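/- arXiv:2408.01513 — 3 statements merged into one kernel-verified Lean document; each statement's English description precedes it below -/
import Mathlib

section
/- There exists a universal constant γ₊ > 0 such that: (a) for all functions h, w : ℤ⁺ → ℤ⁺ with √h ≻ 1 and w ≻ √h, one has L[h, w] ∼ γ₊·w·√h; and (b) for every nondecreasing function η : ℤ⁺ → ℤ⁺ satisfying √(η(n)) ≺ n, √(η(n)) ≻ 1, and η(n) ≺ Σ_{i=1}^n √(η(i)), one has ln KPF[(η(1), η(2), …, η(n))] ∼ γ₊·Σ_{i=1}^n √(η(i)) as n → ∞. -/
open Filter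

/-- A Kostant picture of height `η`. -/
def IsKostant {w : ℕ} (η : Fin w → ℕ) (c : Fin w → Fin w → ℕ) : Prop :=
  (∀ i j : Fin w, j < i → c i j = 0) ∧
  ∀ m : Fin w, (∑ i : Fin w, ∑ j : Fin w, (if i ≤ m ∧ m ≤ j then c i j else 0)) = η m

/-- Kostant's partition function. -/
noncomputable def KPF {w : ℕ} (η : Fin w → ℕ) : ℕ :=
  Set.ncard {c : Fin w → Fin w → ℕ | IsKostant η c}

/-- `L[h,w] = ln KPF[(h,…,h)]` for the constant tuple of length `w`. -/
noncomputable def Lbox (h w : ℕ) : ℝ := Real.log (KPF (fun _ : Fin w => h))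

/-- The height of a picture `c` above the position `m`. -/
def pictureHeight {w : ℕ} (c : Fin w → Fin w → ℕ) (m : Fin w) : ℕ :=
  ∑ i : Fin w, ∑ j : Fin w, if i ≤ m ∧ m ≤ j then c i j else 0

lemma isKostant_iff {w : ℕ} (η : Fin w → ℕ) (c : Fin w → Fin w → ℕ) :
    IsKostant η c ↔ (∀ i j : Fin w, j < i → c i j = 0) ∧ ∀ m, pictureHeight c m = η m :=
  Iff.rfl

lemma pictureHeight_add {w : ℕ} (c d : Fin w → Fin w → ℕ) (m : Fin w) :
    pictureHeight (fun i j => c i j + d i j) m = pictureHeight c m + pictureHeight d m := by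
  simp only [pictureHeight, ← Finset.sum_add_distrib]
  refine Finset.sum_congr rfl fun i _ => Finset.sum_congr rfl fun j _ => ?_
  split_ifs <;> rfl

lemma pictureHeight_diag {w : ℕ} (e : Fin w → ℕ) (m : Fin w) :
    pictureHeight (fun i j => if i = j then e i else 0) m = e m := by
  unfold pictureHeight
  rw [Finset.sum_eq_single m]
  · rw [Finset.sum_eq_single m]
    · simp
    · intro j _ hj
      simp [Ne.symm hj]
    · simp
  · intro i _ hi
    refine Finset.sum_eq_zero fun j _ => ?_
    rw [ite_eq_right_iff]
    rintro ⟨h1, h2⟩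
    refine if_neg ?_
    rintro rfl
    exact hi (le_antisymm h1 h2)
  · simp

lemma IsKostant.le {w : ℕ} {η : Fin w → ℕ} {c : Fin w → Fin w → ℕ} (h : IsKostant η c)
    (i j : Fin w) : c i j ≤ η i := by
  rcases lt_or_ge j i with hji | hij
  · simp [h.1 i j hji]
  · rw [← h.2 i]
    calc c i j = (if i ≤ i ∧ i ≤ j then c i j else 0) := by simp [hij]
      _ ≤ ∑ j' : Fin w, (if i ≤ i ∧ i ≤ j' then c i j' else 0) :=
          Finset.single_le_sum (f := fun j' => if i ≤ i ∧ i ≤ j' then c i j' else 0)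
            (fun _ _ => Nat.zero_le _) (Finset.mem_univ j)
      _ ≤ _ := Finset.single_le_sum
            (f := fun i' => ∑ j' : Fin w, (if i' ≤ i ∧ i ≤ j' then c i' j' else 0))
            (fun _ _ => Nat.zero_le _) (Finset.mem_univ i)

lemma finite_setOf_isKostant {w : ℕ} (η : Fin w → ℕ) :
    {c : Fin w → Fin w → ℕ | IsKostant η c}.Finite :=
  (Set.finite_Icc (0 : Fin w → Fin w → ℕ) (fun i _ => η i)).subset
    fun _ hc => ⟨fun _ _ => Nat.zero_le _, fun i j => hc.le i j⟩

lemma ncard_le_KPF_of_injOn {α : Type*} {w : ℕ} {η : Fin w → ℕ} (s : Set α)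
    (Φ : α → Fin w → Fin w → ℕ) (hΦ : ∀ a ∈ s, IsKostant η (Φ a)) (hinj : Set.InjOn Φ s) :
    s.ncard ≤ KPF η :=
  Set.ncard_le_ncard_of_injOn Φ hΦ hinj (finite_setOf_isKostant η)

lemma KPF_mono {w : ℕ} {η η' : Fin w → ℕ} (h : ∀ i, η i ≤ η' i) : KPF η ≤ KPF η' := by
  refine ncard_le_KPF_of_injOn _
    (fun c i j => c i j + if i = j then η' i - η i else 0) ?_ ?_
  · intro c hc
    refine (isKostant_iff _ _).2 ⟨fun i j hij => ?_, fun m => ?_⟩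
    · simp [hc.1 i j hij, hij.ne']
    · rw [pictureHeight_add, pictureHeight_diag, ((isKostant_iff _ _).1 hc).2 m]
      exact Nat.add_sub_cancel' (h m)
  · intro c _ d _ hcd
    funext i j
    exact Nat.add_right_cancel (congrFun (congrFun hcd i) j)

lemma KPF_pos {w : ℕ} (η : Fin w → ℕ) : 0 < KPF η := by
  refine (Set.ncard_pos (finite_setOf_isKostant η)).2
    ⟨fun i j => if i = j then η i else 0, (isKostant_iff _ _).2 ⟨fun i j hij => ?_, fun m => ?_⟩⟩
  · simp [hij.ne']
  · exact pictureHeight_diag η m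

/-- Pictures without one-point intervals may have height smaller than prescribed, since the
one-point intervals can be used to fill the defect. -/
lemma ncard_le_KPF_of_pictureHeight_le {α : Type*} {w : ℕ} {η : Fin w → ℕ} (s : Set α)
    (Φ : α → Fin w → Fin w → ℕ) (hdiag : ∀ a ∈ s, ∀ i j, j ≤ i → Φ a i j = 0)
    (hle : ∀ a ∈ s, ∀ m, pictureHeight (Φ a) m ≤ η m) (hinj : Set.InjOn Φ s) :
    s.ncard ≤ KPF η := by
  refine ncard_le_KPF_of_injOn s
    (fun a i j => Φ a i j + if i = j then η i - pictureHeight (Φ a) i else 0) ?_ ?_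
  · intro a ha
    refine (isKostant_iff _ _).2 ⟨fun i j hij => ?_, fun m => ?_⟩
    · simp [hdiag a ha i j hij.le, hij.ne']
    · rw [pictureHeight_add, pictureHeight_diag]
      exact Nat.add_sub_cancel' (hle a ha m)
  · intro a ha b hb hab
    refine hinj ha hb ?_
    funext i j
    rcases le_or_gt j i with hji | hij
    · rw [hdiag a ha i j hji, hdiag b hb i j hji]
    · simpa [hij.ne] using congrFun (congrFun hab i) j

lemma KPF_mul_le_KPF_append (a b : ℕ) (f : ℕ → ℕ) :
    KPF (fun i : Fin a => f i) * KPF (fun i : Fin b => f (a + i)) ≤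
      KPF (fun i : Fin (a + b) => f i) := by
  have hcard : KPF (fun i : Fin a => f i) * KPF (fun i : Fin b => f (a + i)) =
      ({c | IsKostant (fun i : Fin a => f i) c} ×ˢ
        {c | IsKostant (fun i : Fin b => f (a + i)) c}).ncard := by
    rw [Set.ncard_prod]; rfl
  rw [hcard]
  refine ncard_le_KPF_of_injOn _
    (fun p i j => Fin.addCases (fun i' => Fin.addCases (fun j' => p.1 i' j') (fun _ => 0) j)
      (fun i' => Fin.addCases (fun _ => 0) (fun j' => p.2 i' j') j) i) ?_ ?_
  · rintro ⟨c, d⟩ ⟨hc, hd⟩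
    constructor
    · intro i j
      refine Fin.addCases (fun i' => ?_) (fun i' => ?_) i <;>
        refine Fin.addCases (fun j' => ?_) (fun j' => ?_) j
      · intro h
        simpa using hc.1 i' j' h
      · simp
      · simp
      · intro h
        simpa using hd.1 i' j' ((Fin.natAdd_lt_natAdd_iff a).1 h)
    · have hcast : ∀ i j : Fin a, Fin.castAdd b i ≤ Fin.castAdd b j ↔ i ≤ j := fun _ _ => Iff.rfl
      have key : ∀ i : Fin a, ∀ j : Fin b, ¬ (Fin.natAdd a j ≤ Fin.castAdd b i) := by
        intro i j h
        have := i.2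
        simp only [Fin.le_def, Fin.val_natAdd, Fin.val_castAdd] at h
        omega
      intro m
      refine Fin.addCases (fun m' => ?_) (fun m' => ?_) m
      · have := hc.2 m'
        simpa [Fin.sum_univ_add, key, hcast] using this
      · have := hd.2 m'
        simpa [Fin.sum_univ_add, key, hcast] using this
  · rintro ⟨c, d⟩ _ ⟨c', d'⟩ _ h
    refine Prod.ext ?_ ?_
    · funext i j
      simpa using congrFun (congrFun h (Fin.castAdd b i)) (Fin.castAdd b j)
    · funext i j
      simpa using congrFun (congrFun h (Fin.natAdd a i)) (Fin.natAdd a j)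

/-- Pictures in which the number of intervals from block `p.1` to block `p.2` is prescribed. -/
lemma prod_multichoose_le_KPF (B k h : ℕ) (M : Fin B × Fin B → ℕ)
    (hM0 : ∀ b b', b' ≤ b → M (b, b') = 0)
    (hMh : ∀ m : Fin B, ∑ p : Fin B × Fin B, (if p.1 ≤ m ∧ m ≤ p.2 then M p else 0) ≤ h) :
    ∏ p : Fin B × Fin B, Nat.multichoose (k * k) (M p) ≤ KPF (fun _ : Fin (B * k) => h) := by
  classical
  set s : Finset (Fin B × Fin B → (Fin k × Fin k →₀ ℕ)) :=
    Fintype.piFinset fun p => Finset.finsuppAntidiag Finset.univ (M p) with hs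
  have hcard : ∏ p : Fin B × Fin B, Nat.multichoose (k * k) (M p) =
      (s : Set (Fin B × Fin B → (Fin k × Fin k →₀ ℕ))).ncard := by
    rw [Set.ncard_coe_finset, hs, Fintype.card_piFinset]
    simp [Finset.card_finsuppAntidiag_nat_eq_multichoose]
  have hmem : ∀ F ∈ s, ∀ p, ∑ r, F p r = M p := by
    intro F hF p
    have := (Fintype.mem_piFinset.1 hF) p
    rw [Finset.mem_finsuppAntidiag] at this
    exact this.1
  rw [hcard]
  refine ncard_le_KPF_of_pictureHeight_le _
    (fun F u v => F ((finProdFinEquiv.symm u).1, (finProdFinEquiv.symm v).1)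
      ((finProdFinEquiv.symm u).2, (finProdFinEquiv.symm v).2)) ?_ ?_ ?_
  · intro F hF u v huv
    have h1 : (finProdFinEquiv.symm v).1 ≤ (finProdFinEquiv.symm u).1 := by
      simp only [finProdFinEquiv, Equiv.coe_fn_symm_mk, Fin.le_def, Fin.coe_divNat]
      exact Nat.div_le_div_right huv
    have h2 := hmem F hF ((finProdFinEquiv.symm u).1, (finProdFinEquiv.symm v).1)
    rw [hM0 _ _ h1] at h2
    exact (Finset.sum_eq_zero_iff.1 h2) _ (Finset.mem_univ _)
  · intro F hF m
    refine le_trans ?_ (hMh (finProdFinEquiv.symm m).1)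
    unfold pictureHeight
    rw [← finProdFinEquiv.sum_comp]
    simp_rw [← finProdFinEquiv.sum_comp (fun j => if _ ∧ m ≤ j then _ else 0)]
    simp only [Equiv.symm_apply_apply]
    rw [← Finset.sum_product', Finset.univ_product_univ, ← (Equiv.prodProdProdComm _ _ _ _).sum_comp]
    rw [← Finset.univ_product_univ, Finset.sum_product]
    refine Finset.sum_le_sum fun p _ => ?_
    split_ifs with hp
    · rw [← hmem F hF p]
      refine Finset.sum_le_sum fun r _ => ?_
      simp only [Equiv.prodProdProdComm_apply]
      split_ifs <;> simp
    · refine (Finset.sum_eq_zero fun r _ => ?_).le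
      rw [if_neg]
      rintro ⟨h1, h2⟩
      refine hp ⟨?_, ?_⟩
      · have : (finProdFinEquiv.symm (finProdFinEquiv (p.1, r.1))).1 ≤
            (finProdFinEquiv.symm m).1 := by
          simp only [finProdFinEquiv, Equiv.coe_fn_symm_mk, Fin.le_def, Fin.coe_divNat]
          exact Nat.div_le_div_right h1
        simpa using this
      · have : (finProdFinEquiv.symm m).1 ≤
            (finProdFinEquiv.symm (finProdFinEquiv (p.2, r.2))).1 := by
          simp only [finProdFinEquiv, Equiv.coe_fn_symm_mk, Fin.le_def, Fin.coe_divNat]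
          exact Nat.div_le_div_right h2
        simpa using this
  · intro F _ G _ h
    funext p
    ext r
    have := congrFun (congrFun h (finProdFinEquiv (p.1, r.1))) (finProdFinEquiv (p.2, r.2))
    simpa using this

lemma prod_pow_eq_of_isKostant {w : ℕ} {η : Fin w → ℕ} {c : Fin w → Fin w → ℕ}
    (hc : IsKostant η c) (x : Fin w → ℝ) :
    ∏ m, x m ^ η m = ∏ p : Fin w × Fin w, (∏ m ∈ Finset.Icc p.1 p.2, x m) ^ c p.1 p.2 := by
  have h1 : ∀ p : Fin w × Fin w, (∏ m ∈ Finset.Icc p.1 p.2, x m) ^ c p.1 p.2 =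
      ∏ m, x m ^ (if p.1 ≤ m ∧ m ≤ p.2 then c p.1 p.2 else 0) := by
    intro p
    rw [← Finset.prod_pow]
    simp only [pow_ite, pow_zero, ← Finset.mem_Icc, Finset.prod_ite_mem, Finset.univ_inter]
  simp_rw [h1]
  rw [Finset.prod_comm]
  refine Finset.prod_congr rfl fun m _ => ?_
  rw [Finset.prod_pow_eq_pow_sum, ← hc.2 m, Fintype.sum_prod_type]

lemma KPF_mul_prod_pow_le {w : ℕ} (η : Fin w → ℕ) (x : Fin w → ℝ) (hx0 : ∀ m, 0 < x m)
    (hx1 : ∀ m, x m < 1) :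
    (KPF η : ℝ) * ∏ m, x m ^ η m ≤
      ∏ p : Fin w × Fin w,
        if p.1 ≤ p.2 then (1 - ∏ m ∈ Finset.Icc p.1 p.2, x m)⁻¹ else 1 := by
  classical
  set y : Fin w × Fin w → ℝ := fun p => ∏ m ∈ Finset.Icc p.1 p.2, x m with hy
  have hy0 : ∀ p, 0 < y p := fun p => Finset.prod_pos fun m _ => hx0 m
  have hy1 : ∀ p : Fin w × Fin w, p.1 ≤ p.2 → y p < 1 := by
    intro p hp
    have hmem : p.1 ∈ Finset.Icc p.1 p.2 := Finset.left_mem_Icc.2 hp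
    rw [hy]
    simp only [← Finset.mul_prod_erase _ _ hmem]
    exact mul_lt_one_of_nonneg_of_lt_one_left (hx0 _).le (hx1 _)
      (Finset.prod_le_one (fun m _ => (hx0 m).le) fun m _ => (hx1 m).le)
  set t : Fin w × Fin w → Finset ℕ := fun p =>
    if p.1 ≤ p.2 then Finset.range (η p.1 + 1) else {0} with ht
  set S := (finite_setOf_isKostant η).toFinset with hS
  have hcard : KPF η = S.card := Set.ncard_eq_toFinset_card _ _
  calc (KPF η : ℝ) * ∏ m, x m ^ η m = ∑ c ∈ S, ∏ p, y p ^ c p.1 p.2 := by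
        rw [hcard, ← nsmul_eq_mul, ← Finset.sum_const]
        refine Finset.sum_congr rfl fun c hc => ?_
        exact prod_pow_eq_of_isKostant (by simpa [hS] using hc) x
    _ = ∑ F ∈ S.image (fun c (p : Fin w × Fin w) => c p.1 p.2), ∏ p, y p ^ F p := by
        rw [Finset.sum_image]
        intro c _ d _ h
        funext i j
        exact congrFun h (i, j)
    _ ≤ ∑ F ∈ Fintype.piFinset t, ∏ p, y p ^ F p := by
        refine Finset.sum_le_sum_of_subset_of_nonneg ?_
          (fun F _ _ => Finset.prod_nonneg fun p _ => (pow_pos (hy0 p) _).le)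
        intro F hF
        obtain ⟨c, hc, rfl⟩ := Finset.mem_image.1 hF
        have hc : IsKostant η c := by simpa [hS] using hc
        refine Fintype.mem_piFinset.2 fun p => ?_
        simp only [ht]
        split_ifs with hp
        · exact Finset.mem_range.2 (Nat.lt_succ_of_le (hc.le _ _))
        · exact Finset.mem_singleton.2 (hc.1 _ _ (not_le.1 hp))
    _ = ∏ p, ∑ j ∈ t p, y p ^ j := (Finset.prod_univ_sum t fun p j => y p ^ j).symm
    _ ≤ _ := by
        refine Finset.prod_le_prod
          (fun p _ => Finset.sum_nonneg fun j _ => (pow_pos (hy0 p) _).le) fun p _ => ?_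
        simp only [ht]
        split_ifs with hp
        · rw [← tsum_geometric_of_lt_one (hy0 p).le (hy1 p hp)]
          exact (summable_geometric_of_lt_one (hy0 p).le (hy1 p hp)).sum_le_tsum _
            fun j _ => (pow_pos (hy0 p) _).le
        · simp

lemma log_KPF_le {w : ℕ} (η : Fin w → ℕ) (μ : Fin w → ℝ) (hμ : ∀ m, 0 < μ m) :
    Real.log (KPF η) ≤ ∑ m, μ m * η m + ∑ j, ∑ i ∈ Finset.Iic j,
      -Real.log (1 - Real.exp (-∑ m ∈ Finset.Icc i j, μ m)) := by
  have h := KPF_mul_prod_pow_le η (fun m => Real.exp (-μ m)) (fun m => Real.exp_pos _)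
    (fun m => by simpa using hμ m)
  have hpos : (0 : ℝ) < KPF η := by exact_mod_cast KPF_pos η
  have hy1 : ∀ p : Fin w × Fin w, p.1 ≤ p.2 →
      0 < 1 - Real.exp (-∑ m ∈ Finset.Icc p.1 p.2, μ m) := by
    intro p hp
    rw [sub_pos, Real.exp_lt_one_iff, neg_lt_zero]
    exact Finset.sum_pos (fun m _ => hμ m) (by simpa using hp)
  have hlog := Real.log_le_log
    (mul_pos hpos (Finset.prod_pos fun m _ => pow_pos (Real.exp_pos _) _)) h
  simp only [← Real.exp_sum, Finset.sum_neg_distrib] at hlog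
  rw [Real.log_mul hpos.ne' (Finset.prod_pos fun m _ => pow_pos (Real.exp_pos _) _).ne',
    Real.log_prod (fun m _ => (pow_pos (Real.exp_pos _) _).ne'),
    Real.log_prod (fun p _ => by
      split_ifs with hp
      · exact (inv_pos.2 (hy1 p hp)).ne'
      · exact one_ne_zero)] at hlog
  have h1 : ∑ m, Real.log (Real.exp (-μ m) ^ η m) = -∑ m, μ m * η m := by
    rw [← Finset.sum_neg_distrib]
    refine Finset.sum_congr rfl fun m _ => ?_
    rw [Real.log_pow, Real.log_exp]; ring
  have h2 : (∑ p : Fin w × Fin w, Real.log (if p.1 ≤ p.2 then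
      (1 - Real.exp (-∑ m ∈ Finset.Icc p.1 p.2, μ m))⁻¹ else 1)) =
      ∑ j, ∑ i ∈ Finset.Iic j, -Real.log (1 - Real.exp (-∑ m ∈ Finset.Icc i j, μ m)) := by
    rw [Fintype.sum_prod_type_right]
    refine Finset.sum_congr rfl fun j _ => ?_
    simp only [apply_ite Real.log, Real.log_inv, Real.log_one, ← Finset.mem_Iic,
      Finset.sum_ite_mem, Finset.univ_inter]
  linarith

lemma exp_neg_mul_le (t : ℝ) : Real.exp (-t) * t ≤ 1 - Real.exp (-t) := by
  have h1 := Real.add_one_le_exp t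
  have h2 : Real.exp (-t) * Real.exp t = 1 := by rw [← Real.exp_add]; simp
  nlinarith [Real.exp_pos (-t)]

lemma sum_exp_neg_pow_le {t : ℝ} (ht : 0 < t) (n : ℕ) :
    ∑ l ∈ Finset.range n, Real.exp (-t) ^ (l + 1) ≤ 1 / t := by
  set u := Real.exp (-t) with hu
  have hu0 : 0 < u := Real.exp_pos _
  have hu1 : u < 1 := by simpa [hu] using ht
  have h1 : ∑ l ∈ Finset.range n, u ^ l ≤ (1 - u)⁻¹ := by
    rw [← tsum_geometric_of_lt_one hu0.le hu1]
    exact (summable_geometric_of_lt_one hu0.le hu1).sum_le_tsum _ fun j _ => (pow_pos hu0 _).le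
  have h2 : u * t ≤ 1 - u := exp_neg_mul_le t
  simp only [pow_succ]
  rw [← Finset.sum_mul]
  calc (∑ l ∈ Finset.range n, u ^ l) * u ≤ (1 - u)⁻¹ * u := by gcongr
    _ ≤ 1 / t := by
      rw [inv_mul_eq_div, div_le_div_iff₀ (by linarith) ht]
      linarith

lemma hasSum_one_div_succ_sq :
    HasSum (fun m : ℕ => 1 / ((m : ℝ) + 1) ^ 2) (Real.pi ^ 2 / 6) := by
  have h := (hasSum_nat_add_iff' 1).2 hasSum_zeta_two
  simpa using h

lemma exp_neg_succ_mul (t : ℝ) (l : ℕ) :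
    Real.exp (-(((l : ℝ) + 1) * t)) = Real.exp (-t) ^ (l + 1) := by
  rw [← Real.exp_nat_mul]
  push_cast
  ring_nf

lemma sum_neg_log_le {t : ℝ} (ht : 0 < t) (n : ℕ) :
    ∑ l ∈ Finset.range n, -Real.log (1 - Real.exp (-(((l : ℝ) + 1) * t))) ≤
      Real.pi ^ 2 / 6 / t := by
  have h1 : HasSum (fun m : ℕ => ∑ l ∈ Finset.range n,
      Real.exp (-(((l : ℝ) + 1) * t)) ^ (m + 1) / ((m : ℝ) + 1))
      (∑ l ∈ Finset.range n, -Real.log (1 - Real.exp (-(((l : ℝ) + 1) * t)))) := by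
    refine hasSum_sum fun l _ => ?_
    refine Real.hasSum_pow_div_log_of_abs_lt_one ?_
    rw [abs_of_pos (Real.exp_pos _), Real.exp_lt_one_iff, neg_lt_zero]
    positivity
  refine hasSum_le (fun m => ?_) h1 (hasSum_one_div_succ_sq.div_const t)
  rw [← Finset.sum_div]
  have h2 := sum_exp_neg_pow_le (t := ((m : ℝ) + 1) * t) (by positivity) n
  have h3 : ∀ l : ℕ, Real.exp (-(((l : ℝ) + 1) * t)) ^ (m + 1) =
      Real.exp (-(((m : ℝ) + 1) * t)) ^ (l + 1) := by
    intro l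
    rw [exp_neg_succ_mul, exp_neg_succ_mul, ← pow_mul, ← pow_mul, mul_comm]
  simp_rw [h3]
  calc _ ≤ 1 / (((m : ℝ) + 1) * t) / ((m : ℝ) + 1) := by gcongr
    _ = _ := by field_simp

lemma log_KPF_le_of_monotone {w : ℕ} (η : Fin w → ℕ) (hη : Monotone η) (hpos : ∀ i, 0 < η i) :
    Real.log (KPF η) ≤ 2 * (Real.pi / √6) * ∑ i, √(η i : ℝ) := by
  set a := Real.pi / √6 with ha
  have ha0 : 0 < a := by positivity
  have ha2 : Real.pi ^ 2 / 6 = a ^ 2 := by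
    rw [ha, div_pow, Real.sq_sqrt (by norm_num)]
  have hsq : ∀ i, 0 < √(η i : ℝ) := fun i => Real.sqrt_pos.2 (by exact_mod_cast hpos i)
  set μ : Fin w → ℝ := fun m => a / √(η m : ℝ) with hμ
  have hμ0 : ∀ m, 0 < μ m := fun m => div_pos ha0 (hsq m)
  refine (log_KPF_le η μ hμ0).trans ?_
  have h1 : ∑ m, μ m * η m = a * ∑ i, √(η i : ℝ) := by
    rw [Finset.mul_sum]
    refine Finset.sum_congr rfl fun m _ => ?_
    have := Real.mul_self_sqrt (Nat.cast_nonneg (α := ℝ) (η m))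
    rw [hμ]
    have := (hsq m).ne'
    field_simp
    nlinarith
  have h2 : ∀ j, ∑ i ∈ Finset.Iic j, -Real.log (1 - Real.exp (-∑ m ∈ Finset.Icc i j, μ m)) ≤
      a * √(η j : ℝ) := by
    intro j
    have hterm : ∀ i ∈ Finset.Iic j, -Real.log (1 - Real.exp (-∑ m ∈ Finset.Icc i j, μ m)) ≤
        -Real.log (1 - Real.exp (-((((j : ℕ) - (i : ℕ) : ℕ) + 1 : ℝ) * μ j))) := by
      intro i hi
      have hij : i ≤ j := Finset.mem_Iic.1 hi
      have hle : (((j : ℕ) - (i : ℕ) : ℕ) + 1 : ℝ) * μ j ≤ ∑ m ∈ Finset.Icc i j, μ m := by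
        have hc : (Finset.Icc i j).card = (j : ℕ) - (i : ℕ) + 1 := by
          rw [Fin.card_Icc]
          have : (i : ℕ) ≤ j := hij
          omega
        have := Finset.card_nsmul_le_sum (Finset.Icc i j) μ (μ j) (fun m hm => by
          have hmj := hη (Finset.mem_Icc.1 hm).2
          refine div_le_div_of_nonneg_left ha0.le (hsq m) (Real.sqrt_le_sqrt ?_)
          exact_mod_cast hmj)
        rw [hc, nsmul_eq_mul] at this
        exact_mod_cast this
      have hp : 0 < (((j : ℕ) - (i : ℕ) : ℕ) + 1 : ℝ) * μ j :=
        mul_pos (by positivity) (hμ0 j)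
      have hlt : Real.exp (-((((j : ℕ) - (i : ℕ) : ℕ) + 1 : ℝ) * μ j)) < 1 := by
        rw [Real.exp_lt_one_iff]; linarith
      refine neg_le_neg (Real.log_le_log (by linarith) ?_)
      have := Real.exp_le_exp.2 (neg_le_neg hle)
      linarith
    refine (Finset.sum_le_sum hterm).trans ?_
    have hre : ∑ i ∈ Finset.Iic j,
        -Real.log (1 - Real.exp (-((((j : ℕ) - (i : ℕ) : ℕ) + 1 : ℝ) * μ j))) =
        ∑ l ∈ Finset.range (j + 1), -Real.log (1 - Real.exp (-(((l : ℝ) + 1) * μ j))) := by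
      refine Finset.sum_bij' (fun i _ => (j : ℕ) - (i : ℕ))
        (fun l _ => ⟨(j : ℕ) - l, lt_of_le_of_lt (Nat.sub_le _ _) j.2⟩) ?_ ?_ ?_ ?_ ?_
      · intro i _
        simp only [Finset.mem_range]
        omega
      · intro l _
        simp only [Finset.mem_Iic, Fin.le_def]
        omega
      · intro i hi
        have : i ≤ j := Finset.mem_Iic.1 hi
        rw [Fin.le_def] at this
        ext
        simp only
        omega
      · intro l hl
        have := Finset.mem_range.1 hl
        simp only
        omega
      · intro i _
        rfl
    rw [hre]
    refine (sum_neg_log_le (hμ0 j) _).trans (le_of_eq ?_)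
    rw [ha2, hμ]
    have := (hsq j).ne'
    field_simp
  have h3 := Finset.sum_le_sum fun j (_ : j ∈ Finset.univ) => h2 j
  rw [← Finset.mul_sum] at h3
  linarith

lemma mul_log_sub_le_log_factorial (n : ℕ) :
    (n : ℝ) * Real.log n - n ≤ Real.log (n.factorial : ℝ) := by
  rcases Nat.eq_zero_or_pos n with rfl | hn
  · simp
  have h := Stirling.le_log_factorial_stirling hn.ne'
  have h1 : 0 ≤ Real.log n := Real.log_natCast_nonneg n
  have h2 : 0 ≤ Real.log (2 * Real.pi) := Real.log_nonneg (by nlinarith [Real.pi_gt_three])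
  linarith

lemma log_factorial_le_mul_log {n : ℕ} (hn : 1 ≤ n) :
    Real.log (n.factorial : ℝ) ≤ n * Real.log n - n + Real.log n + 1 := by
  induction n, hn using Nat.le_induction with
  | base => simp
  | succ n hn ih =>
    have hn0 : (0 : ℝ) < n := by exact_mod_cast hn
    have hfac : ((n.factorial : ℕ) : ℝ) ≠ 0 := by exact_mod_cast n.factorial_ne_zero
    have h1 := Real.one_sub_inv_le_log_of_pos (x := ((n : ℝ) + 1) / n) (by positivity)
    rw [Real.log_div (by positivity) hn0.ne', inv_div] at h1
    have h2 : ((n : ℝ) + 1) * (1 - n / (n + 1)) = 1 := by field_simp; ring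
    have h3 := mul_le_mul_of_nonneg_left h1 (by positivity : (0 : ℝ) ≤ (n : ℝ) + 1)
    rw [Nat.factorial_succ]
    push_cast
    rw [Real.log_mul (by positivity) hfac]
    nlinarith

lemma le_log_choose {a b : ℕ} (ha : 1 ≤ a) (hb : 1 ≤ b) :
    ((a : ℝ) + b) * Real.log (a + b) - a * Real.log a - b * Real.log b
      - Real.log a - Real.log b - 2 ≤ Real.log ((a + b).choose a : ℝ) := by
  have h := Nat.add_choose_mul_factorial_mul_factorial a b
  have hfa : ((a.factorial : ℕ) : ℝ) ≠ 0 := by exact_mod_cast a.factorial_ne_zero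
  have hfb : ((b.factorial : ℕ) : ℝ) ≠ 0 := by exact_mod_cast b.factorial_ne_zero
  have hc : (((a + b).choose a : ℕ) : ℝ) ≠ 0 := by
    exact_mod_cast (Nat.choose_pos (Nat.le_add_right a b)).ne'
  have h' : Real.log (((a + b).choose a : ℕ) : ℝ) + Real.log (a.factorial : ℝ) +
      Real.log (b.factorial : ℝ) = Real.log ((a + b).factorial : ℝ) := by
    rw [← Real.log_mul hc hfa, ← Real.log_mul (mul_ne_zero hc hfa) hfb, ← h,
      ← Nat.choose_symm_add]
    push_cast
    rfl
  have h1 := mul_log_sub_le_log_factorial (a + b)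
  have h2 := log_factorial_le_mul_log ha
  have h3 := log_factorial_le_mul_log hb
  push_cast at h1
  linarith

/-- The entropy of a geometric distribution on `ℕ` with mean `c`. -/
noncomputable def geomEntropy (c : ℝ) : ℝ := (c + 1) * Real.log (c + 1) - c * Real.log c

lemma mul_log_mul {x K : ℝ} (hK : K ≠ 0) :
    K * (x / K * Real.log (x / K)) = x * Real.log x - x * Real.log K := by
  rcases eq_or_ne x 0 with rfl | hx
  · simp
  rw [Real.log_div hx hK]
  field_simp

lemma eventually_le_log_multichoose {c δ : ℝ} (hc : 0 < c) (hδ : 0 < δ) :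
    ∀ᶠ K : ℕ in atTop,
      (K : ℝ) * (geomEntropy c - δ) ≤ Real.log (Nat.multichoose K ⌊c * K⌋₊ : ℝ) := by
  have hφ : Continuous fun x : ℝ => x * Real.log x := Real.continuous_mul_log
  have hcast : Tendsto (fun K : ℕ => (K : ℝ)) atTop atTop := tendsto_natCast_atTop_atTop
  have hN : Tendsto (fun K : ℕ => (⌊c * K⌋₊ : ℝ) / K) atTop (nhds c) :=
    (tendsto_nat_floor_mul_div_atTop hc.le).comp hcast
  have hb : Tendsto (fun K : ℕ => ((K : ℝ) - 1) / K) atTop (nhds 1) := by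
    have h1 : Tendsto (fun K : ℕ => 1 - (K : ℝ)⁻¹) atTop (nhds (1 - 0)) :=
      tendsto_const_nhds.sub (tendsto_inv_atTop_zero.comp hcast)
    rw [sub_zero] at h1
    refine h1.congr' ?_
    filter_upwards [eventually_gt_atTop 0] with K hK
    have : (K : ℝ) ≠ 0 := by exact_mod_cast hK.ne'
    field_simp
  have herr : Tendsto (fun K : ℕ => (Real.log c + 2) * (K : ℝ)⁻¹ + 2 * (Real.log K / K))
      atTop (nhds ((Real.log c + 2) * 0 + 2 * 0)) := by
    refine ((tendsto_inv_atTop_zero.comp hcast).const_mul _).add (Tendsto.const_mul _ ?_)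
    exact (Real.isLittleO_log_id_atTop.tendsto_div_nhds_zero).comp hcast
  have hlim := (((hφ.tendsto _).comp (hN.add hb)).sub ((hφ.tendsto _).comp hN)).sub
    ((hφ.tendsto _).comp hb) |>.sub herr
  have hval : (c + 1) * Real.log (c + 1) - c * Real.log c - 1 * Real.log 1 -
      ((Real.log c + 2) * 0 + 2 * 0) = geomEntropy c := by
    simp [geomEntropy]
  rw [hval] at hlim
  have hev := hlim.eventually (lt_mem_nhds (show geomEntropy c - δ < geomEntropy c by linarith))
  have hbig : ∀ᶠ K : ℕ in atTop, 1 / c ≤ (K : ℝ) := hcast.eventually_ge_atTop _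
  filter_upwards [hev, hbig, eventually_ge_atTop 2] with K hK hKc hK2
  have hK0 : (0 : ℝ) < K := by exact_mod_cast (by omega : 0 < K)
  have hN1 : 1 ≤ ⌊c * K⌋₊ := by
    rw [Nat.one_le_floor_iff]
    rw [div_le_iff₀ hc] at hKc
    linarith
  have hNle : (⌊c * K⌋₊ : ℝ) ≤ c * K := Nat.floor_le (by positivity)
  set N := ⌊c * (K : ℝ)⌋₊ with hNdef
  have hchoose := le_log_choose hN1 (by omega : 1 ≤ K - 1)
  have hsub : ((K - 1 : ℕ) : ℝ) = K - 1 := by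
    rw [Nat.cast_sub (by omega)]; simp
  rw [hsub] at hchoose
  have hmc : Nat.multichoose K N = (N + (K - 1)).choose N := by
    rw [Nat.multichoose_eq]; congr 1; omega
  rw [hmc]
  refine le_trans ?_ hchoose
  have hmul := mul_le_mul_of_nonneg_left hK.le hK0.le
  refine hmul.trans ?_
  simp only [Function.comp]
  rw [← add_div]
  have e1 := mul_log_mul (x := (N : ℝ) + (K - 1)) hK0.ne'
  have e2 := mul_log_mul (x := (N : ℝ)) hK0.ne'
  have e3 := mul_log_mul (x := (K : ℝ) - 1) hK0.ne'
  have e4 : (K : ℝ) * ((Real.log c + 2) * (K : ℝ)⁻¹ + 2 * (Real.log K / K)) =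
      Real.log c + 2 + 2 * Real.log K := by field_simp
  have l1 : Real.log N ≤ Real.log c + Real.log K := by
    rw [← Real.log_mul hc.ne' hK0.ne']
    exact Real.log_le_log (by exact_mod_cast hN1) hNle
  have hK2' : (2 : ℝ) ≤ K := by exact_mod_cast hK2
  have l2 : Real.log ((K : ℝ) - 1) ≤ Real.log K := Real.log_le_log (by linarith) (by linarith)
  have expand : (K : ℝ) * (((N : ℝ) + (K - 1)) / K * Real.log (((N : ℝ) + (K - 1)) / K) -
      (N : ℝ) / K * Real.log ((N : ℝ) / K) - ((K : ℝ) - 1) / K * Real.log (((K : ℝ) - 1) / K) -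
      ((Real.log c + 2) * (K : ℝ)⁻¹ + 2 * (Real.log K / K))) =
      ((N : ℝ) + (K - 1)) * Real.log ((N : ℝ) + (K - 1)) - N * Real.log N -
        ((K : ℝ) - 1) * Real.log ((K : ℝ) - 1) - (Real.log c + 2 + 2 * Real.log K) := by
    rw [mul_sub, mul_sub, mul_sub, e1, e2, e3, e4]; ring
  rw [expand]
  linarith

lemma hasSum_one_div_exp_sub_one {t : ℝ} (ht : 0 < t) :
    HasSum (fun m : ℕ => Real.exp (-t) ^ (m + 1)) (1 / (Real.exp t - 1)) := by
  have hu0 := Real.exp_pos (-t)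
  have hu1 : Real.exp (-t) < 1 := by simpa using ht
  have he : 0 < Real.exp t - 1 := by
    have := Real.add_one_lt_exp ht.ne'
    linarith
  have := (hasSum_geometric_of_lt_one hu0.le hu1).mul_right (Real.exp (-t))
  simp only [← pow_succ] at this
  convert! this using 1
  have hinv : Real.exp (-t) = (Real.exp t)⁻¹ := Real.exp_neg t
  rw [hinv]
  have := (Real.exp_pos t).ne'
  field_simp

lemma hasSum_geomEntropy {t : ℝ} (ht : 0 < t) :
    HasSum (fun m : ℕ => (t + 1 / ((m : ℝ) + 1)) * Real.exp (-t) ^ (m + 1))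
      (geomEntropy (1 / (Real.exp t - 1))) := by
  have hu0 := Real.exp_pos (-t)
  have hu1 : Real.exp (-t) < 1 := by simpa using ht
  have he : 0 < Real.exp t - 1 := by
    have := Real.add_one_lt_exp ht.ne'
    linarith
  have h1 := hasSum_one_div_exp_sub_one ht
  have h2 := Real.hasSum_pow_div_log_of_abs_lt_one (x := Real.exp (-t))
    (by rwa [abs_of_pos hu0])
  have h3 := (h1.mul_left t).add h2
  convert! h3 using 1
  · funext m
    ring
  · have hE := Real.exp_pos t
    have e1 : 1 / (Real.exp t - 1) + 1 = Real.exp t / (Real.exp t - 1) := by field_simp; ring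
    have e2 : 1 - Real.exp (-t) = (Real.exp t - 1) / Real.exp t := by
      rw [Real.exp_neg]; field_simp
    rw [geomEntropy, e1, e2, Real.log_div hE.ne' he.ne', Real.log_div he.ne' hE.ne',
      Real.log_div one_ne_zero he.ne', Real.log_exp, Real.log_one]
    field_simp
    ring

lemma geometric_deriv_le {t : ℝ} (ht : 0 < t) :
    Real.exp (-t) / (1 - Real.exp (-t)) ^ 2 ≤ 1 / t ^ 2 := by
  have h1 : t / 2 ≤ Real.sinh (t / 2) := Real.self_le_sinh_iff.2 (by positivity)
  rw [Real.sinh_eq] at h1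
  have hv := Real.exp_pos (-(t / 2))
  have hvv : Real.exp (-(t / 2)) * Real.exp (t / 2) = 1 := by rw [← Real.exp_add]; simp
  have hu : Real.exp (-t) = Real.exp (-(t / 2)) ^ 2 := by
    rw [← Real.exp_nat_mul]; push_cast; ring_nf
  have hu1 : Real.exp (-t) < 1 := by simpa using ht
  have h2 : Real.exp (-(t / 2)) * t ≤ 1 - Real.exp (-t) := by
    rw [hu]; nlinarith
  rw [div_le_div_iff₀ (pow_pos (by linarith) 2) (by positivity), one_mul]
  calc Real.exp (-t) * t ^ 2 = (Real.exp (-(t / 2)) * t) ^ 2 := by rw [hu]; ring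
    _ ≤ _ := by gcongr

lemma exp_neg_mul_add_two_pow (s : ℝ) (d m : ℕ) :
    Real.exp (-(s * ((d : ℝ) + 2))) ^ (m + 1) =
      Real.exp (-(((m : ℝ) + 1) * s)) ^ (d + 2) := by
  rw [← Real.exp_nat_mul, ← Real.exp_nat_mul]
  push_cast
  ring_nf

lemma hasSum_add_two_mul_pow {u : ℝ} (hu0 : 0 < u) (hu1 : u < 1) :
    HasSum (fun d : ℕ => ((d : ℝ) + 2) * u ^ (d + 2)) (u / (1 - u) ^ 2 - u) := by
  have h := (hasSum_nat_add_iff' 2).2 (hasSum_coe_mul_geometric_of_norm_lt_one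
    (r := u) (by rwa [Real.norm_of_nonneg hu0.le]))
  simpa [Finset.sum_range_succ] using h

lemma hasSum_pow_add_two {u : ℝ} (hu0 : 0 < u) (hu1 : u < 1) :
    HasSum (fun d : ℕ => u ^ (d + 2)) (u ^ 2 / (1 - u)) := by
  have h := (hasSum_geometric_of_lt_one hu0.le hu1).mul_right (u ^ 2)
  simp only [← pow_add] at h
  convert! h using 1
  rw [div_eq_inv_mul]

lemma sum_add_two_div_exp_le {s : ℝ} (hs : 0 < s) (D : ℕ) :
    ∑ d ∈ Finset.range D, ((d : ℝ) + 2) * (1 / (Real.exp (s * ((d : ℝ) + 2)) - 1)) ≤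
      Real.pi ^ 2 / 6 / s ^ 2 := by
  have h1 : HasSum (fun m : ℕ => ∑ d ∈ Finset.range D,
      ((d : ℝ) + 2) * Real.exp (-(s * ((d : ℝ) + 2))) ^ (m + 1))
      (∑ d ∈ Finset.range D, ((d : ℝ) + 2) * (1 / (Real.exp (s * ((d : ℝ) + 2)) - 1))) :=
    hasSum_sum fun d _ => (hasSum_one_div_exp_sub_one (by positivity)).mul_left _
  refine hasSum_le (fun m => ?_) h1 (hasSum_one_div_succ_sq.div_const (s ^ 2))
  have hτ : 0 < ((m : ℝ) + 1) * s := by positivity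
  have hu0 := Real.exp_pos (-(((m : ℝ) + 1) * s))
  have hu1 : Real.exp (-(((m : ℝ) + 1) * s)) < 1 := by
    rw [Real.exp_lt_one_iff]; linarith
  simp_rw [exp_neg_mul_add_two_pow]
  calc _ ≤ Real.exp (-(((m : ℝ) + 1) * s)) / (1 - Real.exp (-(((m : ℝ) + 1) * s))) ^ 2 -
        Real.exp (-(((m : ℝ) + 1) * s)) :=
        sum_le_hasSum _ (fun d _ => by positivity) (hasSum_add_two_mul_pow hu0 hu1)
    _ ≤ 1 / (((m : ℝ) + 1) * s) ^ 2 := by linarith [geometric_deriv_le hτ]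
    _ = _ := by field_simp

lemma tendsto_div_one_sub_exp {k : ℝ} (hk : 0 < k) :
    Tendsto (fun s : ℝ => s / (1 - Real.exp (-(k * s)))) (nhdsWithin 0 (Set.Ioi 0))
      (nhds (1 / k)) := by
  have hd : HasDerivAt (fun s : ℝ => 1 - Real.exp (-(k * s))) k 0 := by
    have h1 : HasDerivAt (fun s : ℝ => -(k * s)) (-k) 0 := by
      simpa using (hasDerivAt_id (0 : ℝ)).const_mul (-k)
    have := (h1.exp).const_sub 1
    simpa using this
  have h := hd.tendsto_slope_zero_right
  have h2 := h.inv₀ hk.ne'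
  rw [one_div]
  refine h2.congr fun s => ?_
  simp [div_eq_mul_inv, mul_comm]

lemma tendsto_scaled_geometric_sums {k : ℝ} (hk : 0 < k) :
    Tendsto (fun s : ℝ => s ^ 2 * (Real.exp (-(k * s)) / (1 - Real.exp (-(k * s))) ^ 2 -
        Real.exp (-(k * s))) + s * (1 / k) * (Real.exp (-(k * s)) ^ 2 / (1 - Real.exp (-(k * s)))))
      (nhdsWithin 0 (Set.Ioi 0)) (nhds (2 * (1 / k ^ 2))) := by
  have h1 := tendsto_div_one_sub_exp hk
  have hu : Tendsto (fun s : ℝ => Real.exp (-(k * s))) (nhdsWithin 0 (Set.Ioi 0)) (nhds 1) := by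
    have : Continuous fun s : ℝ => Real.exp (-(k * s)) := by fun_prop
    have := (this.tendsto 0).mono_left (nhdsWithin_le_nhds (s := Set.Ioi 0))
    simpa using this
  have hs : Tendsto (fun s : ℝ => s) (nhdsWithin 0 (Set.Ioi 0)) (nhds 0) :=
    tendsto_id.mono_left nhdsWithin_le_nhds
  have := (((h1.pow 2).mul hu).sub ((hs.pow 2).mul hu)).add
    ((h1.mul (hu.pow 2)).const_mul (1 / k))
  have hval : (1 / k) ^ 2 * 1 - 0 ^ 2 * 1 + 1 / k * (1 / k * 1 ^ 2) = 2 * (1 / k ^ 2) := by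
    field_simp; ring
  rw [hval] at this
  refine this.congr fun s => ?_
  rw [div_pow]
  ring

/-- Geometric distributions with suitable means are nearly optimal. -/
lemma exists_sum_geomEntropy_gt {r : ℝ} (hr : r < Real.pi ^ 2 / 3) :
    ∃ s : ℝ, 0 < s ∧ ∃ D : ℕ, 0 < D ∧
      r < s * ∑ d ∈ Finset.range D, geomEntropy (1 / (Real.exp (s * ((d : ℝ) + 2)) - 1)) := by
  have h1 : HasSum (fun m : ℕ => 2 * (1 / ((m : ℝ) + 1) ^ 2)) (2 * (Real.pi ^ 2 / 6)) :=
    hasSum_one_div_succ_sq.mul_left 2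
  obtain ⟨M, hM⟩ := (h1.tendsto_sum_nat.eventually
    (lt_mem_nhds (show r < 2 * (Real.pi ^ 2 / 6) by linarith))).exists
  have h2 := tendsto_finsetSum (Finset.range M) fun m _ =>
    tendsto_scaled_geometric_sums (k := (m : ℝ) + 1) (by positivity)
  obtain ⟨s, hsr, hs⟩ := ((h2.eventually (lt_mem_nhds hM)).and self_mem_nhdsWithin).exists
  have hs : 0 < s := hs
  refine ⟨s, hs, ?_⟩
  have hu1 : ∀ m : ℕ, Real.exp (-(((m : ℝ) + 1) * s)) < 1 := by
    intro m
    rw [Real.exp_lt_one_iff, neg_lt_zero]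
    positivity
  have h3 : HasSum (fun d : ℕ => ∑ m ∈ Finset.range M,
      (s ^ 2 * (((d : ℝ) + 2) * Real.exp (-(((m : ℝ) + 1) * s)) ^ (d + 2)) +
        s * (1 / ((m : ℝ) + 1)) * Real.exp (-(((m : ℝ) + 1) * s)) ^ (d + 2))) _ :=
    hasSum_sum fun m _ =>
      ((hasSum_add_two_mul_pow (Real.exp_pos _) (hu1 m)).mul_left (s ^ 2)).add
        ((hasSum_pow_add_two (Real.exp_pos _) (hu1 m)).mul_left (s * (1 / ((m : ℝ) + 1))))
  obtain ⟨D, hD, hD0⟩ := ((h3.tendsto_sum_nat.eventually (lt_mem_nhds hsr)).and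
    (eventually_gt_atTop 0)).exists
  refine ⟨D, hD0, hD.trans_le ?_⟩
  rw [Finset.mul_sum]
  refine Finset.sum_le_sum fun d _ => ?_
  have ht : 0 < s * ((d : ℝ) + 2) := by positivity
  have h4 := sum_le_hasSum (Finset.range M) (fun m _ => by positivity) (hasSum_geomEntropy ht)
  refine le_trans (le_of_eq ?_) (mul_le_mul_of_nonneg_left h4 hs.le)
  rw [Finset.mul_sum]
  refine Finset.sum_congr rfl fun m _ => ?_
  rw [exp_neg_mul_add_two_pow]
  ring

lemma sum_blockPairs_le (B D : ℕ) (N : ℕ → ℕ) (m : Fin B) :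
    ∑ p : Fin B × Fin B, (if p.1 ≤ m ∧ m ≤ p.2 then
      (if p.1 < p.2 ∧ (p.2 : ℕ) - p.1 ≤ D then N ((p.2 : ℕ) - p.1 - 1) else 0) else 0) ≤
      ∑ d ∈ Finset.range D, (d + 2) * N d := by
  classical
  simp only [← ite_and]
  rw [← Finset.sum_filter]
  set S := Finset.univ.filter fun p : Fin B × Fin B =>
    (p.1 ≤ m ∧ m ≤ p.2) ∧ p.1 < p.2 ∧ (p.2 : ℕ) - p.1 ≤ D with hS
  have hmem : ∀ p ∈ S, (p.1 : ℕ) ≤ m ∧ (m : ℕ) ≤ p.2 ∧ (p.1 : ℕ) < p.2 ∧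
      (p.2 : ℕ) - p.1 ≤ D := by
    intro p hp
    have := (Finset.mem_filter.1 hp).2
    exact ⟨this.1.1, this.1.2, this.2.1, this.2.2⟩
  rw [← Finset.sum_fiberwise_of_maps_to (s := S) (t := Finset.range D)
    (g := fun p => (p.2 : ℕ) - p.1 - 1) (fun p hp => by
      have := hmem p hp
      simp only [Finset.mem_range]
      omega)]
  refine Finset.sum_le_sum fun d _ => ?_
  rw [Finset.sum_congr rfl fun p hp => by rw [(Finset.mem_filter.1 hp).2], Finset.sum_const,
    smul_eq_mul]
  refine Nat.mul_le_mul_right _ ?_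
  rw [← Finset.card_range (d + 2)]
  refine Finset.card_le_card_of_injOn (fun p => (m : ℕ) - p.1) ?_ ?_
  · intro p hp
    have hp := Finset.mem_filter.1 hp
    have h1 := hmem p hp.1
    have h2 := hp.2
    simp only [Finset.coe_range, Set.mem_Iio]
    omega
  · intro p hp q hq hpq
    have hp := Finset.mem_filter.1 hp
    have hq := Finset.mem_filter.1 hq
    have h1 := hmem p hp.1
    have h2 := hmem q hq.1
    have h3 := hp.2
    have h4 := hq.2
    simp only at hpq
    refine Prod.ext (Fin.ext ?_) (Fin.ext ?_) <;> omega

lemma sum_log_multichoose_le_Lbox {B k h D : ℕ} (hk : 0 < k) (N : ℕ → ℕ)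
    (hN : ∑ d ∈ Finset.range D, (d + 2) * N d ≤ h) :
    ((B - D : ℕ) : ℝ) * ∑ d ∈ Finset.range D, Real.log (Nat.multichoose (k * k) (N d) : ℝ) ≤
      Lbox h (B * k) := by
  classical
  set M : Fin B × Fin B → ℕ := fun p =>
    if p.1 < p.2 ∧ (p.2 : ℕ) - p.1 ≤ D then N ((p.2 : ℕ) - p.1 - 1) else 0 with hM
  have hmc : ∀ n, 0 < Nat.multichoose (k * k) n := by
    intro n
    rw [Nat.multichoose_eq]
    refine Nat.choose_pos ?_
    have := Nat.mul_pos hk hk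
    omega
  have h1 := prod_multichoose_le_KPF B k h M
    (fun b b' hb => if_neg fun hlt => absurd hlt.1 (not_lt.2 hb))
    (fun m => (sum_blockPairs_le B D N m).trans hN)
  have h2 : ∑ p, Real.log (Nat.multichoose (k * k) (M p) : ℝ) ≤ Lbox h (B * k) := by
    rw [← Real.log_prod fun p _ => by exact_mod_cast (hmc _).ne']
    refine Real.log_le_log (Finset.prod_pos fun p _ => by exact_mod_cast hmc _) ?_
    exact_mod_cast h1
  refine le_trans ?_ h2
  let e : Fin (B - D) × Fin D → Fin B × Fin B := fun x =>
    (⟨x.1, by omega⟩, ⟨(x.1 : ℕ) + x.2 + 1, by omega⟩)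
  have he : Function.Injective e := by
    rintro ⟨a, b⟩ ⟨a', b'⟩ h
    simp only [e, Prod.mk.injEq, Fin.mk.injEq] at h
    refine Prod.ext (Fin.ext ?_) (Fin.ext ?_) <;> simp only <;> omega
  calc _ = ∑ x : Fin (B - D) × Fin D, Real.log (Nat.multichoose (k * k) (M (e x)) : ℝ) := by
        have hMe : ∀ x, M (e x) = N x.2 := by
          intro x
          have hx := x.2.2
          simp only [hM, e, Fin.mk_lt_mk]
          rw [if_pos (by omega)]
          congr 1
          omega
        simp_rw [hMe]
        rw [Fintype.sum_prod_type]
        dsimp only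
        rw [Finset.sum_const, Finset.card_univ, Fintype.card_fin,
          nsmul_eq_mul, ← Fin.sum_univ_eq_sum_range
            (fun d => Real.log (Nat.multichoose (k * k) (N d) : ℝ))]
    _ = ∑ p ∈ Finset.univ.map ⟨e, he⟩, Real.log (Nat.multichoose (k * k) (M p) : ℝ) := by
        rw [Finset.sum_map]; rfl
    _ ≤ _ := Finset.sum_le_sum_of_subset_of_nonneg (Finset.subset_univ _)
        fun p _ _ => Real.log_natCast_nonneg _

lemma log_KPF_add_ge (a b : ℕ) (f : ℕ → ℕ) :
    Real.log (KPF fun i : Fin a => f i) + Real.log (KPF fun i : Fin b => f (a + i)) ≤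
      Real.log (KPF fun i : Fin (a + b) => f i) := by
  have h1 : (0 : ℝ) < KPF fun i : Fin a => f i := by exact_mod_cast KPF_pos _
  have h2 : (0 : ℝ) < KPF fun i : Fin b => f (a + i) := by exact_mod_cast KPF_pos _
  rw [← Real.log_mul h1.ne' h2.ne']
  refine Real.log_le_log (mul_pos h1 h2) ?_
  exact_mod_cast KPF_mul_le_KPF_append a b f

lemma log_KPF_mono_width {a b : ℕ} (hab : a ≤ b) (f : ℕ → ℕ) :
    Real.log (KPF fun i : Fin a => f i) ≤ Real.log (KPF fun i : Fin b => f i) := by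
  obtain ⟨r, rfl⟩ := Nat.exists_eq_add_of_le hab
  have h1 := log_KPF_add_ge a r f
  have h2 := Real.log_natCast_nonneg (KPF fun i : Fin r => f (a + i))
  linarith

lemma Lbox_ge_of_profile {c : ℕ → ℝ} (hc : ∀ d, 0 < c d) {D : ℕ} (hD : 0 < D) {ρ : ℝ}
    (hρ0 : 0 < ρ)
    (hρ : ρ * √(∑ d ∈ Finset.range D, ((d : ℝ) + 2) * c d) <
      ∑ d ∈ Finset.range D, geomEntropy (c d)) :
    ∃ K : ℝ, 0 < K ∧ ∀ h w : ℕ, K ≤ h → K * √(h : ℝ) ≤ w → ρ * w * √(h : ℝ) ≤ Lbox h w := by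
  set H := ∑ d ∈ Finset.range D, ((d : ℝ) + 2) * c d with hH
  set G := ∑ d ∈ Finset.range D, geomEntropy (c d) with hG
  have hD' : (0 : ℝ) < D := by exact_mod_cast hD
  have hH0 : 0 < H := Finset.sum_pos (fun d _ => mul_pos (by positivity) (hc d)) (by simpa using hD.ne')
  set q := √H with hq
  have hq0 : 0 < q := Real.sqrt_pos.2 hH0
  have hqq : q * q = H := Real.mul_self_sqrt hH0.le
  set G' := (G + ρ * q) / 2 with hG'
  have hG'1 : ρ * q < G' := by rw [hG']; linarith
  have hG'2 : G' < G := by rw [hG']; linarith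
  have hG'0 : 0 < G' := (mul_pos hρ0 hq0).trans hG'1
  set δ := (G - G') / D with hδ
  have hδ0 : 0 < δ := div_pos (by linarith) hD'
  have hev : ∀ᶠ K : ℕ in atTop, ∀ d ∈ Finset.range D,
      (K : ℝ) * (geomEntropy (c d) - δ) ≤ Real.log (Nat.multichoose K ⌊c d * K⌋₊ : ℝ) :=
    (Filter.eventually_all_finset _).2 fun d _ => eventually_le_log_multichoose (hc d) hδ0
  obtain ⟨k₀, hk₀⟩ := eventually_atTop.1 hev
  set θ := ρ * q / G' with hθ
  have hθ0 : 0 < θ := div_pos (mul_pos hρ0 hq0) hG'0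
  have hθ1 : θ < 1 := (div_lt_one hG'0).2 hG'1
  set τ := (1 - θ) / 2 with hτ
  have hτ0 : 0 < τ := by rw [hτ]; linarith
  have hτ1 : τ < 1 := by rw [hτ]; linarith
  set X := max (1 / τ) ((k₀ : ℝ) + 1) with hX
  have hX1 : 1 / τ ≤ X := le_max_left _ _
  have hX2 : (k₀ : ℝ) + 1 ≤ X := le_max_right _ _
  have hX0 : 0 < X := lt_of_lt_of_le (by positivity) hX2
  refine ⟨max (H * X ^ 2) ((D + 1) / τ / q), lt_max_of_lt_left (by positivity), ?_⟩
  intro h w hh hw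
  have hh' : H * X ^ 2 ≤ h := (le_max_left _ _).trans hh
  have hw' : (D + 1) / τ / q * √(h : ℝ) ≤ w :=
    (mul_le_mul_of_nonneg_right (le_max_right _ _) (Real.sqrt_nonneg _)).trans hw
  set x := √(h : ℝ) / q with hx
  have hsh : √(h : ℝ) = x * q := by rw [hx]; field_simp
  have hxX : X ≤ x := by
    rw [hx, le_div_iff₀ hq0]
    refine Real.le_sqrt_of_sq_le ?_
    have e : (X * q) ^ 2 = H * X ^ 2 := by rw [← hqq]; ring
    rwa [e]
  have hx0 : 0 < x := hX0.trans_le hxX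
  set k := ⌊x⌋₊ with hk
  have hkx : (k : ℝ) ≤ x := Nat.floor_le hx0.le
  have hxk : x - 1 ≤ k := by have := Nat.lt_floor_add_one x; linarith
  have hkk : k₀ + 1 ≤ k := Nat.le_floor (by push_cast; linarith)
  have hk0 : 0 < k := by omega
  set B := w / k with hB
  have hBk : B * k ≤ w := Nat.div_mul_le_self w k
  have hBw : (w : ℝ) - k ≤ B * k := by
    have := Nat.lt_div_mul_add hk0 (a := w)
    have h2 : (w : ℝ) < ((w / k * k + k : ℕ) : ℝ) := by exact_mod_cast this
    push_cast at h2
    rw [hB]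
    linarith
  have hheight : ∑ d ∈ Finset.range D, (d + 2) * ⌊c d * ((k * k : ℕ) : ℝ)⌋₊ ≤ h := by
    have hreal : ∑ d ∈ Finset.range D, ((d : ℝ) + 2) * (⌊c d * ((k * k : ℕ) : ℝ)⌋₊ : ℝ) ≤ h := by
      calc _ ≤ ∑ d ∈ Finset.range D, ((d : ℝ) + 2) * (c d * ((k * k : ℕ) : ℝ)) := by
            refine Finset.sum_le_sum fun d _ => ?_
            have := hc d
            gcongr
            exact Nat.floor_le (by positivity)
        _ = H * (k * k) := by
            rw [hH, Finset.sum_mul]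
            refine Finset.sum_congr rfl fun d _ => ?_
            push_cast; ring
        _ ≤ H * (x * x) := by gcongr
        _ = √(h : ℝ) * √(h : ℝ) := by rw [hsh, ← hqq]; ring
        _ = h := Real.mul_self_sqrt (Nat.cast_nonneg _)
    exact_mod_cast hreal
  have hmain := sum_log_multichoose_le_Lbox (B := B) (D := D) hk0 _ hheight
  have hent : ((k : ℝ) * k) * G' ≤
      ∑ d ∈ Finset.range D, Real.log (Nat.multichoose (k * k) ⌊c d * ((k * k : ℕ) : ℝ)⌋₊ : ℝ) := by
    have hge : k₀ ≤ k * k := by nlinarith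
    calc ((k : ℝ) * k) * G' =
        ∑ d ∈ Finset.range D, ((k * k : ℕ) : ℝ) * (geomEntropy (c d) - δ) := by
          rw [← Finset.mul_sum, Finset.sum_sub_distrib, ← hG, Finset.sum_const, Finset.card_range,
            nsmul_eq_mul, hδ]
          push_cast
          field_simp
          ring
      _ ≤ _ := Finset.sum_le_sum fun d hd => hk₀ _ hge d hd
  have hwidth : Lbox h (B * k) ≤ Lbox h w := log_KPF_mono_width hBk fun _ => h
  have hBD : (B : ℝ) - D ≤ ((B - D : ℕ) : ℝ) := by
    rw [sub_le_iff_le_add]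
    have h1 : B ≤ (B - D) + D := by omega
    exact_mod_cast h1
  have hk' : (0 : ℝ) < k := by exact_mod_cast hk0
  have hwx : ((D : ℝ) + 1) * x ≤ τ * w := by
    have e : (D + 1) / τ / q * √(h : ℝ) = (D + 1) * x / τ := by rw [hsh]; field_simp
    rw [e, div_le_iff₀ hτ0] at hw'
    linarith
  have hx1 : 1 ≤ τ * x := by
    have := hX1.trans hxX
    rw [div_le_iff₀ hτ0] at this
    linarith
  have hθG : ρ * q = θ * G' := by rw [hθ]; field_simp
  have hw0 : (0 : ℝ) ≤ w := Nat.cast_nonneg w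
  calc ρ * w * √(h : ℝ) = θ * (w * x) * G' := by
        rw [hsh]
        linear_combination (w * x) * hθG
    _ ≤ (((1 - τ) * w) * ((1 - τ) * x)) * G' := by
        have : θ ≤ (1 - τ) * (1 - τ) := by
          have : θ = 1 - 2 * τ := by rw [hτ]; ring
          nlinarith
        have h2 := mul_le_mul_of_nonneg_right this (mul_nonneg hw0 hx0.le)
        refine mul_le_mul_of_nonneg_right (h2.trans (le_of_eq (by ring))) hG'0.le
    _ ≤ (((B : ℝ) - D) * k * k) * G' := by
        refine mul_le_mul_of_nonneg_right ?_ hG'0.le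
        have hkx' : ((D : ℝ) + 1) * k ≤ ((D : ℝ) + 1) * x := by gcongr
        have e1 : (1 - τ) * w ≤ ((B : ℝ) - D) * k := by linarith
        have e2 : (1 - τ) * x ≤ k := by linarith
        exact mul_le_mul e1 e2 (mul_nonneg (by linarith) hx0.le)
          ((mul_nonneg (by linarith) hw0).trans e1)
    _ = ((B : ℝ) - D) * ((k * k) * G') := by ring
    _ ≤ ((B - D : ℕ) : ℝ) * ((k * k) * G') :=
        mul_le_mul_of_nonneg_right hBD (by positivity)
    _ ≤ _ := mul_le_mul_of_nonneg_left hent (Nat.cast_nonneg _)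
    _ ≤ Lbox h (B * k) := hmain
    _ ≤ Lbox h w := hwidth

lemma Lbox_ge {ρ : ℝ} (hρ0 : 0 < ρ) (hρ : ρ < 2 * (Real.pi / √6)) :
    ∃ K : ℝ, 0 < K ∧ ∀ h w : ℕ, K ≤ h → K * √(h : ℝ) ≤ w → ρ * w * √(h : ℝ) ≤ Lbox h w := by
  set a := Real.pi / √6 with ha
  have ha0 : 0 < a := by positivity
  have ha2 : Real.pi ^ 2 / 6 = a ^ 2 := by
    rw [ha, div_pow, Real.sq_sqrt (by norm_num)]
  obtain ⟨s, hs, D, hD, hsD⟩ := exists_sum_geomEntropy_gt (r := ρ * a) (by nlinarith)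
  have hc : ∀ d : ℕ, 0 < 1 / (Real.exp (s * ((d : ℝ) + 2)) - 1) := by
    intro d
    have : 0 < s * ((d : ℝ) + 2) := by positivity
    have := Real.add_one_lt_exp this.ne'
    exact one_div_pos.2 (by linarith)
  refine Lbox_ge_of_profile hc hD hρ0 ?_
  have h1 : √(∑ d ∈ Finset.range D, ((d : ℝ) + 2) * (1 / (Real.exp (s * ((d : ℝ) + 2)) - 1))) ≤
      a / s := by
    refine Real.sqrt_le_iff.2 ⟨by positivity, ?_⟩
    rw [div_pow, ← ha2]
    exact sum_add_two_div_exp_le hs D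
  refine (mul_le_mul_of_nonneg_left h1 hρ0.le).trans_lt ?_
  rw [← mul_div_assoc, div_lt_iff₀ hs]
  linarith

lemma Lbox_le {h w : ℕ} (hh : 0 < h) : Lbox h w ≤ 2 * (Real.pi / √6) * w * √(h : ℝ) := by
  have := log_KPF_le_of_monotone (fun _ : Fin w => h) monotone_const fun _ => hh
  rw [Finset.sum_const, Finset.card_univ, Fintype.card_fin, nsmul_eq_mul, ← mul_assoc] at this
  exact this

lemma sum_Lbox_le_log_KPF {η : ℕ → ℕ} (hη : Monotone η) (W m : ℕ) :
    ∑ b ∈ Finset.range m, Lbox (η (b * W + 1)) W ≤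
      Real.log (KPF fun i : Fin (m * W) => η ((i : ℕ) + 1)) := by
  induction m with
  | zero => simpa using Real.log_natCast_nonneg _
  | succ m ih =>
    rw [Finset.sum_range_succ]
    have h1 := log_KPF_add_ge (m * W) W fun i => η (i + 1)
    have h2 : Lbox (η (m * W + 1)) W ≤
        Real.log (KPF fun i : Fin W => η (m * W + i + 1)) := by
      refine Real.log_le_log (by exact_mod_cast KPF_pos _) ?_
      exact_mod_cast KPF_mono fun i : Fin W => hη (by omega : m * W + 1 ≤ m * W + i + 1)
    rw [Nat.succ_mul]
    linarith

lemma sum_le_sum_block_starts {a : ℕ → ℝ} (ha : Monotone a) (W m : ℕ) :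
    ∑ i ∈ Finset.range (m * W), a (i + 1) ≤
      ∑ b ∈ Finset.range m, W * a (b * W + 1) + W * (a (m * W) - a 0) := by
  induction m with
  | zero => simp
  | succ m ih =>
    have h1 : ∑ i ∈ Finset.range W, a (m * W + i + 1) ≤ W * a ((m + 1) * W) := by
      calc _ ≤ ∑ _i ∈ Finset.range W, a ((m + 1) * W) := by
            refine Finset.sum_le_sum fun i hi => ha ?_
            have := Finset.mem_range.1 hi
            rw [Nat.succ_mul]
            omega
        _ = _ := by simp
    have h2 : (W : ℝ) * a (m * W) ≤ W * a (m * W + 1) :=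
      mul_le_mul_of_nonneg_left (ha (Nat.le_succ _)) (Nat.cast_nonneg _)
    rw [Finset.sum_range_succ, Nat.succ_mul, Finset.sum_range_add]
    rw [Nat.succ_mul] at h1
    linarith

lemma sum_Icc_eq_sum_fin (a : ℕ → ℝ) (n : ℕ) :
    ∑ i ∈ Finset.Icc 1 n, a i = ∑ i : Fin n, a (i + 1) := by
  rw [Fin.sum_univ_eq_sum_range (fun i => a (i + 1)), Finset.range_eq_Ico,
    Finset.sum_Ico_add' a 0 n 1]
  rfl

lemma log_KPF_ge_sum_sub {ρ K : ℝ} (hρ : 0 < ρ) (hK : 0 < K)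
    (hL : ∀ h w : ℕ, K ≤ h → K * √(h : ℝ) ≤ w → ρ * w * √(h : ℝ) ≤ Lbox h w)
    {η : ℕ → ℕ} (hη : Monotone η) (hpos : ∀ n, 0 < η n) {i₀ : ℕ} (hi₀ : K ≤ η i₀) (n : ℕ) :
    ρ * (∑ i ∈ Finset.Icc 1 n, √(η i : ℝ) - (K + 1) * (2 + i₀ * √K) * η n) ≤
      Real.log (KPF fun i : Fin n => η ((i : ℕ) + 1)) := by
  set a : ℕ → ℝ := fun i => √(η i : ℝ) with ha
  have ham : Monotone a := fun i j hij => Real.sqrt_le_sqrt (by exact_mod_cast hη hij)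
  have ha1 : 1 ≤ a n := Real.one_le_sqrt.2 (by exact_mod_cast hpos n)
  have haa : a n * a n = η n := Real.mul_self_sqrt (Nat.cast_nonneg _)
  set W := ⌈K * a n⌉₊ with hW
  have hW0 : 0 < W := Nat.ceil_pos.2 (by positivity)
  have hKW : K * a n ≤ W := Nat.le_ceil _
  have hWa : (W : ℝ) ≤ (K + 1) * a n := by
    have := Nat.ceil_lt_add_one (a := K * a n) (by positivity)
    linarith
  set m := n / W with hm
  have hmn : m * W ≤ n := Nat.div_mul_le_self n W
  have hnm : n < m * W + W := Nat.lt_div_mul_add hW0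
  have hWη : (W : ℝ) * a n ≤ (K + 1) * η n := by
    rw [← haa, ← mul_assoc]
    gcongr
  have hWη' : (W : ℝ) ≤ (K + 1) * η n :=
    (le_mul_of_one_le_right (Nat.cast_nonneg _) ha1).trans hWη
  have hblock : ∀ b ∈ Finset.range m, ρ * (W * a (b * W + 1)) -
      (if b < i₀ then ρ * (W * √K) else 0) ≤ Lbox (η (b * W + 1)) W := by
    intro b hb
    have hbm : b + 1 ≤ m := Finset.mem_range.1 hb
    have hbn : b * W + 1 ≤ n := by
      have := Nat.mul_le_mul_right W hbm
      rw [Nat.succ_mul] at this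
      omega
    have hbb : b ≤ b * W := Nat.le_mul_of_pos_right b hW0
    rcases le_or_gt K (η (b * W + 1)) with h | h
    · have h1 := hL _ W h ((mul_le_mul_of_nonneg_left (ham hbn) hK.le).trans hKW)
      have h2 : (0 : ℝ) ≤ if b < i₀ then ρ * (W * √K) else 0 := by
        split_ifs <;> positivity
      have h3 : ρ * W * a (b * W + 1) ≤ Lbox (η (b * W + 1)) W := h1
      linarith
    · have hlt : b < i₀ := by
        by_contra hcon
        have : (η i₀ : ℝ) ≤ η (b * W + 1) := by
          exact_mod_cast hη (by omega : i₀ ≤ b * W + 1)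
        linarith
      rw [if_pos hlt]
      have h1 : a (b * W + 1) ≤ √K := Real.sqrt_le_sqrt h.le
      have h2 : ρ * (W * a (b * W + 1)) ≤ ρ * (W * √K) := by gcongr
      have h3 : 0 ≤ Lbox (η (b * W + 1)) W := Real.log_natCast_nonneg _
      linarith
  have hloss : ∑ b ∈ Finset.range m, (if b < i₀ then ρ * (W * √K) else 0) ≤
      i₀ * (ρ * (W * √K)) := by
    rw [← Finset.sum_filter, Finset.sum_const, nsmul_eq_mul]
    refine mul_le_mul_of_nonneg_right ?_ (by positivity)
    have : ((Finset.range m).filter (· < i₀)).card ≤ (Finset.range i₀).card :=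
      Finset.card_le_card fun b hb => Finset.mem_range.2 (Finset.mem_filter.1 hb).2
    rw [Finset.card_range] at this
    exact_mod_cast this
  have hsum := Finset.sum_le_sum hblock
  rw [Finset.sum_sub_distrib, ← Finset.mul_sum] at hsum
  have hlog := (sum_Lbox_le_log_KPF hη W m).trans
    (log_KPF_mono_width hmn fun i => η (i + 1))
  have hstarts := sum_le_sum_block_starts ham W m
  have hrest : ∑ i ∈ Finset.Icc 1 n, a i ≤
      ∑ i ∈ Finset.range (m * W), a (i + 1) + W * a n := by
    obtain ⟨r, hr⟩ := Nat.exists_eq_add_of_le hmn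
    rw [sum_Icc_eq_sum_fin, Fin.sum_univ_eq_sum_range (fun i => a (i + 1))]
    conv_lhs => rw [hr, Finset.sum_range_add]
    gcongr
    calc _ ≤ ∑ _i ∈ Finset.range r, a n := by
          refine Finset.sum_le_sum fun i hi => ham ?_
          have := Finset.mem_range.1 hi
          omega
      _ = r * a n := by simp
      _ ≤ W * a n := by
          gcongr
          omega
  have ha0 : 0 ≤ a 0 := Real.sqrt_nonneg _
  have hlast : (W : ℝ) * (a (m * W) - a 0) ≤ W * a n := by
    gcongr
    linarith [ham hmn]
  have hcost : (i₀ : ℝ) * (W * √K) ≤ (K + 1) * η n * (i₀ * √K) := by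
    calc (i₀ : ℝ) * (W * √K) = W * (i₀ * √K) := by ring
      _ ≤ _ := by gcongr
  have hfinal : ∑ i ∈ Finset.Icc 1 n, a i - (K + 1) * (2 + i₀ * √K) * η n ≤
      ∑ b ∈ Finset.range m, W * a (b * W + 1) - i₀ * (W * √K) := by
    linarith
  have := mul_le_mul_of_nonneg_left hfinal hρ.le
  linarith

lemma tendsto_one_of_eventually_ge {u : ℕ → ℝ} (hle : ∀ᶠ n in atTop, u n ≤ 1)
    (hge : ∀ ε : ℝ, 0 < ε → ε < 1 → ∀ᶠ n in atTop, 1 - ε ≤ u n) :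
    Tendsto u atTop (nhds 1) := by
  refine tendsto_order.2 ⟨fun x hx => ?_, fun x hx => ?_⟩
  · have h1 : 0 < min ((1 - x) / 2) (1 / 2) := lt_min (by linarith) (by norm_num)
    filter_upwards [hge _ h1 ((min_le_right _ _).trans_lt (by norm_num))] with n hn
    have := min_le_left ((1 - x) / 2) (1 / 2 : ℝ)
    linarith
  · filter_upwards [hle] with n hn
    linarith

lemma eventually_le_of_one_div_sqrt {h : ℕ → ℕ} (hh : ∀ n, 0 < h n)
    (hlim : Tendsto (fun n => (1 : ℝ) / √(h n : ℝ)) atTop (nhds 0)) (K : ℝ) :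
    ∀ᶠ n in atTop, K ≤ h n := by
  have hK : 0 < 1 / (|K| + 1) := by positivity
  filter_upwards [hlim.eventually_lt_const hK] with n hn
  have h1 : (1 : ℝ) ≤ h n := by exact_mod_cast hh n
  have h2 : 0 < √(h n : ℝ) := Real.sqrt_pos.2 (by linarith)
  have h3 : |K| + 1 < √(h n : ℝ) := (one_div_lt_one_div h2 (by positivity)).1 hn
  have h4 : √(h n : ℝ) ≤ h n := Real.sqrt_le_iff.2 ⟨by linarith, by nlinarith⟩
  linarith [le_abs_self K]

/-- There is a universal constant `γ₊ > 0` such that (a) whenever `√h ≻ 1` and `w ≻ √h`,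
`L[h,w] ∼ γ₊·w·√h`; and (b) for every nondecreasing `η : ℤ⁺ → ℤ⁺` with `√(η n) ≺ n`,
`√(η n) ≻ 1` and `η n ≺ Σ_{i=1}^n √(η i)`, one has
`ln KPF[(η 1, …, η n)] ∼ γ₊·Σ_{i=1}^n √(η i)`. -/
theorem Lbox_asymp_sum :
    ∃ γ : ℝ, 0 < γ ∧
      (∀ h w : ℕ → ℕ,
        (∀ n, 0 < h n) → (∀ n, 0 < w n) →
        Tendsto (fun n => (1 : ℝ) / Real.sqrt (h n : ℝ)) atTop (nhds 0) →
        Tendsto (fun n => Real.sqrt (h n : ℝ) / (w n : ℝ)) atTop (nhds 0) →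
        Tendsto (fun n =>
            Lbox (h n) (w n) / (γ * (w n : ℝ) * Real.sqrt (h n : ℝ)))
          atTop (nhds 1)) ∧
      (∀ η : ℕ → ℕ, Monotone η → (∀ n, 0 < η n) →
        Tendsto (fun n : ℕ => Real.sqrt (η n : ℝ) / (n : ℝ)) atTop (nhds 0) →
        Tendsto (fun n : ℕ => (1 : ℝ) / Real.sqrt (η n : ℝ)) atTop (nhds 0) →
        Tendsto (fun n : ℕ =>
            (η n : ℝ) / ∑ i ∈ Finset.Icc 1 n, Real.sqrt (η i : ℝ)) atTop (nhds 0) →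
        Tendsto (fun n : ℕ =>
            Real.log (KPF (fun i : Fin n => η ((i : ℕ) + 1))) /
              (γ * ∑ i ∈ Finset.Icc 1 n, Real.sqrt (η i : ℝ)))
          atTop (nhds 1)) := by
  have hγ : 0 < 2 * (Real.pi / √6) := by positivity
  set γ := 2 * (Real.pi / √6) with hγdef
  refine ⟨γ, hγ, ?_, ?_⟩
  · intro h w hh hw hlim hhw
    have hden : ∀ n, 0 < γ * (w n : ℝ) * √(h n : ℝ) := fun n => by
      have h1 : (0 : ℝ) < h n := by exact_mod_cast hh n
      have h2 : (0 : ℝ) < w n := by exact_mod_cast hw n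
      positivity
    refine tendsto_one_of_eventually_ge (.of_forall fun n =>
      (div_le_one (hden n)).2 (Lbox_le (hh n))) fun ε hε0 hε1 => ?_
    obtain ⟨K, hK0, hK⟩ := Lbox_ge (ρ := (1 - ε) * γ) (mul_pos (by linarith) hγ) (by nlinarith)
    filter_upwards [eventually_le_of_one_div_sqrt hh hlim K,
      hhw.eventually_lt_const (inv_pos.2 hK0)] with n hn1 hn2
    have hwn : (0 : ℝ) < w n := by exact_mod_cast hw n
    rw [le_div_iff₀ (hden n), ← mul_assoc, ← mul_assoc]
    refine hK _ _ hn1 ?_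
    rw [div_lt_iff₀ hwn, inv_mul_eq_div, lt_div_iff₀ hK0] at hn2
    linarith
  · intro η hη hpos _ hlim hsum
    have hpos' : ∀ n, (0 : ℝ) < η n := fun n => by exact_mod_cast hpos n
    have hden : ∀ n, 1 ≤ n → 0 < ∑ i ∈ Finset.Icc 1 n, √(η i : ℝ) := fun n hn =>
      Finset.sum_pos (fun i _ => Real.sqrt_pos.2 (hpos' i)) ⟨1, Finset.mem_Icc.2 ⟨le_rfl, hn⟩⟩
    refine tendsto_one_of_eventually_ge ?_ fun ε hε0 hε1 => ?_
    · filter_upwards [eventually_ge_atTop 1] with n hn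
      rw [div_le_one (mul_pos hγ (hden n hn)), sum_Icc_eq_sum_fin]
      exact log_KPF_le_of_monotone (fun i : Fin n => η ((i : ℕ) + 1))
        (fun i j hij => hη (Nat.succ_le_succ hij)) fun i => hpos _
    · have hρ : 0 < (1 - ε / 2) * γ := mul_pos (by linarith) hγ
      obtain ⟨K, hK0, hK⟩ := Lbox_ge hρ (by nlinarith)
      obtain ⟨i₀, hi₀⟩ := (eventually_le_of_one_div_sqrt hpos hlim K).exists
      set C := (K + 1) * (2 + i₀ * √K) with hC
      have hC0 : 0 < C := by positivity
      filter_upwards [eventually_ge_atTop 1,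
        hsum.eventually_lt_const (div_pos (half_pos hε0) hC0)] with n hn hn2
      have hS := hden n hn
      have hlow := log_KPF_ge_sum_sub hρ hK0 hK hη hpos hi₀ n
      set S := ∑ i ∈ Finset.Icc 1 n, √(η i : ℝ)
      rw [div_lt_iff₀ hS, div_mul_eq_mul_div, lt_div_iff₀ hC0] at hn2
      rw [le_div_iff₀ (mul_pos hγ hS)]
      refine le_trans ?_ hlow
      have h1 : (1 - ε / 2) * S ≤ S - C * η n := by linarith
      calc (1 - ε) * (γ * S) ≤ (1 - ε / 2) * (1 - ε / 2) * (γ * S) := by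
            refine mul_le_mul_of_nonneg_right ?_ (mul_pos hγ hS).le
            nlinarith [sq_nonneg ε]
        _ = (1 - ε / 2) * γ * ((1 - ε / 2) * S) := by ring
        _ ≤ _ := mul_le_mul_of_nonneg_left h1 hρ.le
end

section
/- There exists a universal constant γ₊ > 0 such that: (a) for all functions h, w : ℤ⁺ → ℤ⁺ with √h ≻ 1 and w ≻ √h, one has L[h, w] ∼ γ₊·w·√h; and (b) L(1ⁿ) ∼ (2/3)·γ₊·n·√n, i.e. ln|T(1, 1, …, 1)| / ((2/3)·γ₊·n^{3/2}) → 1 as n → ∞, where the hook sum vector consists of n ones. -/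
open Filter

/-- A generalized Tesler matrix with hook sum vector `h`. -/
def IsTesler {n : ℕ} (h : Fin n → ℤ) (A : Fin n → Fin n → ℕ) : Prop :=
  (∀ i j : Fin n, j < i → A i j = 0) ∧
  ∀ k : Fin n, (∑ i : Fin n, if k ≤ i then (A k i : ℤ) else 0)
    - (∑ i : Fin n, if i < k then (A i k : ℤ) else 0) = h k

/-- `L(h) = ln |T(h)|`. -/
noncomputable def LTes {n : ℕ} (h : Fin n → ℤ) : ℝ :=
  Real.log (Set.ncard {A : Fin n → Fin n → ℕ | IsTesler h A})

section Packings

open scoped Classical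

/-- Nonnegative integer weightings of `E` whose total weight over the elements covering `m` is at
most `η m`, for every `m`. -/
def Packings {α ι : Type*} (E : Finset α) (cov : ι → α → Prop) (η : ι → ℕ) : Set (α → ℕ) :=
  {c | (∀ e ∉ E, c e = 0) ∧ ∀ m, ∑ e ∈ E with cov m e, c e ≤ η m}

variable {α β ι κ : Type*}

theorem finite_and_ncard_mul_pow_le (E : Finset α) (S : Set (α → ℕ)) (wt : α → ℕ) (W : ℕ)
    (hsupp : ∀ c ∈ S, ∀ e ∉ E, c e = 0) (hpos : ∀ e ∈ E, 0 < wt e)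
    (hW : ∀ c ∈ S, ∑ e ∈ E, wt e * c e ≤ W) {t : ℝ} (ht0 : 0 < t) (ht1 : t < 1) :
    S.Finite ∧ (S.ncard : ℝ) * t ^ W ≤ ∏ e ∈ E, (1 - t ^ wt e)⁻¹ := by
  let φ : (α → ℕ) → ((e : α) → e ∈ E → ℕ) := fun c e _ => c e
  have hmap : ∀ c ∈ S, φ c ∈ E.pi (fun _ => Finset.range (W + 1)) := by
    intro c hc
    rw [Finset.mem_pi]
    intro e he
    have h1 : wt e * c e ≤ W :=
      (Finset.single_le_sum (f := fun e => wt e * c e) (fun _ _ => Nat.zero_le _) he).trans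
        (hW c hc)
    have h2 : c e ≤ wt e * c e := Nat.le_mul_of_pos_left _ (hpos e he)
    simp only [φ, Finset.mem_range]
    omega
  have hinj : Set.InjOn φ S := by
    intro c hc d hd h
    funext e
    by_cases he : e ∈ E
    · exact congrFun (congrFun h e) he
    · rw [hsupp c hc e he, hsupp d hd e he]
  have hfin : S.Finite :=
    Set.Finite.of_injOn (t := ((E.pi fun _ => Finset.range (W + 1) : Finset _) : Set _))
      (fun c hc => hmap c hc) hinj (Finset.finite_toSet _)
  refine ⟨hfin, ?_⟩
  have hterm : ∀ k, 0 ≤ t ^ k := fun k => by positivity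
  calc (S.ncard : ℝ) * t ^ W = ∑ c ∈ hfin.toFinset, t ^ W := by
        rw [Set.ncard_eq_toFinset_card S hfin]; simp
    _ ≤ ∑ c ∈ hfin.toFinset, ∏ x ∈ E.attach, (t ^ wt x) ^ (φ c x x.2) := by
        refine Finset.sum_le_sum fun c hc => ?_
        have hc : c ∈ S := by simpa using hc
        have : ∏ x ∈ E.attach, (t ^ wt x) ^ (φ c x x.2) = t ^ ∑ e ∈ E, wt e * c e := by
          simp only [φ]
          rw [Finset.prod_attach E (fun e => (t ^ wt e) ^ c e), ← Finset.prod_pow_eq_pow_sum]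
          simp only [pow_mul]
        rw [this]
        exact pow_le_pow_of_le_one ht0.le ht1.le (hW c hc)
    _ = ∑ p ∈ hfin.toFinset.image φ, ∏ x ∈ E.attach, (t ^ wt x) ^ (p x x.2) := by
        rw [Finset.sum_image]
        intro c hc d hd h
        exact hinj (by simpa using hc) (by simpa using hd) h
    _ ≤ ∑ p ∈ E.pi (fun _ => Finset.range (W + 1)), ∏ x ∈ E.attach, (t ^ wt x) ^ (p x x.2) := by
        refine Finset.sum_le_sum_of_subset_of_nonneg ?_ ?_
        · intro p hp
          obtain ⟨c, hc, rfl⟩ := Finset.mem_image.1 hp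
          exact hmap c (by simpa using hc)
        · intro p _ _
          positivity
    _ = ∏ e ∈ E, ∑ k ∈ Finset.range (W + 1), (t ^ wt e) ^ k := by
        rw [Finset.prod_sum]
    _ ≤ ∏ e ∈ E, (1 - t ^ wt e)⁻¹ := by
        refine Finset.prod_le_prod (fun e _ => by positivity) fun e he => ?_
        have h1 : t ^ wt e < 1 := pow_lt_one₀ ht0.le ht1 (hpos e he).ne'
        rw [← tsum_geometric_of_lt_one (hterm _) h1]
        exact (summable_geometric_of_lt_one (hterm _) h1).sum_le_tsum _
          (fun _ _ => by positivity)

theorem Packings.finite {E : Finset α} {cov : ι → α → Prop} (hE : ∀ e ∈ E, ∃ m, cov m e)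
    (η : ι → ℕ) : (Packings E cov η).Finite := by
  have hB : ∀ e, ∃ B, e ∈ E → ∀ c ∈ Packings E cov η, c e ≤ B := by
    intro e
    by_cases he : e ∈ E
    · obtain ⟨m, hm⟩ := hE e he
      refine ⟨η m, fun _ c hc => le_trans ?_ (hc.2 m)⟩
      exact Finset.single_le_sum (f := c) (fun _ _ => Nat.zero_le _)
        (Finset.mem_filter.2 ⟨he, hm⟩)
    · exact ⟨0, fun h => absurd h he⟩
  choose B hB using hB
  refine (finite_and_ncard_mul_pow_le E (Packings E cov η) (fun _ => 1) (∑ e ∈ E, B e)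
    (fun c hc => hc.1) (fun _ _ => one_pos) (fun c hc => ?_)
    (t := 1 / 2) (by norm_num) (by norm_num)).1
  refine Finset.sum_le_sum fun e he => ?_
  rw [one_mul]
  exact hB e he c hc

theorem Packings.zero_mem (E : Finset α) (cov : ι → α → Prop) (η : ι → ℕ) :
    (0 : α → ℕ) ∈ Packings E cov η := by
  simp [Packings]

theorem Packings.ncard_pos {E : Finset α} {cov : ι → α → Prop} (hE : ∀ e ∈ E, ∃ m, cov m e)
    (η : ι → ℕ) : 0 < (Packings E cov η).ncard :=
  (Set.ncard_pos (Packings.finite hE η)).2 ⟨0, Packings.zero_mem E cov η⟩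

theorem Packings.ncard_union_le [DecidableEq α] (E F : Finset α) {cov : ι → α → Prop}
    (hE : ∀ e ∈ E, ∃ m, cov m e) (hF : ∀ e ∈ F, ∃ m, cov m e) (η : ι → ℕ) :
    (Packings (E ∪ F) cov η).ncard ≤ (Packings E cov η).ncard * (Packings F cov η).ncard := by
  rw [← Set.ncard_prod]
  have key : ∀ G ⊆ E ∪ F, ∀ c ∈ Packings (E ∪ F) cov η,
      (fun e => if e ∈ G then c e else 0) ∈ Packings G cov η := by
    intro G hG c hc
    refine ⟨fun e he => if_neg he, fun m => le_trans ?_ (hc.2 m)⟩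
    calc ∑ e ∈ G with cov m e, (if e ∈ G then c e else 0) ≤ ∑ e ∈ G with cov m e, c e :=
          Finset.sum_le_sum fun e _ => by split_ifs <;> simp
      _ ≤ ∑ e ∈ E ∪ F with cov m e, c e :=
          Finset.sum_le_sum_of_subset (Finset.filter_subset_filter _ hG)
  refine Set.ncard_le_ncard_of_injOn
    (fun c => (fun e => if e ∈ E then c e else 0, fun e => if e ∈ F then c e else 0)) ?_ ?_
    ((Packings.finite hE η).prod (Packings.finite hF η))
  · intro c hc
    exact ⟨key E Finset.subset_union_left c hc, key F Finset.subset_union_right c hc⟩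
  · intro c hc d hd h
    simp only [Prod.mk.injEq] at h
    funext e
    by_cases he : e ∈ E
    · simpa [he] using congrFun h.1 e
    by_cases hf : e ∈ F
    · simpa [hf] using congrFun h.2 e
    · rw [hc.1 e (by simp [he, hf]), hd.1 e (by simp [he, hf])]

theorem Packings.ncard_mul_le [DecidableEq α] (E F : Finset α) {cov : ι → α → Prop}
    (hE : ∀ e ∈ E, ∃ m, cov m e) (hF : ∀ e ∈ F, ∃ m, cov m e) (hEF : Disjoint E F)
    (hcov : ∀ m, (∀ e ∈ E, ¬ cov m e) ∨ ∀ e ∈ F, ¬ cov m e) (η : ι → ℕ) :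
    (Packings E cov η).ncard * (Packings F cov η).ncard ≤ (Packings (E ∪ F) cov η).ncard := by
  rw [← Set.ncard_prod]
  have hne : ∀ e, e ∈ E → e ∉ F := fun e h1 h2 => Finset.disjoint_left.1 hEF h1 h2
  refine Set.ncard_le_ncard_of_injOn (fun p => p.1 + p.2) ?_ ?_
    (Packings.finite (fun e he => ?_) η)
  · rintro ⟨c, d⟩ ⟨hc, hd⟩
    dsimp only at hc hd ⊢
    refine ⟨fun e he => ?_, fun m => ?_⟩
    · simp only [Finset.mem_union, not_or] at he
      simp [hc.1 e he.1, hd.1 e he.2]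
    · simp only [Pi.add_apply, Finset.sum_add_distrib]
      have h1 : ∑ e ∈ E ∪ F with cov m e, c e ≤ ∑ e ∈ E with cov m e, c e := by
        refine Finset.sum_le_sum_of_ne_zero fun e he h0 => ?_
        simp only [Finset.mem_filter] at he ⊢
        exact ⟨by_contra fun h => h0 (hc.1 e h), he.2⟩
      have h2 : ∑ e ∈ E ∪ F with cov m e, d e ≤ ∑ e ∈ F with cov m e, d e := by
        refine Finset.sum_le_sum_of_ne_zero fun e he h0 => ?_
        simp only [Finset.mem_filter] at he ⊢
        exact ⟨by_contra fun h => h0 (hd.1 e h), he.2⟩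
      have h3 := hc.2 m
      have h4 := hd.2 m
      rcases hcov m with h | h
      · rw [Finset.filter_false_of_mem h] at h1
        rw [Finset.sum_empty] at h1
        omega
      · rw [Finset.filter_false_of_mem h] at h2
        rw [Finset.sum_empty] at h2
        omega
  · rintro ⟨c, d⟩ ⟨hc, hd⟩ ⟨c', d'⟩ ⟨hc', hd'⟩ h
    dsimp only at hc hd hc' hd'
    have h' : ∀ e, c e + d e = c' e + d' e := fun e => congrFun h e
    simp only [Prod.mk.injEq]
    constructor <;> funext e
    · by_cases he : e ∈ E
      · have := h' e
        rwa [hd.1 e (hne e he), hd'.1 e (hne e he)] at this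
      · rw [hc.1 e he, hc'.1 e he]
    · by_cases he : e ∈ E
      · rw [hd.1 e (hne e he), hd'.1 e (hne e he)]
      · have := h' e
        rwa [hc.1 e he, hc'.1 e he, zero_add, zero_add] at this
  · rcases Finset.mem_union.1 he with h | h
    · exact hE e h
    · exact hF e h

theorem Packings.ncard_le_of_map {E : Finset α} {F : Finset β} {cov : ι → α → Prop}
    {cov' : κ → β → Prop} {η : ι → ℕ} {η' : κ → ℕ} (φ : α → β)
    (hF : ∀ e ∈ F, ∃ m, cov' m e) (hφ : ∀ e ∈ E, φ e ∈ F) (hinj : Set.InjOn φ E)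
    (hcov : ∀ m', (∃ e ∈ E, cov' m' (φ e)) →
      ∃ m, η m ≤ η' m' ∧ ∀ e ∈ E, cov' m' (φ e) → cov m e) :
    (Packings E cov η).ncard ≤ (Packings F cov' η').ncard := by
  have hext : ∀ (c : α → ℕ), ∀ e ∈ E, ∑ x ∈ E with φ x = φ e, c x = c e := by
    intro c e he
    rw [Finset.sum_eq_single_of_mem e (by simp [he])]
    intro x hx hxe
    rw [Finset.mem_filter] at hx
    exact absurd (hinj hx.1 he hx.2) hxe
  refine Set.ncard_le_ncard_of_injOn (fun c f => ∑ e ∈ E with φ e = f, c e) ?_ ?_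
    (Packings.finite hF η')
  · intro c hc
    refine ⟨fun f hf => Finset.sum_eq_zero fun e he => ?_, fun m' => ?_⟩
    · rw [Finset.mem_filter] at he
      exact absurd (he.2 ▸ hφ e he.1) hf
    · have h1 : ∑ f ∈ F with cov' m' f, ∑ e ∈ E with φ e = f, c e
          = ∑ e ∈ E with cov' m' (φ e), c e := by
        rw [← Finset.sum_fiberwise_of_maps_to (s := E.filter fun e => cov' m' (φ e))
          (t := F.filter (cov' m')) (g := φ)]
        · refine Finset.sum_congr rfl fun f hf => Finset.sum_congr ?_ fun _ _ => rfl
          ext e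
          simp only [Finset.mem_filter] at hf ⊢
          constructor
          · rintro ⟨h, rfl⟩
            exact ⟨⟨h, hf.2⟩, rfl⟩
          · rintro ⟨⟨h, _⟩, rfl⟩
            exact ⟨h, rfl⟩
        · intro e he
          simp only [Finset.mem_filter] at he ⊢
          exact ⟨hφ e he.1, he.2⟩
      rw [h1]
      by_cases hex : ∃ e ∈ E, cov' m' (φ e)
      · obtain ⟨m, hm, hm'⟩ := hcov m' hex
        refine le_trans ?_ ((hc.2 m).trans hm)
        refine Finset.sum_le_sum_of_ne_zero fun e he _ => ?_
        simp only [Finset.mem_filter] at he ⊢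
        exact ⟨he.1, hm' e he.1 he.2⟩
      · rw [Finset.filter_false_of_mem fun e he h => hex ⟨e, he, h⟩]
        simp
  · intro c hc d hd h
    funext e
    by_cases he : e ∈ E
    · rw [← hext c e he, ← hext d e he]
      exact congrFun h (φ e)
    · rw [hc.1 e he, hd.1 e he]

theorem Packings.ncard_pow_le (X : Type*) [Fintype X] {E : Finset α} {cov : ι → α → Prop}
    (hE : ∀ e ∈ E, ∃ m, cov m e) (η : ι → ℕ) :
    (Packings E cov η).ncard ^ Fintype.card X ≤
      (Packings ((Finset.univ : Finset X) ×ˢ E) (fun m p => cov m p.2)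
        (fun m => Fintype.card X * η m)).ncard := by
  have hfin : (Packings ((Finset.univ : Finset X) ×ˢ E) (fun m p => cov m p.2)
        (fun m => Fintype.card X * η m)).Finite := by
    refine Packings.finite (fun e he => ?_) _
    exact hE e.2 (Finset.mem_product.1 he).2
  have := hfin.to_subtype
  have h1 : (Packings E cov η).ncard ^ Fintype.card X = Nat.card (X → Packings E cov η) := by
    rw [Nat.card_fun, Nat.card_coe_set_eq, Nat.card_eq_fintype_card]
  rw [h1, ← Nat.card_coe_set_eq]
  refine Nat.card_le_card_of_injective (fun f => ⟨fun p => (f p.1).1 p.2, ?_, ?_⟩) ?_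
  · intro p hp
    exact (f p.1).2.1 p.2 (fun h => hp (by simp [h]))
  · intro m
    dsimp only
    have : (Finset.univ ×ˢ E).filter (fun p : X × α => cov m p.2)
        = Finset.univ ×ˢ E.filter (cov m) := by
      ext p; simp
    rw [this, Finset.sum_product, ← Finset.card_univ, ← smul_eq_mul]
    exact Finset.sum_le_card_nsmul _ _ _ fun x _ => (f x).2.2 m
  · intro f g h
    funext x
    ext e
    exact congrFun (congrArg Subtype.val h) (x, e)

theorem Packings.ncard_le_of_surjOn {E : Finset α} {F : Finset β} {cov : ι → α → Prop}
    {cov' : κ → β → Prop} {η : ι → ℕ} {η' : κ → ℕ} (φ : α → β)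
    (hE : ∀ e ∈ E, ∃ m, cov m e) (hφ : ∀ e ∈ E, φ e ∈ F) (hinj : Set.InjOn φ E)
    (hsurj : ∀ f ∈ F, ∃ e ∈ E, φ e = f)
    (hcov : ∀ m, ∃ m', η' m' ≤ η m ∧ ∀ e ∈ E, cov m e → cov' m' (φ e)) :
    (Packings F cov' η').ncard ≤ (Packings E cov η).ncard := by
  refine Set.ncard_le_ncard_of_injOn (fun c e => if e ∈ E then c (φ e) else 0) ?_ ?_
    (Packings.finite hE η)
  · intro c hc
    refine ⟨fun e he => if_neg he, fun m => ?_⟩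
    obtain ⟨m', hm, hm'⟩ := hcov m
    refine le_trans ?_ ((hc.2 m').trans hm)
    calc ∑ e ∈ E with cov m e, (if e ∈ E then c (φ e) else 0)
        = ∑ e ∈ E with cov m e, c (φ e) :=
          Finset.sum_congr rfl fun e he => if_pos (Finset.mem_filter.1 he).1
      _ = ∑ f ∈ (E.filter (cov m)).image φ, c f := by
          rw [Finset.sum_image]
          intro x hx y hy h
          exact hinj (Finset.mem_filter.1 hx).1 (Finset.mem_filter.1 hy).1 h
      _ ≤ ∑ f ∈ F with cov' m' f, c f := by
          refine Finset.sum_le_sum_of_subset fun f hf => ?_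
          obtain ⟨e, he, rfl⟩ := Finset.mem_image.1 hf
          rw [Finset.mem_filter] at he ⊢
          exact ⟨hφ e he.1, hm' e he.1 he.2⟩
  · intro c hc d hd h
    funext f
    by_cases hf : f ∈ F
    · obtain ⟨e, he, rfl⟩ := hsurj f hf
      simpa [he] using congrFun h e
    · rw [hc.1 f hf, hd.1 f hf]

theorem Packings.ncard_exact_eq {U V : Finset α} {cov : ι → α → Prop} (s : ι → α)
    (hU : ∀ m, s m ∈ U) (hs : ∀ m m', cov m (s m') ↔ m = m')
    (hV : ∀ e, e ∈ V ↔ e ∈ U ∧ e ∉ Set.range s) (η : ι → ℕ) :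
    {c : α → ℕ | (∀ e ∉ U, c e = 0) ∧ ∀ m, ∑ e ∈ U with cov m e, c e = η m}.ncard =
      (Packings V cov η).ncard := by
  obtain rfl : V = {e ∈ U | e ∉ Set.range s} := by
    ext e
    rw [hV, Finset.mem_filter]
  have hsinj : Function.Injective s := fun m m' h => by
    rw [← hs m m', ← h, hs m m]
  have hsplit : ∀ (c : α → ℕ) m, ∑ e ∈ U with cov m e, c e =
      c (s m) + ∑ e ∈ {e ∈ U | e ∉ Set.range s} with cov m e, c e := by
    intro c m
    rw [← Finset.sum_filter_add_sum_filter_not {e ∈ U | cov m e} (fun e => e ∈ Set.range s)]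
    congr 1
    · have : {e ∈ {e ∈ U | cov m e} | e ∈ Set.range s} = {s m} := by
        ext e
        simp only [Finset.mem_filter, Set.mem_range, Finset.mem_singleton]
        constructor
        · rintro ⟨⟨_, h⟩, m', rfl⟩
          rw [(hs m m').1 h]
        · rintro rfl
          exact ⟨⟨hU m, (hs m m).2 rfl⟩, m, rfl⟩
      rw [this, Finset.sum_singleton]
    · rw [Finset.filter_filter, Finset.filter_filter]
      refine Finset.sum_congr ?_ fun _ _ => rfl
      ext e
      simp only [Finset.mem_filter]
      tauto
  have hzero : ∀ (c : α → ℕ) m, ∑ e ∈ {e ∈ U | e ∉ Set.range s} with cov m e,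
      (if e ∈ Set.range s then 0 else c e) =
        ∑ e ∈ {e ∈ U | e ∉ Set.range s} with cov m e, c e := by
    intro c m
    refine Finset.sum_congr rfl fun e he => if_neg ?_
    simp only [Finset.mem_filter] at he
    exact he.1.2
  have himage : Packings {e ∈ U | e ∉ Set.range s} cov η =
      (fun (c : α → ℕ) e => if e ∈ Set.range s then 0 else c e) ''
        {c : α → ℕ | (∀ e ∉ U, c e = 0) ∧ ∀ m, ∑ e ∈ U with cov m e, c e = η m} := by
    ext d
    constructor
    · intro hd
      set T : ι → ℕ := fun m => ∑ e ∈ {e ∈ U | e ∉ Set.range s} with cov m e, d e with hT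
      let c : α → ℕ := fun e => if h : e ∈ Set.range s then η h.choose - T h.choose else d e
      have hcs : ∀ m, c (s m) = η m - T m := by
        intro m
        have h : s m ∈ Set.range s := ⟨m, rfl⟩
        have h2 : h.choose = m := hsinj h.choose_spec
        simp only [c, dif_pos h, h2]
      have hcd : ∀ e, e ∉ Set.range s → c e = d e := fun e he => dif_neg he
      refine ⟨c, ⟨fun e he => ?_, fun m => ?_⟩, ?_⟩
      · have h1 : e ∉ Set.range s := by
          rintro ⟨m, rfl⟩
          exact he (hU m)
        rw [hcd e h1, hd.1 e (by simp [he])]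
      · rw [hsplit, hcs]
        have : ∑ e ∈ {e ∈ U | e ∉ Set.range s} with cov m e, c e = T m := by
          refine Finset.sum_congr rfl fun e he => hcd e ?_
          simp only [Finset.mem_filter] at he
          exact he.1.2
        rw [this]
        exact Nat.sub_add_cancel (hd.2 m)
      · funext e
        by_cases he : e ∈ Set.range s
        · rw [hd.1 e (by simp only [Finset.mem_filter]; tauto)]
          simp only [if_pos he]
        · simp only [if_neg he, hcd e he]
    · rintro ⟨c, hc, rfl⟩
      refine ⟨fun e he => ?_, fun m => ?_⟩
      · by_cases h : e ∈ Set.range s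
        · exact if_pos h
        · simp only [if_neg h]
          exact hc.1 e fun hU => he (by simp only [Finset.mem_filter]; exact ⟨hU, h⟩)
      · rw [hzero, ← hc.2 m, hsplit]
        exact Nat.le_add_left _ _
  rw [himage, Set.InjOn.ncard_image]
  intro c hc d hd h
  have hoff : ∀ e, e ∉ Set.range s → c e = d e := by
    intro e he
    simpa only [if_neg he] using congrFun h e
  funext e
  by_cases he : e ∈ Set.range s
  · obtain ⟨m, rfl⟩ := he
    have h1 := hc.2 m
    have h2 := hd.2 m
    rw [hsplit] at h1 h2
    have h3 : ∑ e ∈ {e ∈ U | e ∉ Set.range s} with cov m e, c e =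
        ∑ e ∈ {e ∈ U | e ∉ Set.range s} with cov m e, d e := by
      refine Finset.sum_congr rfl fun e he => hoff e ?_
      simp only [Finset.mem_filter] at he
      exact he.1.2
    omega
  · exact hoff e he

/-- Pairs `(i, j)` with `a ≤ i < j < b`. -/
def arcs (a b : ℕ) : Finset (ℕ × ℕ) := {e ∈ Finset.Ico a b ×ˢ Finset.Ico a b | e.1 < e.2}

/-- The interval `[i, j]` contains `m`. -/
def Covers (m : ℕ) (e : ℕ × ℕ) : Prop := e.1 ≤ m ∧ m ≤ e.2

/-- The number of families of nondegenerate subintervals of `[a, b)` covering each `m` at most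
`η m` times. -/
noncomputable def arcCount (a b : ℕ) (η : ℕ → ℕ) : ℕ := (Packings (arcs a b) Covers η).ncard

theorem mem_arcs {a b : ℕ} {e : ℕ × ℕ} : e ∈ arcs a b ↔ a ≤ e.1 ∧ e.1 < e.2 ∧ e.2 < b := by
  simp only [arcs, Finset.mem_filter, Finset.mem_product, Finset.mem_Ico]
  omega

theorem exists_covers_of_mem_arcs {a b : ℕ} : ∀ e ∈ arcs a b, ∃ m, Covers m e := fun e he =>
  ⟨e.1, le_rfl, (mem_arcs.1 he).2.1.le⟩

theorem ncard_curry {γ δ : Type*} (P : (γ × δ → ℕ) → Prop) :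
    {c : γ → δ → ℕ | P fun e => c e.1 e.2}.ncard = {c | P c}.ncard := by
  have : {c | P c} = (Equiv.curry γ δ ℕ).symm '' {c : γ → δ → ℕ | P fun e => c e.1 e.2} := by
    ext c
    simp only [Set.mem_ofPred_eq, Set.mem_image]
    constructor
    · intro h
      exact ⟨fun a b => c (a, b), h, rfl⟩
    · rintro ⟨d, hd, rfl⟩
      exact hd
  rw [this, Set.ncard_image_of_injective _ (Equiv.injective _)]

theorem KPF_eq_arcCount (w : ℕ) (η : ℕ → ℕ) :
    KPF (fun m : Fin w => η m) = arcCount 0 w η := by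
  let U : Finset (Fin w × Fin w) := {e | e.1 ≤ e.2}
  obtain ⟨cov, hcov⟩ : ∃ cov : Fin w → Fin w × Fin w → Prop,
      ∀ m e, cov m e ↔ e.1 ≤ m ∧ m ≤ e.2 := ⟨_, fun _ _ => Iff.rfl⟩
  let s : Fin w → Fin w × Fin w := fun m => (m, m)
  have h1 : KPF (fun m : Fin w => η m) = {c : Fin w × Fin w → ℕ | (∀ e ∉ U, c e = 0) ∧
      ∀ m, ∑ e ∈ U with cov m e, c e = η m}.ncard := by
    rw [← ncard_curry, KPF]
    congr 1
    ext c
    simp only [IsKostant, Set.mem_ofPred_eq]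
    refine and_congr ?_ (forall_congr' fun m => ?_)
    · simp [U, Prod.forall]
    · have : {e ∈ U | cov m e} = {e ∈ (Finset.univ ×ˢ Finset.univ : Finset (Fin w × Fin w)) |
          e.1 ≤ m ∧ m ≤ e.2} := by
        ext e
        simp only [U, hcov, Finset.mem_filter, Finset.mem_univ, Finset.mem_product, true_and]
        exact ⟨fun h => h.2, fun h => ⟨h.1.trans h.2, h⟩⟩
      rw [this, Finset.sum_filter, Finset.sum_product]
  obtain ⟨V, hV⟩ : ∃ V : Finset (Fin w × Fin w), ∀ e, e ∈ V ↔ e ∈ U ∧ e ∉ Set.range s :=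
    ⟨{e ∈ U | e ∉ Set.range s}, fun e => Finset.mem_filter⟩
  have hmem : ∀ e, e ∈ V ↔ e.1 < e.2 := by
    rintro ⟨i, j⟩
    simp only [hV, U, s, Finset.mem_filter, Finset.mem_univ, true_and, Set.mem_range, Prod.mk.injEq,
      not_exists, not_and]
    constructor
    · rintro ⟨h, h'⟩
      exact lt_of_le_of_ne h fun h'' => h' i rfl h''
    · intro h
      exact ⟨h.le, fun x hx hx' => absurd (hx.symm.trans hx') h.ne⟩
  rw [h1, Packings.ncard_exact_eq s (fun m => by simp [U, s]) (fun m m' => ?_) hV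
    (fun m : Fin w => η m)]
  · let φ : Fin w × Fin w → ℕ × ℕ := fun e => (e.1, e.2)
    have hφ : ∀ e ∈ V, φ e ∈ arcs 0 w := fun e he => by
      rw [hmem] at he
      exact mem_arcs.2 ⟨Nat.zero_le _, he, e.2.2⟩
    have hinj : Function.Injective φ := by
      rintro ⟨i, j⟩ ⟨i', j'⟩ h
      simp only [φ, Prod.mk.injEq] at h
      rw [Fin.ext h.1, Fin.ext h.2]
    refine le_antisymm ?_ ?_
    · refine Packings.ncard_le_of_map φ exists_covers_of_mem_arcs hφ hinj.injOn ?_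
      rintro m ⟨e, he, hm⟩
      refine ⟨⟨m, lt_of_le_of_lt hm.2 e.2.2⟩, le_rfl, fun e _ h => (hcov _ _).2 h⟩
    · refine Packings.ncard_le_of_surjOn φ (fun e he => ⟨e.1, (hcov _ _).2 ⟨le_rfl, ?_⟩⟩) hφ
        hinj.injOn ?_ ?_
      · exact ((hmem e).1 he).le
      · rintro ⟨i, j⟩ hf
        have hf := mem_arcs.1 hf
        refine ⟨(⟨i, hf.2.1.trans hf.2.2⟩, ⟨j, hf.2.2⟩), (hmem _).2 hf.2.1, rfl⟩
      · exact fun m => ⟨m, le_rfl, fun e _ h => (hcov _ _).1 h⟩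
  · simp only [hcov, s]
    exact ⟨fun h => le_antisymm h.2 h.1, fun h => ⟨h.ge, h.le⟩⟩

theorem isTesler_ones_iff {n : ℕ} (A : Fin n → Fin n → ℕ) :
    IsTesler (fun _ => 1) A ↔ (∀ i j : Fin n, j < i → A i j = 0) ∧
      ∀ m : Fin n, ∑ k, ∑ i, (if k ≤ m ∧ (m < i ∨ i = k) then A k i else 0) = (m : ℕ) + 1 := by
  let X : ℕ → ℤ := fun t => ∑ k : Fin n, ∑ i : Fin n,
    if (k : ℕ) < t ∧ (t ≤ (i : ℕ) ∨ i = k) then (A k i : ℤ) else 0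
  have hstep : ∀ m : Fin n, X (m + 1) - X m =
      (∑ i : Fin n, if m ≤ i then (A m i : ℤ) else 0) -
        ∑ i : Fin n, if i < m then (A i m : ℤ) else 0 := by
    intro m
    have h1 : (∑ i : Fin n, if m ≤ i then (A m i : ℤ) else 0) =
        ∑ k : Fin n, ∑ i : Fin n, if k = m ∧ m ≤ i then (A k i : ℤ) else 0 := by
      symm
      rw [Finset.sum_eq_single_of_mem m (Finset.mem_univ m)]
      · simp
      · intro k _ hk
        simp [hk]
    have h2 : (∑ i : Fin n, if i < m then (A i m : ℤ) else 0) =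
        ∑ k : Fin n, ∑ i : Fin n, if i = m ∧ k < m then (A k i : ℤ) else 0 := by
      refine Finset.sum_congr rfl fun k _ => ?_
      rw [Finset.sum_eq_single_of_mem m (Finset.mem_univ m)]
      · simp
      · intro i _ hi
        simp [hi]
    rw [h1, h2]
    simp only [X, ← Finset.sum_sub_distrib]
    refine Finset.sum_congr rfl fun k _ => Finset.sum_congr rfl fun i _ => ?_
    have e1 : i = k ↔ (i : ℕ) = k := Fin.ext_iff
    have e2 : k = m ↔ (k : ℕ) = m := Fin.ext_iff
    have e3 : i = m ↔ (i : ℕ) = m := Fin.ext_iff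
    simp only [e1, e2, e3, Fin.le_def, Fin.lt_def]
    split_ifs <;> omega
  have hX : ∀ m : Fin n, X (m + 1) =
      ((∑ k, ∑ i, (if k ≤ m ∧ (m < i ∨ i = k) then A k i else 0) : ℕ) : ℤ) := by
    intro m
    push_cast
    refine Finset.sum_congr rfl fun k _ => Finset.sum_congr rfl fun i _ => ?_
    simp only [Fin.le_def, Fin.lt_def, Nat.lt_succ_iff, Nat.succ_le_iff]
  refine and_congr_right fun _ => ?_
  simp only [← hstep]
  constructor
  · intro h m
    have hind : ∀ t, t ≤ n → X t = t := by
      intro t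
      induction t with
      | zero => intro _; simp [X]
      | succ t ih =>
        intro ht
        have := h ⟨t, ht⟩
        have := ih (by omega)
        push_cast
        simp only at *
        omega
    have := hind (m + 1) m.2
    rw [hX] at this
    exact_mod_cast this
  · intro h m
    have hsucc : X (m + 1) = (m : ℕ) + 1 := by rw [hX, h]; push_cast; rfl
    have hm : X m = (m : ℕ) := by
      obtain ⟨m, hm⟩ := m
      cases m with
      | zero => simp [X]
      | succ t =>
        have h3 := hX ⟨t, by omega⟩
        rw [h] at h3
        simpa using h3
    rw [hsucc, hm]
    ring

theorem ncard_isTesler_ones_eq (n : ℕ) :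
    {A : Fin n → Fin n → ℕ | IsTesler (fun _ => 1) A}.ncard = arcCount 0 n (fun m => m + 1) := by
  let U : Finset (Fin n × Fin n) := {e | e.1 ≤ e.2}
  obtain ⟨cov, hcov⟩ : ∃ cov : Fin n → Fin n × Fin n → Prop,
      ∀ m e, cov m e ↔ e.1 ≤ m ∧ (m < e.2 ∨ e.2 = e.1) := ⟨_, fun _ _ => Iff.rfl⟩
  let s : Fin n → Fin n × Fin n := fun m =>
    (m, if h : (m : ℕ) + 1 < n then ⟨m + 1, h⟩ else m)
  have h1 : {A : Fin n → Fin n → ℕ | IsTesler (fun _ => 1) A}.ncard =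
      {c : Fin n × Fin n → ℕ | (∀ e ∉ U, c e = 0) ∧
        ∀ m, ∑ e ∈ U with cov m e, c e = (m : ℕ) + 1}.ncard := by
    rw [← ncard_curry]
    congr 1
    ext c
    simp only [isTesler_ones_iff, Set.mem_ofPred_eq]
    refine and_congr ?_ (forall_congr' fun m => ?_)
    · simp [U, Prod.forall]
    · have : {e ∈ U | cov m e} = {e ∈ (Finset.univ ×ˢ Finset.univ : Finset (Fin n × Fin n)) |
          e.1 ≤ m ∧ (m < e.2 ∨ e.2 = e.1)} := by
        ext e
        simp only [U, hcov, Finset.mem_filter, Finset.mem_univ, Finset.mem_product, true_and,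
          Fin.ext_iff, Fin.le_def, Fin.lt_def]
        omega
      rw [this, Finset.sum_filter, Finset.sum_product]
  obtain ⟨V, hV⟩ : ∃ V : Finset (Fin n × Fin n), ∀ e, e ∈ V ↔ e ∈ U ∧ e ∉ Set.range s :=
    ⟨{e ∈ U | e ∉ Set.range s}, fun e => Finset.mem_filter⟩
  have hmem : ∀ e, e ∈ V ↔
      (e.1 : ℕ) ≤ e.2 ∧ (e.2 : ℕ) ≠ e.1 + 1 ∧ ((e.2 : ℕ) = e.1 → (e.1 : ℕ) + 1 < n) := by
    rintro ⟨⟨i, hi⟩, ⟨j, hj⟩⟩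
    simp only [hV, U, s, Finset.mem_filter, Finset.mem_univ, true_and, Set.mem_range, Prod.mk.injEq,
      not_exists, not_and, Fin.le_def]
    refine and_congr_right fun hij => ?_
    constructor
    · intro h
      have := h ⟨i, hi⟩ rfl
      by_cases h' : i + 1 < n
      · simp only [h', dif_pos, Fin.mk.injEq] at this
        omega
      · simp only [h', dif_neg, not_false_eq_true, Fin.mk.injEq] at this
        omega
    · rintro h x rfl
      by_cases h' : i + 1 < n
      · simp only [h', dif_pos, Fin.mk.injEq]
        omega
      · simp only [h', dif_neg, not_false_eq_true, Fin.mk.injEq]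
        omega
  rw [h1, Packings.ncard_exact_eq s (fun m => ?_) (fun m m' => ?_) hV
    (fun m : Fin n => (m : ℕ) + 1)]
  · let φ : Fin n × Fin n → ℕ × ℕ := fun e =>
      (e.1, if (e.2 : ℕ) = e.1 then n - 1 else e.2 - 1)
    have hφ : ∀ e ∈ V, φ e ∈ arcs 0 n := fun e he => by
      rw [hmem] at he
      have := e.2.2
      simp only [mem_arcs, φ]
      split_ifs <;> omega
    have hinj : Set.InjOn φ V := by
      rintro ⟨⟨i, hi⟩, ⟨j, hj⟩⟩ he ⟨⟨i', hi'⟩, ⟨j', hj'⟩⟩ he' h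
      have he := (hmem _).1 he
      have he' := (hmem _).1 he'
      simp only [φ, Prod.mk.injEq, Fin.mk.injEq] at h he he' ⊢
      split_ifs at h <;> omega
    refine le_antisymm ?_ ?_
    · refine Packings.ncard_le_of_map φ exists_covers_of_mem_arcs hφ hinj ?_
      rintro m ⟨e, he, hm⟩
      have hmn := (mem_arcs.1 (hφ e he)).2.2
      refine ⟨⟨m, lt_of_le_of_lt hm.2 hmn⟩, le_rfl, ?_⟩
      rintro ⟨⟨i, hi⟩, ⟨j, hj⟩⟩ he h
      rw [hmem] at he
      simp only [Covers, φ, hcov, Fin.le_def, Fin.lt_def, Fin.mk.injEq] at h he ⊢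
      split_ifs at h <;> omega
    · refine Packings.ncard_le_of_surjOn φ (fun e he => ⟨e.1, (hcov _ _).2 ⟨le_rfl, ?_⟩⟩) hφ
        hinj ?_ ?_
      · have := (hmem e).1 he
        simp only [Fin.lt_def, Fin.ext_iff]
        omega
      · rintro ⟨i, j⟩ hf
        have hf := mem_arcs.1 hf
        simp only at hf
        by_cases hj : j + 1 < n
        · refine ⟨(⟨i, by omega⟩, ⟨j + 1, hj⟩), (hmem _).2 ?_, ?_⟩
          · simp only; omega
          · simp only [φ, Prod.mk.injEq, true_and]; split_ifs <;> omega
        · refine ⟨(⟨i, by omega⟩, ⟨i, by omega⟩), (hmem _).2 ?_, ?_⟩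
          · simp only; omega
          · simp only [φ, Prod.mk.injEq, true_and, if_true]; omega
      · intro m
        refine ⟨m, le_rfl, ?_⟩
        rintro ⟨⟨i, hi⟩, ⟨j, hj⟩⟩ he h
        rw [hmem] at he
        simp only [Covers, φ, hcov, Fin.le_def, Fin.lt_def, Fin.mk.injEq] at h he ⊢
        split_ifs <;> omega
  · simp only [U, s, Finset.mem_filter, Finset.mem_univ, true_and, Fin.le_def]
    split_ifs <;> simp
  · obtain ⟨m, hm⟩ := m
    obtain ⟨m', hm'⟩ := m'
    simp only [hcov, s, Fin.le_def]
    by_cases h' : m' + 1 < n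
    · simp only [h', dif_pos, Fin.mk.injEq, Fin.lt_def]
      omega
    · simp only [h', dif_neg, not_false_eq_true, or_true, and_true, Fin.mk.injEq]
      omega

theorem log_ncard_le (E : Finset α) (S : Set (α → ℕ)) (hne : S.Nonempty) (wt : α → ℕ) (W : ℕ)
    (hsupp : ∀ c ∈ S, ∀ e ∉ E, c e = 0) (hpos : ∀ e ∈ E, 0 < wt e)
    (hW : ∀ c ∈ S, ∑ e ∈ E, wt e * c e ≤ W) {t : ℝ} (ht0 : 0 < t) (ht1 : t < 1) :
    Real.log S.ncard ≤ W * -Real.log t + ∑ e ∈ E, -Real.log (1 - t ^ wt e) := by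
  obtain ⟨hfin, hle⟩ := finite_and_ncard_mul_pow_le E S wt W hsupp hpos hW ht0 ht1
  have hcard : (0 : ℝ) < S.ncard := by exact_mod_cast (Set.ncard_pos hfin).2 hne
  have hlog := Real.log_le_log (by positivity) hle
  rw [Real.log_mul hcard.ne' (by positivity), Real.log_pow, Real.log_prod] at hlog
  · simp only [Real.log_inv] at hlog
    linarith
  · intro e he
    have : t ^ wt e < 1 := pow_lt_one₀ ht0.le ht1 (hpos e he).ne'
    exact inv_ne_zero (by linarith)

theorem arcCount_pos (a b : ℕ) (η : ℕ → ℕ) : 0 < arcCount a b η :=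
  Packings.ncard_pos exists_covers_of_mem_arcs η

theorem arcCount_mono {a b a' b' : ℕ} {η η' : ℕ → ℕ} (ha : a' ≤ a) (hb : b ≤ b')
    (h : ∀ m, a ≤ m → m < b → η m ≤ η' m) : arcCount a b η ≤ arcCount a' b' η' := by
  refine Packings.ncard_le_of_map id exists_covers_of_mem_arcs (fun e he => ?_)
    Function.injective_id.injOn ?_
  · rw [mem_arcs] at he
    simp only [id, mem_arcs]
    omega
  · rintro m ⟨e, he, hm⟩
    rw [mem_arcs] at he
    simp only [Covers, id] at hm
    exact ⟨m, h m (by omega) (by omega), fun _ _ h => h⟩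

theorem arcCount_shift (a w h : ℕ) :
    arcCount a (a + w) (fun _ => h) = arcCount 0 w (fun _ => h) := by
  let φ : ℕ × ℕ → ℕ × ℕ := fun e => (e.1 + a, e.2 + a)
  have hinj : Set.InjOn φ (arcs 0 w) := by
    rintro ⟨i, j⟩ _ ⟨i', j'⟩ _ h
    simp only [φ, Prod.mk.injEq] at h ⊢
    omega
  have hφ : ∀ e ∈ arcs 0 w, φ e ∈ arcs a (a + w) := by
    intro e he
    simp only [mem_arcs, φ] at he ⊢
    omega
  refine le_antisymm ?_ ?_
  · refine Packings.ncard_le_of_surjOn φ exists_covers_of_mem_arcs hφ hinj ?_ ?_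
    · rintro ⟨i, j⟩ hf
      rw [mem_arcs] at hf
      refine ⟨(i - a, j - a), ?_, ?_⟩
      · simp only [mem_arcs] at hf ⊢
        omega
      · simp only [φ, Prod.mk.injEq]
        omega
    · intro m
      refine ⟨m + a, le_rfl, fun e _ h => ?_⟩
      simp only [Covers, φ] at h ⊢
      omega
  · refine Packings.ncard_le_of_map φ exists_covers_of_mem_arcs hφ hinj ?_
    intro m _
    refine ⟨m - a, le_rfl, fun e _ h => ?_⟩
    simp only [Covers, φ] at h ⊢
    omega

theorem arcCount_mul_le {a b c : ℕ} (hab : a ≤ b) (hbc : b ≤ c) (η : ℕ → ℕ) :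
    arcCount a b η * arcCount b c η ≤ arcCount a c η := by
  have hsub : arcs a b ∪ arcs b c ⊆ arcs a c := by
    intro e he
    simp only [Finset.mem_union, mem_arcs] at he ⊢
    omega
  refine (Packings.ncard_mul_le (arcs a b) (arcs b c) exists_covers_of_mem_arcs
    exists_covers_of_mem_arcs ?_ (fun m => ?_) η).trans ?_
  · rw [Finset.disjoint_left]
    intro e h1 h2
    rw [mem_arcs] at h1 h2
    omega
  · rcases lt_or_ge m b with h | h
    · right
      intro e he hm
      rw [mem_arcs] at he
      simp only [Covers] at hm
      omega
    · left
      intro e he hm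
      rw [mem_arcs] at he
      simp only [Covers] at hm
      omega
  · exact Packings.ncard_le_of_map id exists_covers_of_mem_arcs hsub
      Function.injective_id.injOn fun m _ => ⟨m, le_rfl, fun _ _ h => h⟩

theorem arcCount_pow_le (q w h : ℕ) :
    arcCount 0 w (fun _ => h) ^ q ≤ arcCount 0 (q * w) (fun _ => h) := by
  induction q with
  | zero => exact arcCount_pos _ _ _
  | succ q ih =>
    rw [pow_succ, Nat.succ_mul]
    calc _ ≤ arcCount 0 (q * w) (fun _ => h) * arcCount 0 w (fun _ => h) :=
          Nat.mul_le_mul_right _ ih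
      _ = arcCount 0 (q * w) (fun _ => h) * arcCount (q * w) (q * w + w) (fun _ => h) := by
          rw [arcCount_shift]
      _ ≤ _ := arcCount_mul_le (Nat.zero_le _) (Nat.le_add_right _ _) _

theorem arcCount_pow_sq_le {k : ℕ} (hk : 0 < k) (w h : ℕ) :
    arcCount 0 w (fun _ => h) ^ (k * k) ≤ arcCount 0 (k * w) (fun _ => k * k * h) := by
  have hcard : Fintype.card (Fin k × Fin k) = k * k := by simp
  rw [← hcard]
  refine (Packings.ncard_pow_le (Fin k × Fin k) exists_covers_of_mem_arcs (fun _ => h)).trans ?_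
  have hlex : ∀ (i i' : ℕ) (x x' : Fin k), k * i + x = k * i' + x' → i = i' ∧ x = x' := by
    intro i i' x x' h
    have h1 : (k * i + x) / k = i := by
      rw [Nat.mul_add_div hk, Nat.div_eq_of_lt x.2, add_zero]
    have h2 : (k * i' + x') / k = i' := by
      rw [Nat.mul_add_div hk, Nat.div_eq_of_lt x'.2, add_zero]
    have h3 : i = i' := by rw [← h1, h, h2]
    subst h3
    exact ⟨rfl, Fin.ext (by omega)⟩
  refine Packings.ncard_le_of_map
    (fun p : (Fin k × Fin k) × (ℕ × ℕ) => (k * p.2.1 + p.1.1, k * p.2.2 + p.1.2))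
    exists_covers_of_mem_arcs ?_ ?_ ?_
  · rintro ⟨⟨x, y⟩, ⟨i, j⟩⟩ hp
    have hp := mem_arcs.1 (Finset.mem_product.1 hp).2
    simp only at hp
    have h1 : k * (i + 1) ≤ k * j := Nat.mul_le_mul_left k hp.2.1
    have h2 : k * (j + 1) ≤ k * w := Nat.mul_le_mul_left k hp.2.2
    rw [Nat.mul_succ] at h1 h2
    have := x.2
    have := y.2
    simp only [mem_arcs]
    omega
  · rintro ⟨⟨x, y⟩, ⟨i, j⟩⟩ _ ⟨⟨x', y'⟩, ⟨i', j'⟩⟩ _ h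
    simp only [Prod.mk.injEq] at h
    obtain ⟨rfl, rfl⟩ := hlex _ _ _ _ h.1
    obtain ⟨rfl, rfl⟩ := hlex _ _ _ _ h.2
    rfl
  · rintro m -
    refine ⟨m / k, le_rfl, ?_⟩
    rintro ⟨⟨x, y⟩, ⟨i, j⟩⟩ - h
    simp only [Covers] at h ⊢
    constructor
    · rw [Nat.le_div_iff_mul_le hk, mul_comm]
      omega
    · refine Nat.lt_succ_iff.1 ((Nat.div_lt_iff_lt_mul hk).2 ?_)
      have := y.2
      rw [mul_comm, Nat.mul_succ]
      omega

theorem log_arcCount_le_add_add {b c : ℕ} (hc : 0 < c) (η : ℕ → ℕ) :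
    Real.log (arcCount 0 c η) ≤ Real.log (arcCount 0 b η) + Real.log (arcCount b c η) +
      (η b * Real.log ((c : ℝ) ^ 2 + 1) + 1) := by
  obtain ⟨E, hE⟩ : ∃ E : Finset (ℕ × ℕ), ∀ e, e ∈ E ↔ e ∈ arcs 0 c ∧ e.1 < b ∧ b ≤ e.2 :=
    ⟨{e ∈ arcs 0 c | e.1 < b ∧ b ≤ e.2}, fun _ => Finset.mem_filter⟩
  have hEc : ∀ e ∈ E, ∃ m, Covers m e := fun e he =>
    exists_covers_of_mem_arcs e ((hE e).1 he).1
  have hUc : ∀ e ∈ arcs b c ∪ E, ∃ m, Covers m e := fun e he =>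
    (Finset.mem_union.1 he).elim (exists_covers_of_mem_arcs e) (hEc e)
  have hsplit : arcCount 0 c η ≤
      arcCount 0 b η * (arcCount b c η * (Packings E Covers η).ncard) := by
    have h1 : arcCount 0 c η ≤ (Packings (arcs 0 b ∪ (arcs b c ∪ E)) Covers η).ncard := by
      refine Packings.ncard_le_of_map id ?_ ?_ Function.injective_id.injOn
        fun m _ => ⟨m, le_rfl, fun _ _ h => h⟩
      · intro e he
        exact (Finset.mem_union.1 he).elim (exists_covers_of_mem_arcs e) (hUc e)
      · intro e he
        simp only [id, hE, Finset.mem_union, mem_arcs] at he ⊢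
        omega
    refine h1.trans ((Packings.ncard_union_le _ _ exists_covers_of_mem_arcs hUc η).trans ?_)
    exact Nat.mul_le_mul_left _
      (Packings.ncard_union_le _ _ exists_covers_of_mem_arcs hEc η)
  have hp1 : (0 : ℝ) < arcCount 0 b η := by exact_mod_cast arcCount_pos 0 b η
  have hp2 : (0 : ℝ) < arcCount b c η := by exact_mod_cast arcCount_pos b c η
  have hp3 : (0 : ℝ) < (Packings E Covers η).ncard := by
    exact_mod_cast Packings.ncard_pos hEc η
  have hp0 : (0 : ℝ) < arcCount 0 c η := by exact_mod_cast arcCount_pos 0 c η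
  have hlog : Real.log (arcCount 0 c η) ≤ Real.log (arcCount 0 b η) +
      (Real.log (arcCount b c η) + Real.log (Packings E Covers η).ncard) := by
    rw [← Real.log_mul hp2.ne' hp3.ne', ← Real.log_mul hp1.ne' (by positivity)]
    exact Real.log_le_log hp0 (by exact_mod_cast hsplit)
  have hc' : (1 : ℝ) ≤ c := by exact_mod_cast hc
  have hq : (0 : ℝ) < (c : ℝ) ^ 2 := by positivity
  have hcross : Real.log (Packings E Covers η).ncard ≤ η b * Real.log ((c : ℝ) ^ 2 + 1) + 1 := by
    have h := log_ncard_le E (Packings E Covers η) ⟨0, Packings.zero_mem _ _ _⟩ (fun _ => 1) (η b)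
      (fun c hc => hc.1) (fun _ _ => one_pos) (fun d hd => ?_)
      (t := 1 / ((c : ℝ) ^ 2 + 1)) (by positivity)
      (by rw [div_lt_one (by positivity)]; linarith)
    · have hEcard : (E.card : ℝ) ≤ (c : ℝ) ^ 2 := by
        have h1 : E.card ≤ c * c := by
          have h2 : E ⊆ Finset.range c ×ˢ Finset.range c := fun e he => by
            have h3 := mem_arcs.1 ((hE e).1 he).1
            simp only [Finset.mem_product, Finset.mem_range]
            omega
          simpa using Finset.card_le_card h2
        rw [sq]
        exact_mod_cast h1
      have h2 : -Real.log (1 - 1 / ((c : ℝ) ^ 2 + 1)) ≤ 1 / (c : ℝ) ^ 2 := by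
        have h3 : 1 - 1 / ((c : ℝ) ^ 2 + 1) = (1 + 1 / (c : ℝ) ^ 2)⁻¹ := by
          field_simp
          ring
        rw [h3, Real.log_inv, neg_neg]
        have := Real.log_le_sub_one_of_pos (x := 1 + 1 / (c : ℝ) ^ 2) (by positivity)
        linarith
      simp only [pow_one, Finset.sum_const, nsmul_eq_mul] at h
      rw [one_div, Real.log_inv, neg_neg, ← one_div] at h
      have h4 : (E.card : ℝ) * -Real.log (1 - 1 / ((c : ℝ) ^ 2 + 1)) ≤ 1 := by
        calc (E.card : ℝ) * -Real.log (1 - 1 / ((c : ℝ) ^ 2 + 1))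
            ≤ E.card * (1 / (c : ℝ) ^ 2) := by gcongr
          _ ≤ (c : ℝ) ^ 2 * (1 / (c : ℝ) ^ 2) := by gcongr
          _ = 1 := by field_simp
      linarith
    · have h1 : ∑ e ∈ E with Covers b e, d e ≤ η b := hd.2 b
      rw [Finset.filter_true_of_mem fun e he => ⟨((hE e).1 he).2.1.le, ((hE e).1 he).2.2⟩] at h1
      simpa using h1
  linarith

theorem sum_neg_log_one_sub_pow_le {t : ℝ} (ht0 : 0 < t) (ht1 : t < 1) (M : ℕ) :
    ∑ l ∈ Finset.range M, -Real.log (1 - t ^ (l + 1)) ≤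
      (∑' k : ℕ, 1 / ((k : ℝ) + 1) ^ 2) * (1 - t)⁻¹ := by
  have hpow : ∀ l : ℕ, |t ^ (l + 1)| < 1 := fun l => by
    rw [abs_of_pos (by positivity)]
    exact pow_lt_one₀ ht0.le ht1 (Nat.succ_ne_zero l)
  have h1 : HasSum (fun k : ℕ => ∑ l ∈ Finset.range M, (t ^ (l + 1)) ^ (k + 1) / ((k : ℝ) + 1))
      (∑ l ∈ Finset.range M, -Real.log (1 - t ^ (l + 1))) :=
    hasSum_sum fun l _ => Real.hasSum_pow_div_log_of_abs_lt_one (hpow l)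
  have hs : Summable (fun k : ℕ => 1 / ((k : ℝ) + 1) ^ 2) := by
    have := (summable_nat_add_iff 1).2 (Real.summable_one_div_nat_pow.2 one_lt_two)
    simpa using this
  refine hasSum_le (fun k => ?_) h1 (hs.hasSum.mul_right _)
  have hk : (0 : ℝ) < (k : ℝ) + 1 := by positivity
  have hu0 : 0 < t ^ (k + 1) := by positivity
  have hu1 : t ^ (k + 1) < 1 := pow_lt_one₀ ht0.le ht1 (Nat.succ_ne_zero k)
  have hgeom : ∑ l ∈ Finset.range M, (t ^ (l + 1)) ^ (k + 1) ≤
      t ^ (k + 1) * (1 - t ^ (k + 1))⁻¹ := by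
    calc ∑ l ∈ Finset.range M, (t ^ (l + 1)) ^ (k + 1)
        = t ^ (k + 1) * ∑ l ∈ Finset.range M, (t ^ (k + 1)) ^ l := by
          rw [Finset.mul_sum]
          refine Finset.sum_congr rfl fun l _ => ?_
          rw [← pow_mul, ← pow_mul, ← pow_add]
          congr 1
          ring
      _ ≤ t ^ (k + 1) * (1 - t ^ (k + 1))⁻¹ := by
          gcongr
          rw [← tsum_geometric_of_lt_one hu0.le hu1]
          exact (summable_geometric_of_lt_one hu0.le hu1).sum_le_tsum _
            (fun _ _ => by positivity)
  have hbern : ((k : ℝ) + 1) * t ^ (k + 1) * (1 - t) ≤ 1 - t ^ (k + 1) := by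
    have h2 : (∑ i ∈ Finset.range (k + 1), t ^ i) * (1 - t) = 1 - t ^ (k + 1) :=
      geom_sum_mul_neg t (k + 1)
    rw [← h2]
    refine mul_le_mul_of_nonneg_right ?_ (by linarith)
    have h3 : ∀ i ∈ Finset.range (k + 1), t ^ (k + 1) ≤ t ^ i := fun i hi =>
      pow_le_pow_of_le_one ht0.le ht1.le (Finset.mem_range.1 hi).le
    have := Finset.card_nsmul_le_sum _ _ _ h3
    simpa using this
  rw [← Finset.sum_div, div_le_iff₀ hk]
  refine hgeom.trans ?_
  have h1t : 0 < 1 - t := by linarith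
  have h1u : 0 < 1 - t ^ (k + 1) := by linarith
  rw [← div_eq_mul_inv, div_le_iff₀ h1u]
  calc t ^ (k + 1) = 1 / ((k : ℝ) + 1) ^ 2 * (1 - t)⁻¹ * ((k : ℝ) + 1) *
        (((k : ℝ) + 1) * t ^ (k + 1) * (1 - t)) := by field_simp
    _ ≤ _ := by gcongr

theorem exists_log_arcCount_le : ∃ C : ℝ, ∀ w h : ℕ, 0 < h →
    Real.log (arcCount 0 w fun _ => h) ≤ C * ((w : ℝ) * Real.sqrt h) := by
  refine ⟨1 + (∑' k : ℕ, 1 / ((k : ℝ) + 1) ^ 2) * 2, fun w h hh => ?_⟩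
  set A : ℝ := ∑' k : ℕ, 1 / ((k : ℝ) + 1) ^ 2 with hA
  have hA0 : 0 ≤ A := tsum_nonneg fun k => by positivity
  have hh' : (1 : ℝ) ≤ h := by exact_mod_cast hh
  set r : ℝ := Real.sqrt h with hr
  have hr1 : 1 ≤ r := by rw [hr, Real.one_le_sqrt]; exact hh'
  have hr2 : r * r = h := Real.mul_self_sqrt (by positivity)
  have ht0 : 0 < r / (r + 1) := by positivity
  have ht1 : r / (r + 1) < 1 := by rw [div_lt_one (by positivity)]; linarith
  have hmain := log_ncard_le (arcs 0 w) (Packings (arcs 0 w) Covers fun _ => h)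
    ⟨0, Packings.zero_mem _ _ _⟩ (fun e => e.2 - e.1) (w * h) (fun c hc => hc.1)
    (fun e he => Nat.sub_pos_of_lt (mem_arcs.1 he).2.1) (fun c hc => ?_) ht0 ht1
  · set t : ℝ := r / (r + 1) with ht
    have h1 : -Real.log t ≤ 1 / r := by
      have h2 : t⁻¹ = 1 + 1 / r := by rw [ht]; field_simp
      rw [← Real.log_inv, h2]
      have := Real.log_le_sub_one_of_pos (x := 1 + 1 / r) (by positivity)
      linarith
    have h2 : (1 - t)⁻¹ ≤ 2 * r := by
      have : (1 - t)⁻¹ = r + 1 := by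
        rw [ht, one_sub_div (by positivity), add_sub_cancel_left, one_div, inv_inv]
      linarith
    have hf0 : ∀ l : ℕ, 0 ≤ -Real.log (1 - t ^ (l + 1)) := fun l => by
      have h3 : t ^ (l + 1) < 1 := pow_lt_one₀ ht0.le ht1 (Nat.succ_ne_zero l)
      have h4 : 0 < t ^ (l + 1) := by positivity
      exact neg_nonneg.2 (Real.log_nonpos (by linarith) (by linarith))
    have h3 : ∑ e ∈ arcs 0 w, -Real.log (1 - t ^ (e.2 - e.1)) ≤
        ∑ p ∈ Finset.range w ×ˢ Finset.range w, -Real.log (1 - t ^ (p.2 + 1)) := by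
      calc ∑ e ∈ arcs 0 w, -Real.log (1 - t ^ (e.2 - e.1))
          = ∑ p ∈ (arcs 0 w).image (fun e => (e.1, e.2 - e.1 - 1)),
              -Real.log (1 - t ^ (p.2 + 1)) := by
            rw [Finset.sum_image]
            · refine Finset.sum_congr rfl fun e he => ?_
              have := (mem_arcs.1 he).2.1
              rw [show e.2 - e.1 - 1 + 1 = e.2 - e.1 by omega]
            · rintro ⟨i, j⟩ he ⟨i', j'⟩ he' h
              have he := mem_arcs.1 he
              have he' := mem_arcs.1 he'
              simp only [Prod.mk.injEq] at h he he' ⊢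
              omega
        _ ≤ _ := by
            refine Finset.sum_le_sum_of_subset_of_nonneg ?_ fun p _ _ => hf0 p.2
            intro p hp
            obtain ⟨e, he, rfl⟩ := Finset.mem_image.1 hp
            rw [mem_arcs] at he
            simp only [Finset.mem_product, Finset.mem_range]
            omega
    have h4 : ∑ p ∈ Finset.range w ×ˢ Finset.range w, -Real.log (1 - t ^ (p.2 + 1)) ≤
        w * (A * (2 * r)) := by
      rw [Finset.sum_product]
      dsimp only
      rw [Finset.sum_const, Finset.card_range, nsmul_eq_mul]
      gcongr
      exact (sum_neg_log_one_sub_pow_le ht0 ht1 w).trans (by gcongr)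
    have h5 : ((w * h : ℕ) : ℝ) * -Real.log t ≤ w * r := by
      calc ((w * h : ℕ) : ℝ) * -Real.log t ≤ ((w * h : ℕ) : ℝ) * (1 / r) := by gcongr
        _ = w * r := by
          push_cast
          rw [← hr2]
          field_simp
    calc Real.log (arcCount 0 w fun _ => h) ≤ _ := hmain
      _ ≤ w * r + w * (A * (2 * r)) := add_le_add h5 (h3.trans h4)
      _ = (1 + A * 2) * (w * r) := by ring
  · calc ∑ e ∈ arcs 0 w, (e.2 - e.1) * c e
        ≤ ∑ e ∈ arcs 0 w, ∑ m ∈ Finset.range w, if Covers m e then c e else 0 := by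
          refine Finset.sum_le_sum fun e he => ?_
          rw [← Finset.sum_filter, Finset.sum_const, smul_eq_mul]
          refine Nat.mul_le_mul_right _ ?_
          rw [← Nat.card_Ico]
          refine Finset.card_le_card fun m hm => ?_
          rw [mem_arcs] at he
          rw [Finset.mem_Ico] at hm
          refine Finset.mem_filter.2 ⟨Finset.mem_range.2 ?_, ?_⟩
          · omega
          · exact ⟨hm.1, hm.2.le⟩
      _ = ∑ m ∈ Finset.range w, ∑ e ∈ arcs 0 w with Covers m e, c e := by
          rw [Finset.sum_comm]
          simp only [Finset.sum_filter]
      _ ≤ w * h := by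
          have := Finset.sum_le_card_nsmul (Finset.range w) _ h (fun m _ => hc.2 m)
          simpa using this

/-- The logarithm of the number of packings of arcs in `[0, w)` at constant height `h`. -/
noncomputable def boxLog (h w : ℕ) : ℝ := Real.log (arcCount 0 w fun _ => h)

/-- The logarithm of the number of packings of arcs in `[0, n)` at height `(1, 2, …, n)`. -/
noncomputable def stairLog (n : ℕ) : ℝ := Real.log (arcCount 0 n fun m => m + 1)

theorem log_arcCount_mono {a b a' b' : ℕ} {η η' : ℕ → ℕ} (ha : a' ≤ a) (hb : b ≤ b')
    (h : ∀ m, a ≤ m → m < b → η m ≤ η' m) :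
    Real.log (arcCount a b η) ≤ Real.log (arcCount a' b' η') :=
  Real.log_le_log (by exact_mod_cast arcCount_pos a b η) (by exact_mod_cast arcCount_mono ha hb h)

theorem boxLog_nonneg (h w : ℕ) : 0 ≤ boxLog h w := Real.log_natCast_nonneg _

theorem stairLog_nonneg (n : ℕ) : 0 ≤ stairLog n := Real.log_natCast_nonneg _

theorem boxLog_mono {h h' w w' : ℕ} (hh : h ≤ h') (hw : w ≤ w') : boxLog h w ≤ boxLog h' w' :=
  log_arcCount_mono le_rfl hw fun _ _ _ => hh

theorem stairLog_mono : Monotone stairLog := fun _ _ h =>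
  log_arcCount_mono le_rfl h fun _ _ _ => le_rfl

theorem mul_boxLog_le (q h w : ℕ) : q * boxLog h w ≤ boxLog h (q * w) := by
  rw [boxLog, ← Real.log_pow]
  have := arcCount_pos 0 w fun _ => h
  exact Real.log_le_log (by positivity) (by exact_mod_cast arcCount_pow_le q w h)

theorem sq_mul_boxLog_le {k : ℕ} (hk : 0 < k) (h w : ℕ) :
    (k * k : ℝ) * boxLog h w ≤ boxLog (k * k * h) (k * w) := by
  rw [boxLog, ← Nat.cast_mul, ← Real.log_pow]
  have := arcCount_pos 0 w fun _ => h
  exact Real.log_le_log (by positivity) (by exact_mod_cast arcCount_pow_sq_le hk w h)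

theorem boxLog_one_two_pos : 0 < boxLog 1 2 := by
  refine Real.log_pos ?_
  have hfin : (Packings (arcs 0 2) Covers fun _ => 1).Finite :=
    Packings.finite exists_covers_of_mem_arcs _
  have hmem : Pi.single ((0, 1) : ℕ × ℕ) 1 ∈ Packings (arcs 0 2) Covers fun _ => 1 := by
    refine ⟨fun e he => Pi.single_eq_of_ne (fun h => he ?_) _, fun m => ?_⟩
    · rw [h, mem_arcs]
      decide
    · exact (Finset.sum_le_sum_of_subset (Finset.filter_subset _ _)).trans
        (by rw [Finset.sum_pi_single']; split_ifs <;> simp)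
  have : 1 < (Packings (arcs 0 2) Covers fun _ => 1).ncard := by
    rw [Set.one_lt_ncard hfin]
    exact ⟨0, Packings.zero_mem _ _ _, _, hmem, fun h => by simpa using congrFun h (0, 1)⟩
  exact_mod_cast this

theorem stairLog_add_boxLog_le (n b : ℕ) : stairLog n + boxLog n b ≤ stairLog (n + b) := by
  have h1 : (0 : ℝ) < arcCount 0 n fun m => m + 1 := by exact_mod_cast arcCount_pos _ _ _
  have h2 : (0 : ℝ) < arcCount n (n + b) fun m => m + 1 := by exact_mod_cast arcCount_pos _ _ _
  have h3 : boxLog n b ≤ Real.log (arcCount n (n + b) fun m => m + 1) := by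
    rw [boxLog, ← arcCount_shift n b n]
    exact log_arcCount_mono le_rfl le_rfl fun m hm _ => by omega
  calc stairLog n + boxLog n b
      ≤ stairLog n + Real.log (arcCount n (n + b) fun m => m + 1) := by gcongr
    _ ≤ stairLog (n + b) := by
        rw [stairLog, ← Real.log_mul h1.ne' h2.ne']
        exact Real.log_le_log (by positivity) (by
          exact_mod_cast arcCount_mul_le (Nat.zero_le n) (Nat.le_add_right n b) fun m => m + 1)

theorem stairLog_add_le (n : ℕ) {b M : ℕ} (hb : 0 < b) (hM : n + b ≤ M) :
    stairLog (n + b) ≤ stairLog n + boxLog (n + b) b + (M * Real.log ((M : ℝ) ^ 2 + 1) + 1) := by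
  have h := log_arcCount_le_add_add (b := n) (c := n + b) (by omega) fun m => m + 1
  have h1 : Real.log (arcCount n (n + b) fun m => m + 1) ≤ boxLog (n + b) b := by
    rw [boxLog, ← arcCount_shift n b (n + b)]
    exact log_arcCount_mono le_rfl le_rfl fun m _ hm => hm
  have h2 : ((n + 1 : ℕ) : ℝ) * Real.log (((n + b : ℕ) : ℝ) ^ 2 + 1) ≤
      M * Real.log ((M : ℝ) ^ 2 + 1) := by
    have h3 : 0 ≤ Real.log (((n + b : ℕ) : ℝ) ^ 2 + 1) :=
      Real.log_nonneg (by linarith [sq_nonneg ((n + b : ℕ) : ℝ)])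
    have h4 : n + 1 ≤ M := by omega
    gcongr
  rw [stairLog, stairLog]
  linarith

theorem exists_boxLog_asymp : ∃ γ : ℝ, 0 < γ ∧
    (∀ h w : ℕ, 0 < h → 0 < w → boxLog h w ≤ γ * (w * √h)) ∧
    ∀ ε > 0, ε < 1 → ∃ B > 0, ∀ h w : ℕ, B ≤ √h → B * √h ≤ w →
      (1 - ε) * (γ * (w * √h)) ≤ boxLog h w := by
  let S : Set ℝ := {x | ∃ h w : ℕ, 0 < h ∧ 0 < w ∧ x = boxLog h w / (w * √h)}
  obtain ⟨C, hC⟩ := exists_log_arcCount_le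
  have hbdd : BddAbove S := by
    refine ⟨C, ?_⟩
    rintro _ ⟨h, w, hh, hw, rfl⟩
    have : 0 < (w : ℝ) * √h := by positivity
    rw [div_le_iff₀ this]
    exact hC w h hh
  have hmem : boxLog 1 2 / ((2 : ℕ) * √(1 : ℕ)) ∈ S := ⟨1, 2, one_pos, two_pos, rfl⟩
  have hγ : 0 < sSup S :=
    (div_pos boxLog_one_two_pos (by simp)).trans_le (le_csSup hbdd hmem)
  refine ⟨sSup S, hγ, fun h w hh hw => ?_, fun ε hε hε1 => ?_⟩
  · have : 0 < (w : ℝ) * √h := by positivity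
    rw [← div_le_iff₀ this]
    exact le_csSup hbdd ⟨h, w, hh, hw, rfl⟩
  set γ := sSup S
  obtain ⟨_, ⟨h₀, w₀, hh₀, hw₀, rfl⟩, hlt⟩ :=
    exists_lt_of_lt_csSup ⟨_, hmem⟩ (show (1 - ε / 2) * γ < sSup S by nlinarith)
  have hs₀ : 0 < √(h₀ : ℝ) := by positivity
  have hw₀' : 0 < (w₀ : ℝ) := by positivity
  rw [lt_div_iff₀ (by positivity)] at hlt
  refine ⟨4 * (w₀ + √h₀) / ε, by positivity, fun h w hB hw => ?_⟩
  rw [div_le_iff₀ hε] at hB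
  rw [div_mul_eq_mul_div, div_le_iff₀ hε] at hw
  set s := √(h : ℝ) with hs
  have hs1 : √(h₀ : ℝ) ≤ s := by nlinarith [Real.sqrt_nonneg (h : ℝ)]
  have hs0 : 0 < s := hs₀.trans_le hs1
  set k := ⌊s / √h₀⌋₊ with hk
  have hk1 : 0 < k := Nat.floor_pos.2 ((one_le_div hs₀).2 hs1)
  have hks : k * √h₀ ≤ s := by
    rw [← le_div_iff₀ hs₀]
    exact Nat.floor_le (by positivity)
  have hks' : s - √h₀ ≤ k * √h₀ := by
    have := (div_lt_iff₀ hs₀).1 (Nat.lt_floor_add_one (s / √h₀))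
    rw [← hk] at this
    linarith
  have hkh : k * k * h₀ ≤ h := by
    have h1 : (k * √h₀) * (k * √h₀) ≤ s * s := mul_self_le_mul_self (by positivity) hks
    rw [hs, Real.mul_self_sqrt (by positivity), mul_mul_mul_comm,
      Real.mul_self_sqrt (by positivity)] at h1
    exact_mod_cast h1
  set q := w / (k * w₀) with hq
  have hqw : q * (k * w₀) ≤ w := Nat.div_mul_le_self _ _
  have hqw' : (w : ℝ) - s / √h₀ * w₀ ≤ q * (k * w₀) := by
    have h1 : w < (q + 1) * (k * w₀) := by
      rw [mul_comm]
      exact Nat.lt_mul_div_succ w (by positivity)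
    have h2 : (w : ℝ) < (q + 1) * (k * w₀) := by exact_mod_cast h1
    have h3 : (k : ℝ) * w₀ ≤ s / √h₀ * w₀ := by
      gcongr
      exact (le_div_iff₀ hs₀).2 hks
    linarith
  have hchain : q * ((k * k) * boxLog h₀ w₀) ≤ boxLog h w := by
    calc q * ((k * k) * boxLog h₀ w₀) ≤ q * boxLog (k * k * h₀) (k * w₀) := by
          gcongr
          exact sq_mul_boxLog_le hk1 h₀ w₀
      _ ≤ boxLog (k * k * h₀) (q * (k * w₀)) := mul_boxLog_le _ _ _
      _ ≤ boxLog h w := boxLog_mono hkh hqw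
  have hh₀1 : 1 ≤ √(h₀ : ℝ) := Real.one_le_sqrt.2 (by exact_mod_cast hh₀)
  have hloss1 : (1 - ε / 4) * w ≤ q * (k * w₀) := by
    have h1 : s / √h₀ * w₀ ≤ s * w₀ := by
      gcongr
      exact div_le_self hs0.le hh₀1
    nlinarith
  have hloss2 : (1 - ε / 4) * s ≤ k * √h₀ := by nlinarith
  refine le_trans ?_ hchain
  have h1 : (1 - ε) ≤ (1 - ε / 4) * (1 - ε / 4) * (1 - ε / 2) := by nlinarith [sq_nonneg ε]
  calc (1 - ε) * (γ * (w * s))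
      ≤ ((1 - ε / 4) * (1 - ε / 4) * (1 - ε / 2)) * (γ * (w * s)) := by gcongr
    _ = ((1 - ε / 4) * w) * ((1 - ε / 4) * s) * ((1 - ε / 2) * γ) := by ring
    _ ≤ (q * (k * w₀)) * (k * √h₀) * ((1 - ε / 2) * γ) := by
        have : 0 ≤ (1 - ε / 2) * γ := mul_nonneg (by linarith) hγ.le
        have : 0 ≤ (1 - ε / 4) * s := mul_nonneg (by linarith) hs0.le
        gcongr
    _ = q * (k * k) * ((1 - ε / 2) * γ * (w₀ * √h₀)) := by ring
    _ ≤ q * (k * k) * boxLog h₀ w₀ := by gcongr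
    _ = _ := by ring

theorem two_thirds_le_sum_sqrt (N : ℕ) :
    2 / 3 * (N * √N) ≤ ∑ r ∈ Finset.range N, √((r + 1 : ℕ) : ℝ) := by
  induction N with
  | zero => simp
  | succ N ih =>
    rw [Finset.sum_range_succ]
    have ha := Real.sqrt_nonneg (N : ℝ)
    have hab : √(N : ℝ) ≤ √((N + 1 : ℕ) : ℝ) := Real.sqrt_le_sqrt (by simp)
    have ha2 := Real.mul_self_sqrt (Nat.cast_nonneg (α := ℝ) N)
    have hb2 := Real.mul_self_sqrt (Nat.cast_nonneg (α := ℝ) (N + 1))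
    generalize √(N : ℝ) = a at *
    generalize √((N + 1 : ℕ) : ℝ) = b at *
    generalize ∑ r ∈ Finset.range N, √((r + 1 : ℕ) : ℝ) = S at *
    push_cast at hb2 ⊢
    have h1 : b * b - a * a = 1 := by linarith
    rw [← hb2]
    rw [← ha2] at ih
    have h2 : 3 * b * (b * b - a * a) = 3 * b := by rw [h1]; ring
    nlinarith [mul_nonneg (sq_nonneg (b - a)) (by linarith : 0 ≤ b + 2 * a)]

theorem sum_sqrt_le_two_thirds (N : ℕ) :
    ∑ r ∈ Finset.range N, √(r : ℝ) ≤ 2 / 3 * (N * √N) := by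
  induction N with
  | zero => simp
  | succ N ih =>
    rw [Finset.sum_range_succ]
    have ha := Real.sqrt_nonneg (N : ℝ)
    have hab : √(N : ℝ) ≤ √((N + 1 : ℕ) : ℝ) := Real.sqrt_le_sqrt (by simp)
    have ha2 := Real.mul_self_sqrt (Nat.cast_nonneg (α := ℝ) N)
    have hb2 := Real.mul_self_sqrt (Nat.cast_nonneg (α := ℝ) (N + 1))
    refine (add_le_add_left ih _).trans ?_
    generalize √(N : ℝ) = a at *
    generalize √((N + 1 : ℕ) : ℝ) = b at *
    push_cast at hb2 ⊢
    have h1 : b * b - a * a = 1 := by linarith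
    rw [← hb2, ← ha2]
    have h2 : 3 * a * (b * b - a * a) = 3 * a := by rw [h1]; ring
    nlinarith [mul_nonneg (sq_nonneg (b - a)) (by linarith : 0 ≤ 2 * b + a)]

theorem sum_range_sqrt_succ (N : ℕ) :
    ∑ r ∈ Finset.range N, √((r + 1 : ℕ) : ℝ) = ∑ r ∈ Finset.range N, √(r : ℝ) + √N := by
  have := Finset.sum_range_succ' (fun r : ℕ => √(r : ℝ)) N
  rw [Finset.sum_range_succ] at this
  simpa using this.symm

theorem sum_boxLog_le_stairLog (b N : ℕ) :
    ∑ r ∈ Finset.range N, boxLog (r * b) b ≤ stairLog (N * b) := by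
  induction N with
  | zero => simpa using stairLog_nonneg 0
  | succ N ih =>
    rw [Finset.sum_range_succ, Nat.succ_mul]
    linarith [stairLog_add_boxLog_le (N * b) b]

theorem stairLog_le_sum_boxLog {b N M : ℕ} (hb : 0 < b) (hM : N * b ≤ M) :
    stairLog (N * b) ≤ ∑ r ∈ Finset.range N, boxLog ((r + 1) * b) b +
      N * (M * Real.log ((M : ℝ) ^ 2 + 1) + 1) := by
  induction N with
  | zero =>
    obtain ⟨C, hC⟩ := exists_log_arcCount_le
    have h : stairLog 0 ≤ boxLog 1 0 := log_arcCount_mono le_rfl le_rfl fun _ _ h => by omega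
    simpa using h.trans (hC 0 1 one_pos)
  | succ N ih =>
    rw [Nat.succ_mul] at hM
    rw [Finset.sum_range_succ, Nat.succ_mul]
    have := stairLog_add_le (N * b) hb hM
    push_cast
    linarith [ih (by omega)]

theorem eventually_log_error_le (N : ℕ) {K : ℝ} (hK : 0 < K) :
    ∀ᶠ c : ℕ in atTop,
      N * (((N * c : ℕ) : ℝ) * Real.log (((N * c : ℕ) : ℝ) ^ 2 + 1) + 1) ≤ K * (c * √c) := by
  have hs : Tendsto (fun c : ℕ => √(c : ℝ)) atTop atTop :=
    Real.tendsto_sqrt_atTop.comp tendsto_natCast_atTop_atTop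
  have hinv : Tendsto (fun c : ℕ => (√(c : ℝ))⁻¹) atTop (nhds 0) := hs.inv_tendsto_atTop
  have hlog : Tendsto (fun c : ℕ => Real.log c / √(c : ℝ)) atTop (nhds 0) := by
    have := (isLittleO_log_rpow_atTop (r := 1 / 2) (by norm_num)).tendsto_div_nhds_zero
    simp only [← Real.sqrt_eq_rpow] at this
    exact this.comp tendsto_natCast_atTop_atTop
  have hlim : Tendsto (fun c : ℕ => (N * N * (2 * Real.log (N + 1)) + N) * (√(c : ℝ))⁻¹ +
      2 * N * N * (Real.log c / √(c : ℝ))) atTop (nhds 0) := by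
    simpa using (hinv.const_mul _).add (hlog.const_mul (2 * N * N : ℝ))
  filter_upwards [hlim.eventually (ge_mem_nhds hK), eventually_ge_atTop 1] with c hc hc1
  have hc1' : (1 : ℝ) ≤ c := by exact_mod_cast hc1
  have hsc : 0 < √(c : ℝ) := by positivity
  have h1 : Real.log (((N * c : ℕ) : ℝ) ^ 2 + 1) ≤ 2 * Real.log (N + 1) + 2 * Real.log c := by
    have h2 : 2 * Real.log (N + 1) + 2 * Real.log c = Real.log (((N + 1) * c) ^ 2) := by
      rw [Real.log_pow, Real.log_mul (by positivity) (by positivity)]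
      push_cast
      ring
    rw [h2]
    refine Real.log_le_log (by positivity) ?_
    push_cast
    have : (0 : ℝ) ≤ N * c := by positivity
    nlinarith
  calc N * (((N * c : ℕ) : ℝ) * Real.log (((N * c : ℕ) : ℝ) ^ 2 + 1) + 1)
      ≤ N * (((N * c : ℕ) : ℝ) * (2 * Real.log (N + 1) + 2 * Real.log c) + c) := by gcongr
    _ = ((N * N * (2 * Real.log (N + 1)) + N) * (√(c : ℝ))⁻¹ +
          2 * N * N * (Real.log c / √(c : ℝ))) * (c * √c) := by
        push_cast
        field_simp
        ring
    _ ≤ K * (c * √c) := by gcongr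

theorem tendsto_boxLog_div {γ : ℝ} (hγ : 0 < γ)
    (hle : ∀ h w : ℕ, 0 < h → 0 < w → boxLog h w ≤ γ * (w * √h))
    (hge : ∀ ε > 0, ε < 1 → ∃ B > 0, ∀ h w : ℕ, B ≤ √h → B * √h ≤ w →
      (1 - ε) * (γ * (w * √h)) ≤ boxLog h w)
    {h w : ℕ → ℕ} (hh : ∀ n, 0 < h n) (hw : ∀ n, 0 < w n)
    (hh' : Tendsto (fun n => (1 : ℝ) / √(h n)) atTop (nhds 0))
    (hw' : Tendsto (fun n => √(h n) / (w n : ℝ)) atTop (nhds 0)) :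
    Tendsto (fun n => boxLog (h n) (w n) / (γ * w n * √(h n))) atTop (nhds 1) := by
  rw [tendsto_order]
  constructor
  · intro a ha
    obtain ⟨ε, hε0, hε1, hεa⟩ : ∃ ε > 0, ε < 1 ∧ a < 1 - ε :=
      ⟨min ((1 - a) / 2) (1 / 2), by positivity, by simp; norm_num,
        by linarith [min_le_left ((1 - a) / 2) (1 / 2)]⟩
    obtain ⟨B, hB0, hB⟩ := hge ε hε0 hε1
    filter_upwards [hh'.eventually (ge_mem_nhds (inv_pos.2 hB0)),
      hw'.eventually (ge_mem_nhds (inv_pos.2 hB0))] with n h1 h2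
    have hs : 0 < √(h n : ℝ) := Real.sqrt_pos.2 (by exact_mod_cast hh n)
    have hwn : (0 : ℝ) < w n := by exact_mod_cast hw n
    rw [one_div, inv_le_inv₀ hs hB0] at h1
    rw [div_le_iff₀ hwn, inv_mul_eq_div, le_div_iff₀' hB0] at h2
    rw [lt_div_iff₀ (by positivity), mul_assoc]
    refine lt_of_lt_of_le ?_ (hB _ _ h1 h2)
    gcongr
  · intro a ha
    refine Eventually.of_forall fun n => lt_of_le_of_lt ?_ ha
    have hs : 0 < √(h n : ℝ) := Real.sqrt_pos.2 (by exact_mod_cast hh n)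
    have hwn : (0 : ℝ) < w n := by exact_mod_cast hw n
    rw [div_le_one (by positivity), mul_assoc]
    exact hle _ _ (hh n) (hw n)

theorem eventually_succ_mul_sqrt_le {δ : ℝ} (hδ : 0 < δ) :
    ∀ᶠ b : ℕ in atTop, ((b + 1 : ℕ) : ℝ) * √((b + 1 : ℕ) : ℝ) ≤ (1 + δ) * (b * √b) := by
  have h1 : Tendsto (fun b : ℕ => ((b + 1 : ℕ) : ℝ) / b) atTop (nhds 1) := by
    simpa using (tendsto_natCast_div_add_atTop (1 : ℝ)).inv₀ one_ne_zero
  have h2 := h1.mul ((Real.continuous_sqrt.tendsto 1).comp h1)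
  rw [Real.sqrt_one, mul_one] at h2
  filter_upwards [h2.eventually (ge_mem_nhds (show (1 : ℝ) < 1 + δ by linarith)),
    eventually_ge_atTop 1] with b hb hb1
  have hb0 : (0 : ℝ) < b := by exact_mod_cast hb1
  rw [Function.comp_apply, Real.sqrt_div (by positivity), div_mul_div_comm,
    div_le_iff₀ (by positivity)] at hb
  exact hb

theorem le_stairLog {γ : ℝ} (hγ : 0 < γ)
    (hge : ∀ ε > 0, ε < 1 → ∃ B > 0, ∀ h w : ℕ, B ≤ √h → B * √h ≤ w →
      (1 - ε) * (γ * (w * √h)) ≤ boxLog h w) {ε : ℝ} (hε0 : 0 < ε) (hε1 : ε < 1) :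
    ∀ᶠ n : ℕ in atTop, (1 - ε) * (2 / 3 * γ * (n * √n)) ≤ stairLog n := by
  set δ := ε / 3 with hδ
  have hδ0 : 0 < δ := by positivity
  obtain ⟨B, hB0, hB⟩ := hge δ hδ0 (by linarith)
  obtain ⟨N, hN⟩ := exists_nat_gt (3 / (2 * δ))
  rw [div_lt_iff₀ (by positivity)] at hN
  have hN0 : 0 < N := Nat.pos_of_ne_zero (by rintro rfl; norm_num at hN)
  have hsum : (1 - δ) * (2 / 3 * (N * √N)) ≤ ∑ r ∈ Finset.range N, √(r : ℝ) := by
    have h1 := two_thirds_le_sum_sqrt N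
    rw [sum_range_sqrt_succ] at h1
    have h2 : √(N : ℝ) ≤ δ * (2 / 3 * N) * √N := by
      refine le_mul_of_one_le_left (by positivity) (by linarith)
    linarith
  have hblock : ∀ᶠ b : ℕ in atTop,
      (1 - ε) * (2 / 3 * γ * (((N * (b + 1) : ℕ) : ℝ) * √((N * (b + 1) : ℕ) : ℝ))) ≤
        stairLog (N * b) := by
    have hs : Tendsto (fun c : ℕ => √(c : ℝ)) atTop atTop :=
      Real.tendsto_sqrt_atTop.comp tendsto_natCast_atTop_atTop
    filter_upwards [eventually_succ_mul_sqrt_le hδ0,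
      hs.eventually_ge_atTop (B * √N)] with b hb hbB
    have hN1 : 1 ≤ √(N : ℝ) := Real.one_le_sqrt.2 (by exact_mod_cast hN0)
    have hbox : ∀ r ∈ Finset.range N,
        (1 - δ) * γ * (b * √b) * √r ≤ boxLog (r * b) b := by
      intro r hr
      rcases Nat.eq_zero_or_pos r with rfl | hr0
      · simpa using boxLog_nonneg _ _
      have hr1 : 1 ≤ √(r : ℝ) := Real.one_le_sqrt.2 (by exact_mod_cast hr0)
      have hrN : √(r : ℝ) ≤ √N :=
        Real.sqrt_le_sqrt (by exact_mod_cast (Finset.mem_range.1 hr).le)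
      have hrb : √((r * b : ℕ) : ℝ) = √r * √b := by
        rw [Nat.cast_mul, Real.sqrt_mul (by positivity)]
      have hBb : B ≤ √(b : ℝ) := by nlinarith
      have := hB (r * b) b ?_ ?_
      · rw [hrb] at this
        linarith
      · rw [hrb]
        nlinarith
      · rw [hrb]
        calc B * (√r * √b) ≤ B * (√N * √b) := by gcongr
          _ = (B * √N) * √b := by ring
          _ ≤ √b * √b := by gcongr
          _ = b := Real.mul_self_sqrt (by positivity)
    have h1 := (Finset.sum_le_sum hbox).trans (sum_boxLog_le_stairLog b N)
    rw [← Finset.mul_sum] at h1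
    refine le_trans ?_ h1
    have h2 : 0 ≤ 1 - δ := by linarith
    calc (1 - ε) * (2 / 3 * γ * (((N * (b + 1) : ℕ) : ℝ) * √((N * (b + 1) : ℕ) : ℝ)))
        = (1 - ε) * (2 / 3 * γ * (N * √N)) *
            (((b + 1 : ℕ) : ℝ) * √((b + 1 : ℕ) : ℝ)) := by
          rw [Nat.cast_mul N, Real.sqrt_mul (by positivity)]
          ring
      _ ≤ (1 - ε) * (2 / 3 * γ * (N * √N)) * ((1 + δ) * (b * √b)) := by
          have : 0 ≤ 1 - ε := by linarith
          gcongr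
      _ = (1 - ε) * (1 + δ) * (2 / 3 * γ * (N * √N) * (b * √b)) := by ring
      _ ≤ (1 - δ) * (1 - δ) * (2 / 3 * γ * (N * √N) * (b * √b)) := by
          refine mul_le_mul_of_nonneg_right ?_ (by positivity)
          nlinarith
      _ = (1 - δ) * γ * (b * √b) * ((1 - δ) * (2 / 3 * (N * √N))) := by ring
      _ ≤ _ := by gcongr
  filter_upwards [(Nat.tendsto_div_const_atTop hN0.ne').eventually hblock] with n hn
  refine le_trans ?_ (hn.trans (stairLog_mono (Nat.mul_div_le n N)))
  have h1 : n ≤ N * (n / N + 1) := (Nat.lt_mul_div_succ n hN0).le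
  have : 0 ≤ 1 - ε := by linarith
  gcongr

theorem stairLog_le {γ : ℝ} (hγ : 0 < γ)
    (hle : ∀ h w : ℕ, 0 < h → 0 < w → boxLog h w ≤ γ * (w * √h)) {ε : ℝ} (hε0 : 0 < ε)
    (hε1 : ε < 1) :
    ∀ᶠ n : ℕ in atTop, stairLog n ≤ (1 + ε) * (2 / 3 * γ * (n * √n)) := by
  set δ := ε / 5 with hδ
  have hδ0 : 0 < δ := by positivity
  obtain ⟨N, hN⟩ := exists_nat_gt (3 / (2 * δ))
  rw [div_lt_iff₀ (by positivity)] at hN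
  have hN0 : 0 < N := Nat.pos_of_ne_zero (by rintro rfl; norm_num at hN)
  have hsum : ∑ r ∈ Finset.range N, √((r + 1 : ℕ) : ℝ) ≤ (1 + δ) * (2 / 3 * (N * √N)) := by
    rw [sum_range_sqrt_succ]
    have h1 := sum_sqrt_le_two_thirds N
    have h2 : √(N : ℝ) ≤ δ * (2 / 3 * N) * √N := by
      refine le_mul_of_one_le_left (by positivity) (by linarith)
    linarith
  have hblock : ∀ᶠ b : ℕ in atTop,
      stairLog (N * (b + 1)) ≤
        (1 + ε) * (2 / 3 * γ * (((N * b : ℕ) : ℝ) * √((N * b : ℕ) : ℝ))) := by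
    filter_upwards [eventually_succ_mul_sqrt_le hδ0, (tendsto_add_atTop_nat 1).eventually
      (eventually_log_error_le N (K := δ * (2 / 3 * γ * (N * √N))) (by positivity))] with b hb herr
    set c := b + 1 with hc
    have hc0 : 0 < c := Nat.succ_pos b
    have hbox : ∀ r ∈ Finset.range N,
        boxLog ((r + 1) * c) c ≤ γ * (c * √c) * √((r + 1 : ℕ) : ℝ) := by
      intro r _
      refine (hle _ _ (by positivity) hc0).trans (le_of_eq ?_)
      rw [Nat.cast_mul (r + 1), Real.sqrt_mul (by positivity)]
      ring
    have h1 := Finset.sum_le_sum hbox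
    rw [← Finset.mul_sum] at h1
    calc stairLog (N * c) ≤ _ := stairLog_le_sum_boxLog hc0 le_rfl
      _ ≤ γ * (c * √c) * ((1 + δ) * (2 / 3 * (N * √N))) +
          δ * (2 / 3 * γ * (N * √N)) * (c * √c) := by
          refine add_le_add (h1.trans ?_) herr
          gcongr
      _ = (1 + 2 * δ) * (2 / 3 * γ * (N * √N)) * (c * √c) := by ring
      _ ≤ (1 + 2 * δ) * (2 / 3 * γ * (N * √N)) * ((1 + δ) * (b * √b)) := by gcongr
      _ = (1 + 2 * δ) * (1 + δ) * (2 / 3 * γ * (N * √N) * (b * √b)) := by ring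
      _ ≤ (1 + ε) * (2 / 3 * γ * (N * √N) * (b * √b)) := by
          refine mul_le_mul_of_nonneg_right ?_ (by positivity)
          nlinarith
      _ = _ := by
          rw [Nat.cast_mul N, Real.sqrt_mul (by positivity)]
          ring
  filter_upwards [(Nat.tendsto_div_const_atTop hN0.ne').eventually hblock] with n hn
  refine (stairLog_mono (Nat.lt_mul_div_succ n hN0).le).trans (hn.trans ?_)
  have h1 : N * (n / N) ≤ n := Nat.mul_div_le n N
  gcongr

theorem tendsto_stairLog_div {γ : ℝ} (hγ : 0 < γ)
    (hle : ∀ h w : ℕ, 0 < h → 0 < w → boxLog h w ≤ γ * (w * √h))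
    (hge : ∀ ε > 0, ε < 1 → ∃ B > 0, ∀ h w : ℕ, B ≤ √h → B * √h ≤ w →
      (1 - ε) * (γ * (w * √h)) ≤ boxLog h w) :
    Tendsto (fun n : ℕ => stairLog n / (2 / 3 * γ * n * √n)) atTop (nhds 1) := by
  rw [tendsto_order]
  constructor
  · intro a ha
    obtain ⟨ε, hε0, hε1, hεa⟩ : ∃ ε > 0, ε < 1 ∧ a < 1 - ε :=
      ⟨min ((1 - a) / 2) (1 / 2), by positivity, by simp; norm_num,
        by linarith [min_le_left ((1 - a) / 2) (1 / 2)]⟩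
    filter_upwards [le_stairLog hγ hge hε0 hε1, eventually_gt_atTop 0] with n hn hn0
    have hn0' : (0 : ℝ) < n := by exact_mod_cast hn0
    rw [lt_div_iff₀ (by positivity), mul_assoc (2 / 3 * γ)]
    refine lt_of_lt_of_le ?_ hn
    gcongr
  · intro a ha
    obtain ⟨ε, hε0, hε1, hεa⟩ : ∃ ε > 0, ε < 1 ∧ 1 + ε < a :=
      ⟨min ((a - 1) / 2) (1 / 2), by positivity, by simp; norm_num,
        by linarith [min_le_left ((a - 1) / 2) (1 / 2)]⟩
    filter_upwards [stairLog_le hγ hle hε0 hε1, eventually_gt_atTop 0] with n hn hn0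
    have hn0' : (0 : ℝ) < n := by exact_mod_cast hn0
    rw [div_lt_iff₀ (by positivity), mul_assoc (2 / 3 * γ)]
    refine lt_of_le_of_lt hn ?_
    gcongr

end Packings

/-- There is a universal constant `γ₊ > 0` such that (a) whenever `√h ≻ 1` and `w ≻ √h`,
`L[h,w] ∼ γ₊·w·√h`; and (b) `L(1ⁿ) ∼ (2/3)·γ₊·n·√n`. -/
theorem L_ones_asymp :
    ∃ γ : ℝ, 0 < γ ∧
      (∀ h w : ℕ → ℕ,
        (∀ n, 0 < h n) → (∀ n, 0 < w n) →
        Tendsto (fun n => (1 : ℝ) / Real.sqrt (h n : ℝ)) atTop (nhds 0) →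
        Tendsto (fun n => Real.sqrt (h n : ℝ) / (w n : ℝ)) atTop (nhds 0) →
        Tendsto (fun n =>
            Lbox (h n) (w n) / (γ * (w n : ℝ) * Real.sqrt (h n : ℝ)))
          atTop (nhds 1)) ∧
      Tendsto (fun n : ℕ =>
          LTes (fun _ : Fin n => (1 : ℤ)) /
            ((2 / 3) * γ * (n : ℝ) * Real.sqrt (n : ℝ)))
        atTop (nhds 1) := by
  obtain ⟨γ, hγ, hle, hge⟩ := exists_boxLog_asymp
  refine ⟨γ, hγ, fun h w hh hw hh' hw' => ?_, ?_⟩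
  · have hbox : ∀ n, Lbox (h n) (w n) = boxLog (h n) (w n) := fun n => by
      rw [Lbox, boxLog, ← KPF_eq_arcCount]
    simpa only [hbox] using tendsto_boxLog_div hγ hle hge hh hw hh' hw'
  · have hstair : ∀ n : ℕ, LTes (fun _ : Fin n => (1 : ℤ)) = stairLog n := fun n => by
      rw [LTes, stairLog, ← ncard_isTesler_ones_eq]
    simpa only [hstair] using tendsto_stairLog_div hγ hle hge
end

section
/- As n → ∞, L(1, 2, …, n) ∼ n²·ln 2; that is, ln|T(1, 2, …, n)| / (n²·ln 2) → 1. Moreover L(1, 2, …, n) = Σ_{i=1}^n ln C_i, where C_i = binom(2i, i)/(i+1) is the i-th Catalan number. -/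
open Filter

namespace Tesler

open Finset

variable {n : ℕ}

/-- The `k`-th hook sum of `A`. -/
def hook (A : Fin n → Fin n → ℕ) (k : Fin n) : ℤ :=
  (∑ i : Fin n, if k ≤ i then (A k i : ℤ) else 0) - (∑ i : Fin n, if i < k then (A i k : ℤ) else 0)

lemma isTesler_iff (h : Fin n → ℤ) (A : Fin n → Fin n → ℕ) :
    IsTesler h A ↔ (∀ i j, j < i → A i j = 0) ∧ ∀ k, hook A k = h k := Iff.rfl

lemma sum_mul_hook (c : Fin n → ℤ) (A : Fin n → Fin n → ℕ) :
    ∑ k, c k * hook A k =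
      ∑ i, ∑ j, (if i ≤ j then c i - (if i < j then c j else 0) else 0) * (A i j : ℤ) := by
  simp only [hook, mul_sub, sum_sub_distrib, mul_sum]
  rw [sum_comm (f := fun k i => c k * if i < k then (A i k : ℤ) else 0), ← sum_sub_distrib]
  refine sum_congr rfl fun i _ => ?_
  rw [← sum_sub_distrib]
  refine sum_congr rfl fun j _ => ?_
  rcases lt_trichotomy i j with h | h | h
  · simp [h, h.le]; ring
  · simp [h]
  · simp [h.not_ge, h.not_gt]

lemma entry_le {h : Fin n → ℤ} {A : Fin n → Fin n → ℕ} (hA : IsTesler h A) (i j : Fin n) :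
    (A i j : ℤ) ≤ ∑ k : Fin n, ((n : ℤ) - k) * h k := by
  have key := sum_mul_hook (fun k : Fin n => (n : ℤ) - k) A
  simp only [((isTesler_iff h A).1 hA).2] at key
  rw [key]
  have hle : ∀ a b, (A a b : ℤ) ≤
      (if a ≤ b then ((n : ℤ) - a) - (if a < b then (n : ℤ) - b else 0) else 0) * (A a b : ℤ) := by
    intro a b
    rcases lt_trichotomy a b with hab | hab | hab
    · rw [if_pos hab.le, if_pos hab]
      have : (a : ℤ) + 1 ≤ b := by exact_mod_cast hab
      nlinarith [(A a b).cast_nonneg (α := ℤ)]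
    · subst hab
      have : (a : ℤ) + 1 ≤ n := by exact_mod_cast a.2
      simp only [le_refl, if_true, lt_irrefl, if_false]
      nlinarith [(A a a).cast_nonneg (α := ℤ)]
    · simp [hA.1 a b hab]
  have hnn : ∀ a b : Fin n, (0 : ℤ) ≤
      (if a ≤ b then ((n : ℤ) - a) - (if a < b then (n : ℤ) - b else 0) else 0) * (A a b : ℤ) :=
    fun a b => le_trans (by positivity) (hle a b)
  refine (hle i j).trans ?_
  refine (single_le_sum (f := fun b => (if i ≤ b then ((n : ℤ) - i) -
    (if i < b then (n : ℤ) - b else 0) else 0) * (A i b : ℤ)) (fun b _ => hnn i b)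
    (mem_univ j)).trans ?_
  exact single_le_sum (f := fun a : Fin n => ∑ b : Fin n, (if a ≤ b then ((n : ℤ) - a) -
    (if a < b then (n : ℤ) - b else 0) else 0) * (A a b : ℤ))
    (fun a _ => sum_nonneg fun b _ => hnn a b) (mem_univ i)

lemma finite_isTesler (h : Fin n → ℤ) : {A : Fin n → Fin n → ℕ | IsTesler h A}.Finite := by
  refine (Set.finite_Iic
    (fun _ _ : Fin n => (∑ k : Fin n, ((n : ℤ) - k) * h k).toNat)).subset fun A hA i j => ?_
  exact Int.le_toNat ((Int.natCast_nonneg _).trans (entry_le hA i j)) |>.2 (entry_le hA i j)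

/-- The finite set of Tesler matrices with hook sum vector `h`. -/
noncomputable def tes (h : Fin n → ℤ) : Finset (Fin n → Fin n → ℕ) := (finite_isTesler h).toFinset

lemma mem_tes {h : Fin n → ℤ} {A : Fin n → Fin n → ℕ} : A ∈ tes h ↔ IsTesler h A := by
  simp [tes]

/-- The total of the `(i, j)` entries over all Tesler matrices with hook sum vector `h`. -/
noncomputable def weight (i j : Fin n) (h : Fin n → ℤ) : ℤ := ∑ A ∈ tes h, (A i j : ℤ)

/-- Add one to the `(i, j)` entry. -/
def bump (i j : Fin n) (A : Fin n → Fin n → ℕ) (a b : Fin n) : ℕ :=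
  A a b + if a = i ∧ b = j then 1 else 0

lemma hook_bump {i j : Fin n} (hij : i ≤ j) (A : Fin n → Fin n → ℕ) (k : Fin n) :
    hook (bump i j A) k =
      hook A k + (if k = i then 1 else 0) - (if i < j ∧ k = j then 1 else 0) := by
  have h1 : (∑ b : Fin n, if k ≤ b then ((bump i j A k b : ℕ) : ℤ) else 0) =
      (∑ b : Fin n, if k ≤ b then (A k b : ℤ) else 0) + if k = i then 1 else 0 := by
    have : (if k = i then (1 : ℤ) else 0) =
        ∑ b, if b = j then (if k = i then (1 : ℤ) else 0) else 0 := by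
      simp
    rw [this, ← sum_add_distrib]
    refine sum_congr rfl fun b _ => ?_
    unfold bump
    split_ifs <;> simp_all
  have h2 : (∑ b : Fin n, if b < k then ((bump i j A b k : ℕ) : ℤ) else 0) =
      (∑ b : Fin n, if b < k then (A b k : ℤ) else 0) + if i < j ∧ k = j then 1 else 0 := by
    have : (if i < j ∧ k = j then (1 : ℤ) else 0) =
        ∑ b, if b = i then (if i < j ∧ k = j then (1 : ℤ) else 0) else 0 := by
      simp
    rw [this, ← sum_add_distrib]
    refine sum_congr rfl fun b _ => ?_
    unfold bump
    split_ifs <;> simp_all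
  simp only [hook]
  rw [h1, h2]
  ring

/-- Removing one unit from a nonzero `(i, j)` entry. -/
lemma weight_eq {i j : Fin n} (hij : i ≤ j) {h h' : Fin n → ℤ}
    (hh : ∀ k, h k = h' k + (if k = i then 1 else 0) - (if i < j ∧ k = j then 1 else 0)) :
    weight i j h = weight i j h' + #(tes h') := by
  have hsum : weight i j h' + #(tes h') = ∑ A ∈ tes h', ((bump i j A i j : ℕ) : ℤ) := by
    simp [weight, bump, sum_add_distrib]
  have hinj : Set.InjOn (bump i j) (tes h' : Set (Fin n → Fin n → ℕ)) := by
    intro A _ B _ hAB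
    funext a b
    have := congrFun (congrFun hAB a) b
    simpa [bump] using this
  rw [hsum, ← sum_image (f := fun A : Fin n → Fin n → ℕ => (A i j : ℤ)) hinj, weight]
  symm
  refine sum_subset ?_ ?_
  · intro B hB
    obtain ⟨A, hA, rfl⟩ := mem_image.1 hB
    rw [mem_tes, isTesler_iff] at hA ⊢
    refine ⟨fun a b hab => ?_, fun k => ?_⟩
    · have : ¬ (a = i ∧ b = j) := by rintro ⟨rfl, rfl⟩; exact absurd hab hij.not_gt
      simp [bump, this, hA.1 a b hab]
    · rw [hook_bump hij, hA.2, hh]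
  · intro B hB hBn
    by_contra hne
    apply hBn
    have hne : B i j ≠ 0 := by exact_mod_cast hne
    have hbump : bump i j (fun a b => B a b - if a = i ∧ b = j then 1 else 0) = B := by
      funext a b
      by_cases hab : a = i ∧ b = j
      · obtain ⟨rfl, rfl⟩ := hab
        simp [bump, Nat.sub_add_cancel (Nat.pos_of_ne_zero hne)]
      · simp [bump, hab]
    refine mem_image.2 ⟨_, ?_, hbump⟩
    rw [mem_tes, isTesler_iff] at hB ⊢
    refine ⟨fun a b hab => by simp [hB.1 a b hab], fun k => ?_⟩
    have e1 := hook_bump hij (fun a b => B a b - if a = i ∧ b = j then 1 else 0) k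
    rw [hbump, hB.2, hh] at e1
    linarith

lemma mul_card_tes (h : Fin n → ℤ) (k : Fin n) :
    h k * #(tes h) = weight k k h + (∑ j, if k < j then weight k j h else 0)
      - ∑ i, if i < k then weight i k h else 0 := by
  have h1 : h k * #(tes h) = ∑ A ∈ tes h, hook A k := by
    rw [sum_congr rfl fun A hA => ((isTesler_iff h A).1 (mem_tes.1 hA)).2 k]
    simp [mul_comm]
  have h2 : weight k k h + (∑ j, if k < j then weight k j h else 0) =
      ∑ j, if k ≤ j then weight k j h else 0 := by
    have : weight k k h = ∑ j, if j = k then weight k j h else 0 := by simp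
    rw [this, ← sum_add_distrib]
    refine sum_congr rfl fun j _ => ?_
    rcases lt_trichotomy k j with hk | hk | hk
    · simp [hk, hk.le, hk.ne']
    · simp [hk]
    · simp [hk.not_gt, hk.not_ge, hk.ne]
  rw [h1, h2]
  simp only [hook, sum_sub_distrib, weight]
  congr 1 <;>
  · rw [sum_comm]
    refine sum_congr rfl fun j _ => ?_
    split_ifs <;> simp

/-- The vector `(1, 2, …, n)` lowered by one at the positions in `S`. -/
def lowered (S : Finset (Fin n)) (k : Fin n) : ℤ := (k : ℕ) + 1 - if k ∈ S then 1 else 0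

/-- The number of Tesler matrices with hook sum vector `lowered S`. -/
noncomputable def count (S : Finset (Fin n)) : ℤ := #(tes (lowered S))

lemma weight_self_erase {i : Fin n} {S : Finset (Fin n)} (hi : i ∈ S) :
    weight i i (lowered (S.erase i)) = weight i i (lowered S) + count S := by
  refine weight_eq le_rfl fun k => ?_
  by_cases hk : k = i
  · subst hk; simp [lowered, hi]
  · simp [lowered, hk]

lemma weight_swap {i j : Fin n} (hij : i < j) {S : Finset (Fin n)} (hi : i ∈ S) (hj : j ∉ S) :
    weight i j (lowered (S.map (Equiv.swap i j).toEmbedding)) =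
      weight i j (lowered S) + count S := by
  refine weight_eq hij.le fun k => ?_
  by_cases hk : k = i
  · subst hk; simp [lowered, hi, hj, hij.ne]
  by_cases hk' : k = j
  · subst hk'; simp [lowered, hi, hj, hij, hij.ne']
  · simp [lowered, hk, hk', Equiv.swap_apply_of_ne_of_ne hk hk']

lemma sum_mem_sub_mem_weight {i j : Fin n} (hij : i < j) (m : ℕ) :
    ∑ S ∈ powersetCard m univ, ((if j ∈ S then (1 : ℤ) else 0) - (if i ∈ S then 1 else 0)) *
        weight i j (lowered S) =
      ∑ S ∈ powersetCard m univ, (if i ∈ S ∧ j ∉ S then 1 else 0) * count S := by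
  have hsw : ∑ S ∈ powersetCard m univ, (if j ∈ S then (1 : ℤ) else 0) * weight i j (lowered S) =
      ∑ S ∈ powersetCard m univ, (if i ∈ S then (1 : ℤ) else 0) *
        weight i j (lowered (S.map (Equiv.swap i j).toEmbedding)) := by
    refine sum_nbij' (fun S => S.map (Equiv.swap i j).toEmbedding)
      (fun S => S.map (Equiv.swap i j).toEmbedding) ?_ ?_ ?_ ?_ ?_
    · intro S; simp [mem_powersetCard]
    · intro S; simp [mem_powersetCard]
    · intro S _; ext a; simp only [mem_map_equiv]; simp
    · intro S _; ext a; simp only [mem_map_equiv]; simp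
    · intro S _
      have : (S.map (Equiv.swap i j).toEmbedding).map (Equiv.swap i j).toEmbedding = S := by
        ext a; simp only [mem_map_equiv]; simp
      rw [this]
      simp only [mem_map_equiv, Equiv.symm_swap, Equiv.swap_apply_left]
  simp only [sub_mul, sum_sub_distrib]
  rw [hsw, ← sum_sub_distrib]
  refine sum_congr rfl fun S _ => ?_
  by_cases hi : i ∈ S
  · by_cases hj : j ∈ S
    · have : S.map (Equiv.swap i j).toEmbedding = S := by
        ext a
        rw [mem_map_equiv, Equiv.symm_swap, Equiv.swap_apply_def]
        split_ifs with h1 h2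
        · simp [h1, hi, hj]
        · simp [h2, hi, hj]
        · rfl
      simp [this, hj]
    · rw [weight_swap hij hi hj]; simp [hi, hj]
  · simp [hi]

lemma sum_notMem_powersetCard (i : Fin n) (k : ℕ) (f : Finset (Fin n) → ℤ) :
    ∑ T ∈ powersetCard k univ, (if i ∈ T then 0 else f T) =
      ∑ S ∈ powersetCard (k + 1) univ, (if i ∈ S then f (S.erase i) else 0) := by
  have h1 : ∀ T : Finset (Fin n), (if i ∈ T then 0 else f T) = if i ∉ T then f T else 0 := by
    intro T; by_cases hi : i ∈ T <;> simp [hi]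
  simp only [h1]
  rw [← sum_filter, ← sum_filter]
  refine sum_nbij' (fun T => insert i T) (fun S => S.erase i) ?_ ?_ ?_ ?_ ?_
  · intro T hT
    simp only [mem_filter, mem_powersetCard_univ] at hT ⊢
    simp [hT.1, hT.2]
  · intro S hS
    simp only [mem_filter, mem_powersetCard_univ] at hS ⊢
    simp [hS.1, hS.2]
  · intro T hT
    simp only [mem_filter] at hT
    simp [hT.2]
  · intro S hS
    simp only [mem_filter] at hS
    simp [hS.2]
  · intro T hT
    simp only [mem_filter] at hT
    simp [hT.2]

/-- The number of pairs `i < j` with `i ∈ S` and `j ∉ S`. -/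
def inv (S : Finset (Fin n)) : ℤ :=
  ∑ i, ∑ j, if i < j then (if i ∈ S ∧ j ∉ S then 1 else 0) else 0

lemma two_mul_sum_add_inv (S : Finset (Fin n)) :
    2 * ((∑ i ∈ S, ((i : ℕ) : ℤ)) + inv S) = #S * (2 * n - #S - 1) := by
  have h1 : inv S + (∑ i, ∑ j, if i < j then (if i ∈ S ∧ j ∈ S then (1 : ℤ) else 0) else 0) =
      ∑ i ∈ S, ((n : ℤ) - 1 - (i : ℕ)) := by
    rw [inv, ← sum_add_distrib, ← sum_filter_add_sum_filter_not univ (· ∈ S)]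
    have hz : ∀ x ∈ univ.filter (· ∉ S),
        ((∑ j, if x < j then (if x ∈ S ∧ j ∉ S then (1 : ℤ) else 0) else 0) +
        ∑ j, if x < j then (if x ∈ S ∧ j ∈ S then (1 : ℤ) else 0) else 0) = 0 := by
      intro x hx
      simp [(mem_filter.1 hx).2]
    rw [sum_eq_zero hz, add_zero]
    refine sum_congr (by simp) fun i hi => ?_
    have hi : i ∈ S := by simpa using hi
    rw [← sum_add_distrib]
    have : ∀ j, ((if i < j then (if i ∈ S ∧ j ∉ S then (1 : ℤ) else 0) else 0) +
        if i < j then (if i ∈ S ∧ j ∈ S then (1 : ℤ) else 0) else 0) = if i < j then 1 else 0 := by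
      intro j
      by_cases hj : j ∈ S <;> simp [hi, hj]
    simp only [this]
    have hc : univ.filter (fun j => i < j) = Ioi i := by ext; simp
    rw [sum_boole, hc, Fin.card_Ioi]
    have := i.2
    omega
  have h2 : 2 * (∑ i, ∑ j, if i < j then (if i ∈ S ∧ j ∈ S then (1 : ℤ) else 0) else 0) + #S =
      #S * #S := by
    have hs : (∑ i : Fin n, ∑ j, if i < j then (if i ∈ S ∧ j ∈ S then (1 : ℤ) else 0) else 0) =
        ∑ i : Fin n, ∑ j, if j < i then (if i ∈ S ∧ j ∈ S then (1 : ℤ) else 0) else 0 := by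
      rw [sum_comm]
      simp only [and_comm]
    have hd : (#S : ℤ) =
        ∑ i : Fin n, ∑ j, if i = j then (if i ∈ S ∧ j ∈ S then (1 : ℤ) else 0) else 0 := by
      simp
    have hp : (#S : ℤ) * #S = ∑ i : Fin n, ∑ j, if i ∈ S ∧ j ∈ S then (1 : ℤ) else 0 := by
      have : (#S : ℤ) = ∑ i : Fin n, if i ∈ S then 1 else 0 := by simp
      rw [this, sum_mul_sum]
      refine sum_congr rfl fun i _ => sum_congr rfl fun j _ => ?_
      by_cases hi : i ∈ S <;> by_cases hj : j ∈ S <;> simp [hi, hj]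
    rw [hp, two_mul]
    nth_rewrite 2 [hs]
    rw [hd]
    simp only [← sum_add_distrib]
    refine sum_congr rfl fun i _ => sum_congr rfl fun j _ => ?_
    rcases lt_trichotomy i j with h | h | h
    · simp [h, h.not_gt, h.ne]
    · simp [h]
    · simp [h, h.not_gt, h.ne']
  have h3 : ∑ i ∈ S, ((n : ℤ) - 1 - (i : ℕ)) = #S * ((n : ℤ) - 1) - ∑ i ∈ S, ((i : ℕ) : ℤ) := by
    simp [sum_sub_distrib]; ring
  rw [h3] at h1
  linear_combination 2 * h1 - h2

lemma two_mul_sum_compl_sub_inv (S : Finset (Fin n)) :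
    2 * ((∑ i ∈ Sᶜ, (((i : ℕ) : ℤ) + 1)) - inv S) = ((n : ℤ) - #S) * (n - #S + 1) := by
  have h1 := two_mul_sum_add_inv S
  have h2 : ∑ i ∈ Sᶜ, ((i : ℕ) : ℤ) + ∑ i ∈ S, ((i : ℕ) : ℤ) = ∑ i : Fin n, ((i : ℕ) : ℤ) :=
    sum_compl_add_sum S _
  have h3 : 2 * ∑ i : Fin n, ((i : ℕ) : ℤ) = n * (n - 1) := by
    have := two_mul_sum_add_inv (univ : Finset (Fin n))
    simp [inv] at this
    rw [this]; ring
  have h4 : (#Sᶜ : ℤ) = n - #S := by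
    rw [card_compl, Fintype.card_fin, Nat.cast_sub (by simpa using card_le_univ S)]
  rw [sum_add_distrib, sum_const, nsmul_eq_mul, h4]
  linear_combination 2 * h2 + h3 - h1

/-- The sum of `count S` over all `S` of size `m`. -/
noncomputable def countSum (n m : ℕ) : ℤ := ∑ S ∈ powersetCard m (univ : Finset (Fin n)), count S

lemma sum_hook_split (f : Fin n → Finset (Fin n) → ℤ) (m : ℕ)
    (c : Fin n → Finset (Fin n) → ℤ) (w : Fin n → Fin n → Finset (Fin n) → ℤ)
    (hf : ∀ i S, f i S = w i i S + (∑ j, if i < j then w i j S else 0)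
      - ∑ j, if j < i then w j i S else 0) :
    ∑ S ∈ powersetCard m univ, ∑ i, c i S * f i S =
      ∑ i, ∑ S ∈ powersetCard m univ, c i S * w i i S +
      ∑ i, ∑ j, if i < j then ∑ S ∈ powersetCard m univ, (c i S - c j S) * w i j S else 0 := by
  have h1 : ∀ S : Finset (Fin n), ∑ i, c i S * f i S = ∑ i, c i S * w i i S +
      ∑ i, ∑ j, if i < j then (c i S - c j S) * w i j S else 0 := by
    intro S
    simp only [hf, mul_sub, mul_add, sum_sub_distrib, sum_add_distrib, mul_sum]
    rw [sum_comm (f := fun i j => c i S * if j < i then w j i S else 0), add_sub_assoc,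
      ← sum_sub_distrib]
    congr 1
    refine sum_congr rfl fun i _ => ?_
    rw [← sum_sub_distrib]
    refine sum_congr rfl fun j _ => ?_
    split_ifs <;> ring
  simp only [h1, sum_add_distrib]
  congr 1
  · exact sum_comm
  · rw [sum_comm]
    refine sum_congr rfl fun i _ => ?_
    rw [sum_comm]
    refine sum_congr rfl fun j _ => ?_
    split_ifs <;> simp

lemma sum_pairs_count (m : ℕ) :
    (∑ i : Fin n, ∑ j, if i < j then
      ∑ S ∈ powersetCard m univ, (if i ∈ S ∧ j ∉ S then 1 else 0) * count S else 0) =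
    ∑ S ∈ powersetCard m (univ : Finset (Fin n)), inv S * count S := by
  simp only [inv, sum_mul]
  symm
  rw [sum_comm]
  refine sum_congr rfl fun i _ => ?_
  rw [sum_comm]
  refine sum_congr rfl fun j _ => ?_
  split_ifs <;> simp

lemma sum_compl_mul_count (m : ℕ) :
    ∑ T ∈ powersetCard m (univ : Finset (Fin n)),
        ∑ i, (if i ∈ T then 0 else 1) * (lowered T i * count T) =
      ∑ i : Fin n, (∑ T ∈ powersetCard m univ,
        (if i ∈ T then 0 else 1) * weight i i (lowered T)) +
      ∑ T ∈ powersetCard m (univ : Finset (Fin n)), inv T * count T := by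
  rw [sum_hook_split (n := n) (fun i S => lowered S i * count S) m
    (fun i S => if i ∈ S then 0 else 1) (fun i j S => weight i j (lowered S))
    (fun i S => mul_card_tes (lowered S) i), ← sum_pairs_count]
  congr 1
  refine sum_congr rfl fun i _ => sum_congr rfl fun j _ => ?_
  split_ifs with hij
  · rw [← sum_mem_sub_mem_weight hij]
    refine sum_congr rfl fun S _ => ?_
    by_cases hi : i ∈ S <;> by_cases hj : j ∈ S <;> simp [hi, hj]
  · rfl

lemma sum_mem_mul_count (m : ℕ) :
    ∑ S ∈ powersetCard m (univ : Finset (Fin n)),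
        ∑ i, (if i ∈ S then 1 else 0) * (lowered S i * count S) =
      ∑ i : Fin n, (∑ S ∈ powersetCard m univ,
        (if i ∈ S then 1 else 0) * weight i i (lowered S)) -
      ∑ S ∈ powersetCard m (univ : Finset (Fin n)), inv S * count S := by
  rw [sum_hook_split (n := n) (fun i S => lowered S i * count S) m
    (fun i S => if i ∈ S then 1 else 0) (fun i j S => weight i j (lowered S))
    (fun i S => mul_card_tes (lowered S) i), ← sum_pairs_count, sub_eq_add_neg,
    ← sum_neg_distrib]
  congr 1
  refine sum_congr rfl fun i _ => ?_
  rw [← sum_neg_distrib]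
  refine sum_congr rfl fun j _ => ?_
  split_ifs with hij
  · rw [← sum_mem_sub_mem_weight hij, ← sum_neg_distrib]
    refine sum_congr rfl fun S _ => ?_
    ring
  · simp

lemma sum_weight_self (m : ℕ) :
    ∑ i : Fin n, (∑ T ∈ powersetCard m univ, (if i ∈ T then 0 else 1) * weight i i (lowered T)) =
      ∑ i : Fin n, (∑ S ∈ powersetCard (m + 1) univ,
        (if i ∈ S then 1 else 0) * weight i i (lowered S)) + (m + 1) * countSum n (m + 1) := by
  have hc : ((m : ℤ) + 1) * countSum n (m + 1) =
      ∑ i : Fin n, ∑ S ∈ powersetCard (m + 1) univ, (if i ∈ S then 1 else 0) * count S := by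
    rw [sum_comm, countSum, mul_sum]
    refine sum_congr rfl fun S hS => ?_
    rw [← sum_mul]
    simp [(mem_powersetCard.1 hS).2]
  rw [hc, ← sum_add_distrib]
  refine sum_congr rfl fun i _ => ?_
  have := sum_notMem_powersetCard i m (fun S => weight i i (lowered S))
  simp only [ite_mul, zero_mul, one_mul]
  rw [this, ← sum_add_distrib]
  refine sum_congr rfl fun S _ => ?_
  split_ifs with hi
  · exact weight_self_erase hi
  · simp

lemma countSum_recurrence (n k : ℕ) :
    ((n : ℤ) - k) * (n - k + 1) * countSum n k = (k + 1) * (2 * n - k) * countSum n (k + 1) := by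
  have hT := sum_compl_mul_count (n := n) k
  have hS := sum_mem_mul_count (n := n) (k + 1)
  have hD := sum_weight_self (n := n) k
  have h1 : ((n : ℤ) - k) * (n - k + 1) * countSum n k =
      2 * ∑ T ∈ powersetCard k (univ : Finset (Fin n)),
        ∑ i, (if i ∈ T then 0 else 1) * (lowered T i * count T) -
      2 * ∑ T ∈ powersetCard k (univ : Finset (Fin n)), inv T * count T := by
    simp only [countSum, mul_sum, ← sum_sub_distrib]
    refine sum_congr rfl fun T hT => ?_
    have hk := (mem_powersetCard.1 hT).2
    have e := two_mul_sum_compl_sub_inv T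
    rw [hk] at e
    have e2 : ∑ i, 2 * ((if i ∈ T then 0 else 1) * (lowered T i * count T)) =
        2 * (∑ i ∈ Tᶜ, (((i : ℕ) : ℤ) + 1)) * count T := by
      rw [← sum_filter_add_sum_filter_not univ (· ∈ T)]
      rw [sum_eq_zero (fun x hx => by simp [(mem_filter.1 hx).2]), zero_add, mul_assoc, sum_mul,
        mul_sum]
      refine sum_congr (by ext; simp) fun i hi => ?_
      have hi : i ∉ T := by simpa using hi
      simp [hi, lowered]
    rw [e2, ← e]
    ring
  have h2 : ((k : ℤ) + 1) * (2 * n - k) * countSum n (k + 1) =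
      2 * ∑ S ∈ powersetCard (k + 1) (univ : Finset (Fin n)),
        ∑ i, (if i ∈ S then 1 else 0) * (lowered S i * count S) +
      2 * ∑ S ∈ powersetCard (k + 1) (univ : Finset (Fin n)), inv S * count S +
      2 * ((k + 1) * countSum n (k + 1)) := by
    simp only [countSum, mul_sum, ← sum_add_distrib]
    refine sum_congr rfl fun S hS => ?_
    have hk := (mem_powersetCard.1 hS).2
    have e := two_mul_sum_add_inv S
    rw [hk] at e
    push_cast at e
    have e2 : ∑ i, 2 * ((if i ∈ S then 1 else 0) * (lowered S i * count S)) =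
        2 * (∑ i ∈ S, ((i : ℕ) : ℤ)) * count S := by
      rw [← sum_filter_add_sum_filter_not univ (· ∈ S)]
      rw [sum_eq_zero (s := univ.filter (· ∉ S)) (fun x hx => by simp [(mem_filter.1 hx).2]),
        add_zero, mul_assoc, sum_mul, mul_sum]
      refine sum_congr (by ext; simp) fun i hi => ?_
      have hi : i ∈ S := by simpa using hi
      simp [hi, lowered]
    rw [e2]
    linear_combination (-count S) * e
  rw [h1, h2]
  linear_combination 2 * hT - 2 * hS + 2 * hD

lemma descFactorial_mul_countSum_zero (n k : ℕ) (hk : k ≤ n) :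
    (n.descFactorial k * (n + 1).descFactorial k : ℤ) * countSum n 0 =
      (k.factorial * (2 * n).descFactorial k : ℤ) * countSum n k := by
  induction k with
  | zero => simp
  | succ k ih =>
    have ih := ih (by omega)
    have hr := countSum_recurrence n k
    simp only [Nat.descFactorial_succ, Nat.factorial_succ]
    push_cast [Nat.cast_sub (show k ≤ n by omega), Nat.cast_sub (show k ≤ n + 1 by omega),
      Nat.cast_sub (show k ≤ 2 * n by omega)]
    linear_combination ((n : ℤ) - k) * (n + 1 - k) * ih +
      (k.factorial * (2 * n).descFactorial k : ℤ) * hr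

lemma count_empty_eq (n : ℕ) :
    count (∅ : Finset (Fin n)) = catalan n * count (univ : Finset (Fin n)) := by
  have h := descFactorial_mul_countSum_zero n n le_rfl
  have h0 : countSum n 0 = count (∅ : Finset (Fin n)) := by simp [countSum]
  have hn : countSum n n = count (univ : Finset (Fin n)) := by
    have := powersetCard_self (univ : Finset (Fin n))
    rw [card_univ, Fintype.card_fin] at this
    simp [countSum, this]
  have h1 : (n + 1).descFactorial n = (n + 1).factorial := by
    have := Nat.factorial_mul_descFactorial (show n ≤ n + 1 by omega)
    simpa using this
  have h2 : n.factorial * (2 * n).descFactorial n = (n + 1) * catalan n * n.factorial ^ 2 := by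
    rw [succ_mul_catalan_eq_centralBinom, Nat.centralBinom,
      Nat.descFactorial_eq_factorial_mul_choose]
    ring
  have h2' : (n.factorial * (2 * n).descFactorial n : ℤ) =
      (n + 1) * catalan n * n.factorial ^ 2 := by exact_mod_cast h2
  rw [h0, hn, h1, Nat.descFactorial_self, h2', Nat.factorial_succ] at h
  push_cast at h
  have hne : ((n : ℤ) + 1) * n.factorial ^ 2 ≠ 0 := by positivity
  refine mul_left_cancel₀ hne ?_
  linear_combination h

lemma isTesler_cons_zero_iff (h : Fin n → ℤ) (A : Fin (n + 1) → Fin (n + 1) → ℕ) :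
    IsTesler (Fin.cons 0 h : Fin (n + 1) → ℤ) A ↔
      (∀ j, A 0 j = 0) ∧ (∀ i : Fin n, A i.succ 0 = 0) ∧
        IsTesler h (fun i j : Fin n => A i.succ j.succ) := by
  have hs : (∀ j, A 0 j = 0) → ∀ k : Fin n,
      hook A k.succ = hook (fun i j : Fin n => A i.succ j.succ) k := by
    intro h0 k
    simp [hook, Fin.sum_univ_succ, h0]
  have hz : hook A 0 = ∑ j, (A 0 j : ℤ) := by simp [hook]
  rw [isTesler_iff, isTesler_iff]
  constructor
  · rintro ⟨h1, h2⟩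
    have h0 : ∀ j, A 0 j = 0 := by
      have := h2 0
      rw [hz, Fin.cons_zero] at this
      intro j
      have := (sum_eq_zero_iff_of_nonneg (fun i _ => by positivity)).1 this j (mem_univ j)
      exact_mod_cast this
    refine ⟨h0, fun i => h1 _ _ (Fin.succ_pos i), fun i j hij => h1 _ _ (by simpa using hij),
      fun k => ?_⟩
    rw [← hs h0, h2, Fin.cons_succ]
  · rintro ⟨h0, h1, h2, h3⟩
    refine ⟨fun i j hij => ?_, fun k => ?_⟩
    · cases i using Fin.cases with
      | zero => exact h0 j
      | succ i =>
        cases j using Fin.cases with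
        | zero => exact h1 i
        | succ j => exact h2 i j (by simpa using hij)
    · cases k using Fin.cases with
      | zero => simp [hz, h0]
      | succ k => rw [hs h0, h3, Fin.cons_succ]

lemma card_tes_cons_zero (h : Fin n → ℤ) :
    #(tes (Fin.cons 0 h : Fin (n + 1) → ℤ)) = #(tes h) := by
  refine card_nbij' (fun A i j => A i.succ j.succ)
    (fun B => Fin.cons (fun _ => 0) (fun i => Fin.cons 0 (B i))) ?_ ?_ ?_ ?_
  · intro A hA
    exact mem_tes.2 ((isTesler_cons_zero_iff h A).1 (mem_tes.1 hA)).2.2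
  · intro B hB
    refine mem_tes.2 ((isTesler_cons_zero_iff h _).2 ⟨fun j => rfl, fun i => rfl, ?_⟩)
    simpa using mem_tes.1 hB
  · intro A hA
    have hA := (isTesler_cons_zero_iff h A).1 (mem_tes.1 hA)
    funext i j
    cases i using Fin.cases with
    | zero => simp [hA.1]
    | succ i =>
      cases j using Fin.cases with
      | zero => simp [hA.2.1]
      | succ j => simp
  · intro B _
    funext i j
    simp

lemma count_univ_succ (n : ℕ) :
    count (univ : Finset (Fin (n + 1))) = count (∅ : Finset (Fin n)) := by
  have : lowered (univ : Finset (Fin (n + 1))) = Fin.cons 0 (lowered (∅ : Finset (Fin n))) := by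
    funext k
    cases k using Fin.cases <;> simp [lowered]
  rw [count, this, card_tes_cons_zero, count]

lemma count_empty (n : ℕ) :
    count (∅ : Finset (Fin n)) = ∏ i ∈ Icc 1 n, (catalan i : ℤ) := by
  induction n with
  | zero =>
    have : tes (lowered (∅ : Finset (Fin 0))) = univ := by
      ext A
      simp only [mem_tes, mem_univ, iff_true]
      exact ⟨fun i => i.elim0, fun i => i.elim0⟩
    simp [count, this]
  | succ n ih =>
    rw [count_empty_eq, count_univ_succ, ih, prod_Icc_succ_top (by omega), mul_comm]

lemma catalan_pos (n : ℕ) : 0 < catalan n := by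
  have h := succ_mul_catalan_eq_centralBinom n
  have := Nat.centralBinom_pos n
  by_contra h0
  simp [Nat.eq_zero_of_not_pos h0] at h
  omega

theorem LTes_eq_sum_log_catalan (n : ℕ) :
    LTes (fun k : Fin n => ((k : ℕ) : ℤ) + 1) = ∑ i ∈ Icc 1 n, Real.log (catalan i) := by
  have hl : (fun k : Fin n => ((k : ℕ) : ℤ) + 1) = lowered ∅ := by funext k; simp [lowered]
  have hc : Set.ncard {A : Fin n → Fin n → ℕ | IsTesler (lowered ∅) A} =
      ∏ i ∈ Icc 1 n, catalan i := by
    rw [Set.ncard_eq_toFinset_card _ (finite_isTesler _)]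
    have := count_empty n
    rw [count] at this
    exact_mod_cast this
  rw [LTes, hl, hc, Nat.cast_prod, Real.log_prod]
  intro i _
  exact_mod_cast (catalan_pos i).ne'

lemma log_catalan_le (i : ℕ) : Real.log (catalan i) ≤ 2 * i * Real.log 2 := by
  have h1 : catalan i ≤ 4 ^ i := by
    have h := succ_mul_catalan_eq_centralBinom i
    have h2 := Nat.centralBinom_le_four_pow i
    nlinarith
  have h2 : Real.log (catalan i) ≤ Real.log ((2 : ℝ) ^ (2 * i)) := by
    apply Real.log_le_log (by exact_mod_cast catalan_pos i)
    rw [pow_mul]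
    norm_num
    exact_mod_cast h1
  rw [Real.log_pow] at h2
  exact_mod_cast h2

lemma le_log_catalan {i n : ℕ} (hi : 0 < i) (hn : i ≤ n) :
    2 * i * Real.log 2 - 2 * Real.log (2 * n) ≤ Real.log (catalan i) := by
  have h := succ_mul_catalan_eq_centralBinom i
  have h2 := Nat.four_pow_le_two_mul_self_mul_centralBinom i hi
  have h1 : 4 ^ i ≤ (2 * n) ^ 2 * catalan i := by
    have : (i + 1) * (2 * i) ≤ (2 * n) ^ 2 := by nlinarith
    calc 4 ^ i ≤ 2 * i * ((i + 1) * catalan i) := by rw [h]; exact h2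
      _ = (i + 1) * (2 * i) * catalan i := by ring
      _ ≤ _ := Nat.mul_le_mul_right _ this
  have hc : (0 : ℝ) < catalan i := by exact_mod_cast catalan_pos i
  have hn0 : (0 : ℝ) < 2 * n := by have : 0 < n := by omega
                                   positivity
  have h3 : Real.log ((2 : ℝ) ^ (2 * i)) ≤ Real.log ((2 * n : ℝ) ^ 2 * catalan i) := by
    apply Real.log_le_log (by positivity)
    rw [pow_mul]
    norm_num
    exact_mod_cast h1
  rw [Real.log_pow, Real.log_mul (by positivity) hc.ne', Real.log_pow] at h3
  push_cast at h3
  linarith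

lemma sum_two_mul_log_two (n : ℕ) :
    ∑ i ∈ Icc 1 n, 2 * (i : ℝ) * Real.log 2 = n * (n + 1) * Real.log 2 := by
  induction n with
  | zero => simp
  | succ n ih => rw [sum_Icc_succ_top (by omega), ih]; push_cast; ring

lemma sum_log_catalan_le (n : ℕ) :
    ∑ i ∈ Icc 1 n, Real.log (catalan i) ≤ n * (n + 1) * Real.log 2 := by
  rw [← sum_two_mul_log_two]
  exact sum_le_sum fun i _ => log_catalan_le i

lemma le_sum_log_catalan (n : ℕ) :
    n * (n + 1) * Real.log 2 - 2 * n * Real.log (2 * n) ≤ ∑ i ∈ Icc 1 n, Real.log (catalan i) := by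
  have : (2 * n * Real.log (2 * n) : ℝ) = ∑ i ∈ Icc 1 n, 2 * Real.log (2 * n) := by
    simp; ring
  rw [← sum_two_mul_log_two, this, ← sum_sub_distrib]
  exact sum_le_sum fun i hi => le_log_catalan (mem_Icc.1 hi).1 (mem_Icc.1 hi).2

lemma tendsto_sum_log_catalan :
    Tendsto (fun n : ℕ => (∑ i ∈ Icc 1 n, Real.log (catalan i)) / ((n : ℝ) ^ 2 * Real.log 2))
      atTop (nhds 1) := by
  have hl : 0 < Real.log 2 := Real.log_pos (by norm_num)
  have hinv : Tendsto (fun n : ℕ => 1 / (n : ℝ)) atTop (nhds 0) :=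
    tendsto_one_div_atTop_nhds_zero_nat
  have hlog : Tendsto (fun n : ℕ => Real.log (2 * n) / (2 * n : ℝ)) atTop (nhds 0) := by
    have h := Real.isLittleO_log_id_atTop.tendsto_div_nhds_zero
    exact h.comp (tendsto_natCast_atTop_atTop.const_mul_atTop (by norm_num : (0 : ℝ) < 2))
  have hup : Tendsto (fun n : ℕ => 1 + 1 / (n : ℝ)) atTop (nhds 1) := by
    simpa using hinv.const_add 1
  have hlow : Tendsto (fun n : ℕ => 1 + 1 / (n : ℝ) -
      4 / Real.log 2 * (Real.log (2 * n) / (2 * n : ℝ))) atTop (nhds 1) := by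
    simpa using hup.sub (hlog.const_mul (4 / Real.log 2))
  refine tendsto_of_tendsto_of_tendsto_of_le_of_le' hlow hup ?_ ?_
  · filter_upwards [eventually_gt_atTop 0] with n hn
    have hn : (0 : ℝ) < n := by exact_mod_cast hn
    rw [le_div_iff₀ (by positivity)]
    refine le_trans (le_of_eq ?_) (le_sum_log_catalan n)
    field_simp
    ring
  · filter_upwards [eventually_gt_atTop 0] with n hn
    have hn : (0 : ℝ) < n := by exact_mod_cast hn
    rw [div_le_iff₀ (by positivity)]
    refine (sum_log_catalan_le n).trans (le_of_eq ?_)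
    field_simp

end Tesler

/-- `L(1,2,…,n) ∼ n²·ln 2`, and `L(1,2,…,n) = Σ_{i=1}^n ln Cᵢ` where `Cᵢ` is the
`i`-th Catalan number. -/
theorem L_onetoN_asymp :
    Tendsto (fun n : ℕ =>
        LTes (fun k : Fin n => ((k : ℕ) : ℤ) + 1) / ((n : ℝ) ^ 2 * Real.log 2))
      atTop (nhds 1) ∧
    ∀ n : ℕ, LTes (fun k : Fin n => ((k : ℕ) : ℤ) + 1) =
      ∑ i ∈ Finset.Icc 1 n, Real.log (catalan i) := by
  refine ⟨?_, Tesler.LTes_eq_sum_log_catalan⟩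
  simp only [Tesler.LTes_eq_sum_log_catalan]
  exact Tesler.tendsto_sum_log_catalan
end
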